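/- Let F be a field, let k be a field of characteristic p > 0, and let n be a positive integer. The following assertions are equivalent: (1) for every field extension K/F, every continuous homomorphism Γ_K → GL_n(k) lifts to W₂(k), i.e. there is a continuous homomorphism Γ_K → GL_n(W₂(k)) whose composite with π is the given one; (2) for every field extension K/F, every continuous homomorphism Γ_K → B_n(k) lifts to W₂(k), i.e. there is a continuous homomorphism Γ_K → B_n(W₂(k)) whose composite with π is the given one; (3) at least one of the following holds: F has characteristic p, or n ≤ 2, or k has exactly two elements and n ≤ 4. -/

import Mathlib

open Matrix Topology

/-- The reduction ring homomorphism `π : W₂(k) → k` from the ring of `p`-typical length-`2`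
Witt vectors of `k` to `k`, given by the zeroth Witt coefficient. -/
noncomputable def wittReduce (p : ℕ) [hp : Fact p.Prime] (k : Type*) [CommRing k] :
    TruncatedWittVector p 2 k →+* k where
  toFun x := x.coeff 0
  map_one' := by
    show TruncatedWittVector.coeff 0 (1 : TruncatedWittVector p 2 k) = 1
    rw [show (1 : TruncatedWittVector p 2 k) = WittVector.truncate 2 (1 : WittVector p k) from
        (_root_.map_one _).symm, WittVector.coeff_truncate]
    simpa using WittVector.one_coeff_zero p k
  map_mul' x y := by
    show TruncatedWittVector.coeff 0 (x * y)
        = TruncatedWittVector.coeff 0 x * TruncatedWittVector.coeff 0 y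
    obtain ⟨a, ha⟩ := WittVector.truncate_surjective (p := p) 2 k x
    obtain ⟨b, hb⟩ := WittVector.truncate_surjective (p := p) 2 k y
    rw [← ha, ← hb, ← _root_.map_mul, WittVector.coeff_truncate, WittVector.coeff_truncate,
      WittVector.coeff_truncate]
    simpa using WittVector.mul_coeff_zero a b
  map_zero' := by
    show TruncatedWittVector.coeff 0 (0 : TruncatedWittVector p 2 k) = 0
    rw [show (0 : TruncatedWittVector p 2 k) = WittVector.truncate 2 (0 : WittVector p k) from
        (_root_.map_zero _).symm, WittVector.coeff_truncate]
    simpa using WittVector.zero_coeff p k 0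
  map_add' x y := by
    show TruncatedWittVector.coeff 0 (x + y)
        = TruncatedWittVector.coeff 0 x + TruncatedWittVector.coeff 0 y
    obtain ⟨a, ha⟩ := WittVector.truncate_surjective (p := p) 2 k x
    obtain ⟨b, hb⟩ := WittVector.truncate_surjective (p := p) 2 k y
    rw [← ha, ← hb, ← _root_.map_add, WittVector.coeff_truncate, WittVector.coeff_truncate,
      WittVector.coeff_truncate]
    simpa using WittVector.add_coeff_zero a b

/-- `B_n(R)`: the Borel subgroup of `GL_n(R)` consisting of the invertible upper-triangular
`n × n` matrices over `R`. -/
def BorelSubgroup (n : ℕ) (R : Type*) [CommRing R] : Subgroup (GL (Fin n) R) where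
  carrier := {A | ((A : Matrix (Fin n) (Fin n) R)).BlockTriangular id}
  one_mem' := by
    show ((1 : GL (Fin n) R) : Matrix (Fin n) (Fin n) R).BlockTriangular id
    simpa using Matrix.blockTriangular_one
  mul_mem' := by
    intro A B hA hB
    show ((A * B : GL (Fin n) R) : Matrix (Fin n) (Fin n) R).BlockTriangular id
    simpa [Units.val_mul] using hA.mul hB
  inv_mem' := by
    intro A hA
    show ((A⁻¹ : GL (Fin n) R) : Matrix (Fin n) (Fin n) R).BlockTriangular id
    rw [Matrix.coe_units_inv]
    letI := A.invertible
    exact Matrix.blockTriangular_inv_of_blockTriangular hA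

/-- The group homomorphism `B_n(R) → B_n(S)` induced by a ring homomorphism `R → S`. -/
def BorelSubgroup.map {n : ℕ} {R S : Type*} [CommRing R] [CommRing S] (f : R →+* S) :
    BorelSubgroup n R →* BorelSubgroup n S where
  toFun A := ⟨Matrix.GeneralLinearGroup.map f A.1, by
    have hA := A.2
    intro i j hij
    show ((Matrix.GeneralLinearGroup.map f A.1 : GL (Fin n) S) : Matrix (Fin n) (Fin n) S) i j = 0
    show ((A.1 : Matrix (Fin n) (Fin n) R).map f) i j = 0
    rw [Matrix.map_apply, hA hij, map_zero]⟩
  map_one' := Subtype.ext (_root_.map_one _)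
  map_mul' A B := Subtype.ext (_root_.map_mul _ _ _)

set_option linter.unusedSectionVars false
set_option linter.unusedSimpArgs false

/-- The properties of `W₂(k)` that matter for lifting: the kernel of `π : W → k` is the image of
an additive copy `v` of `k`, on which `W` acts through the Frobenius twist. -/
structure IsW2 (p : ℕ) {k W : Type*} [Field k] [CommRing W] (π : W →+* k) (v : k →+ W) :
    Prop where
  surjective : Function.Surjective π
  injective : Function.Injective v
  exists_of_map_eq_zero : ∀ x, π x = 0 → ∃ b, v b = x
  map_v : ∀ b, π (v b) = 0
  mul_v : ∀ x b, x * v b = v (π x ^ p * b)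
  natCast_mul : ∀ x, (p : W) * x = v (π x ^ p)

section WittTwo

variable (p : ℕ) [Fact p.Prime] (k : Type*) [Field k] [CharP k p]

/-- Verschiebung as a map `k → W₂(k)`. -/
noncomputable def wittVerschiebung : k →+ TruncatedWittVector p 2 k where
  toFun b := WittVector.truncate 2 (WittVector.verschiebung (WittVector.teichmuller p b))
  map_zero' := by simp
  map_add' a b := by
    rw [← map_add, ← map_add]
    ext i
    rw [WittVector.coeff_truncate, WittVector.coeff_truncate]
    fin_cases i
    · change (WittVector.verschiebung _).coeff 0 = (WittVector.verschiebung _).coeff 0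
      rw [WittVector.verschiebung_coeff_zero, WittVector.verschiebung_coeff_zero]
    · change (WittVector.verschiebung _).coeff (0 + 1) = (WittVector.verschiebung _).coeff (0 + 1)
      rw [WittVector.verschiebung_coeff_add_one, WittVector.verschiebung_coeff_add_one,
        WittVector.add_coeff_zero]
      simp

theorem truncate_verschiebung (x : WittVector p k) :
    WittVector.truncate 2 (WittVector.verschiebung x) = wittVerschiebung p k (x.coeff 0) := by
  change _ = WittVector.truncate 2 (WittVector.verschiebung (WittVector.teichmuller p _))
  ext i
  rw [WittVector.coeff_truncate, WittVector.coeff_truncate]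
  fin_cases i
  · simp
  · simp

theorem wittReduce_truncate (x : WittVector p k) :
    wittReduce p k (WittVector.truncate 2 x) = x.coeff 0 :=
  WittVector.coeff_truncate x 0

theorem isW2_wittReduce : IsW2 p (wittReduce p k) (wittVerschiebung p k) where
  surjective b := ⟨WittVector.truncate 2 (WittVector.teichmuller p b), by
    rw [wittReduce_truncate, WittVector.teichmuller_coeff_zero]⟩
  injective a b h := by
    have := congrArg (TruncatedWittVector.coeff (p := p) (n := 2) 1) h
    change TruncatedWittVector.coeff 1 (WittVector.truncate 2
        (WittVector.verschiebung (WittVector.teichmuller p a))) =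
      TruncatedWittVector.coeff 1 (WittVector.truncate 2
        (WittVector.verschiebung (WittVector.teichmuller p b))) at this
    rw [WittVector.coeff_truncate, WittVector.coeff_truncate] at this
    simpa using this
  exists_of_map_eq_zero x hx := by
    obtain ⟨y, rfl⟩ := WittVector.truncate_surjective (p := p) 2 k x
    rw [wittReduce_truncate] at hx
    refine ⟨y.coeff 1, ?_⟩
    change WittVector.truncate 2 (WittVector.verschiebung (WittVector.teichmuller p _)) = _
    ext i
    rw [WittVector.coeff_truncate, WittVector.coeff_truncate]
    fin_cases i
    · simp [hx]
    · simp
  map_v b := by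
    change wittReduce p k (WittVector.truncate 2
      (WittVector.verschiebung (WittVector.teichmuller p b))) = 0
    rw [wittReduce_truncate, WittVector.verschiebung_coeff_zero]
  mul_v x b := by
    obtain ⟨y, rfl⟩ := WittVector.truncate_surjective (p := p) 2 k x
    change _ * WittVector.truncate 2 (WittVector.verschiebung _) = _
    rw [wittReduce_truncate, ← map_mul, mul_comm, ← WittVector.verschiebung_mul_frobenius,
      truncate_verschiebung, WittVector.mul_coeff_zero, WittVector.coeff_frobenius_charP,
      WittVector.teichmuller_coeff_zero, mul_comm]
  natCast_mul x := by
    obtain ⟨y, rfl⟩ := WittVector.truncate_surjective (p := p) 2 k x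
    rw [wittReduce_truncate, ← WittVector.coeff_frobenius_charP, ← truncate_verschiebung,
      WittVector.verschiebung_frobenius, map_mul, map_natCast, mul_comm]

end WittTwo

namespace IsW2

variable {p : ℕ} [Fact p.Prime] {k W : Type*} [Field k] [CharP k p] [CommRing W]
  {π : W →+* k} {v : k →+ W}
  {m n l : Type*} [Fintype m] [Fintype n] [Fintype l]

theorem mul_mapv (h : IsW2 p π v) (Y : Matrix m n W) (X : Matrix n l k) :
    Y * X.map v = ((Y.map π).map (frobenius k p) * X).map v := by
  ext i j
  simp [Matrix.mul_apply, h.mul_v, frobenius_def, map_sum]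

theorem mapv_mul (h : IsW2 p π v) (X : Matrix m n k) (Y : Matrix n l W) :
    X.map v * Y = (X * (Y.map π).map (frobenius k p)).map v := by
  ext i j
  simp [Matrix.mul_apply, mul_comm (v _), h.mul_v, frobenius_def, map_sum, mul_comm (X _ _)]

theorem mapv_map (h : IsW2 p π v) (X : Matrix m n k) : (X.map v).map π = 0 := by
  ext i j; simp [h.map_v]

theorem mapv_mul_mapv (h : IsW2 p π v) (X : Matrix m n k) (Y : Matrix n l k) : X.map v * Y.map v = 0 := by
  rw [h.mul_mapv, h.mapv_map]
  ext i j; simp [Matrix.mul_apply]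

theorem mapv_injective (h : IsW2 p π v) : Function.Injective (fun X : Matrix m n k => X.map v) :=
  fun X Y hXY => by
    ext i j
    exact h.injective (congrFun (congrFun hXY i) j)

theorem exists_mapv (h : IsW2 p π v) (A B : Matrix m n W) (hAB : A.map π = B.map π) :
    ∃ X : Matrix m n k, A = B + X.map v := by
  have : ∀ i j, ∃ b, v b = A i j - B i j := fun i j =>
    h.exists_of_map_eq_zero _ (by
      have := congrFun (congrFun hAB i) j
      simp only [Matrix.map_apply] at this
      rw [map_sub, this, sub_self])
  choose X hX using this
  exact ⟨Matrix.of X, by ext i j; simp [hX]⟩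

theorem natCast_sq (h : IsW2 p π v) : ((p ^ 2 : ℕ) : W) = 0 := by
  rw [Nat.cast_pow, sq, h.natCast_mul, map_natCast, CharP.cast_eq_zero,
    zero_pow (Fact.out : p.Prime).ne_zero, map_zero]

theorem isUnit_of_map (h : IsW2 p π v) {x : W} (hx : π x ≠ 0) : IsUnit x := by
  obtain ⟨y, hy⟩ := h.surjective (π x)⁻¹
  have h1 : π (x * y - 1) = 0 := by rw [map_sub, map_mul, hy, mul_inv_cancel₀ hx, map_one, sub_self]
  obtain ⟨b, hb⟩ := h.exists_of_map_eq_zero _ h1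
  have : x * y = 1 + v b := by rw [hb]; ring
  have h2 : v b * v b = 0 := by
    rw [h.mul_v, h.map_v, zero_pow (Fact.out : p.Prime).ne_zero, zero_mul, map_zero]
  refine IsUnit.of_mul_eq_one (y * (1 - v b)) ?_
  rw [← mul_assoc, this]
  linear_combination -h2

variable [DecidableEq n]

theorem isUnit_of_map_matrix (h : IsW2 p π v) {A : Matrix n n W} (hA : IsUnit (A.map π)) : IsUnit A := by
  rw [Matrix.isUnit_iff_isUnit_det] at hA ⊢
  have : (A.map π).det = π A.det := by
    rw [RingHom.map_det]; rfl
  rw [this] at hA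
  exact h.isUnit_of_map hA.ne_zero

/-- The element `1 + v(X)` of `GL_n(W)`. -/
noncomputable def kerElem (h : IsW2 p π v) (X : Matrix n n k) : GL n W :=
  ⟨1 + X.map v, 1 - X.map v, by
    rw [mul_sub, mul_one, add_mul, one_mul, h.mapv_mul_mapv]; abel, by
    rw [mul_add, mul_one, sub_mul, one_mul, h.mapv_mul_mapv]; abel⟩

@[simp] theorem coe_kerElem (h : IsW2 p π v) (X : Matrix n n k) : (h.kerElem X : Matrix n n W) = 1 + X.map v := rfl

theorem kerElem_add (h : IsW2 p π v) (X Y : Matrix n n k) : h.kerElem (X + Y) = h.kerElem X * h.kerElem Y := by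
  ext1
  rw [Units.val_mul]
  simp only [coe_kerElem, mul_add, add_mul, one_mul, mul_one, h.mapv_mul_mapv]
  rw [Matrix.map_add _ (map_add v)]
  abel

theorem kerElem_zero (h : IsW2 p π v) : h.kerElem (0 : Matrix n n k) = 1 := by
  ext1; simp [Matrix.map_zero]

theorem kerElem_injective (h : IsW2 p π v) : Function.Injective (h.kerElem : Matrix n n k → GL n W) := by
  intro X Y hXY
  have := congrArg Units.val hXY
  simp only [coe_kerElem, add_right_inj] at this
  exact h.mapv_injective this

theorem map_kerElem (h : IsW2 p π v) (X : Matrix n n k) : GeneralLinearGroup.map π (h.kerElem X) = 1 := by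
  ext1
  change ((1 + X.map v : Matrix n n W).map π) = 1
  rw [Matrix.map_add _ (map_add π), h.mapv_map, Matrix.map_one _ (map_zero π) (map_one π), add_zero]

theorem exists_kerElem (h : IsW2 p π v) {A : GL n W} (hA : GeneralLinearGroup.map π A = 1) :
    ∃ X, A = h.kerElem X := by
  have : (A : Matrix n n W).map π = (1 : Matrix n n W).map π := by
    rw [Matrix.map_one _ (map_zero π) (map_one π)]
    exact congrArg Units.val hA
  obtain ⟨X, hX⟩ := h.exists_mapv _ _ this
  exact ⟨X, Units.ext hX⟩

end IsW2

/-- A surjection `pr : E → Q` whose kernel is (via `ι`) an abelian group `A` of exponent `p`. -/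
structure IsAbExt (p : ℕ) {E Q A : Type*} [Group E] [Group Q] [AddCommGroup A]
    (pr : E →* Q) (ι : Multiplicative A →* E) : Prop where
  surjective : Function.Surjective pr
  injective : Function.Injective ι
  exists_of_map_eq_one : ∀ e, pr e = 1 → ∃ a, ι a = e
  map_ι : ∀ a, pr (ι a) = 1
  nsmul_eq_zero : ∀ a : A, p • a = 0

namespace IsAbExt

variable {p : ℕ} {E Q A : Type*} [Group E] [Group Q] [AddCommGroup A]
  {pr : E →* Q} {ι : Multiplicative A →* E}

theorem exists_conj (h : IsAbExt p pr ι) (e : E) (a : A) :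
    ∃ b : A, ι (.ofAdd b) = e * ι (.ofAdd a) * e⁻¹ :=
  h.exists_of_map_eq_one _ (by simp [h.map_ι])

/-- The action of `E` on the kernel by conjugation. -/
noncomputable def act (h : IsAbExt p pr ι) (e : E) : A →+ A :=
  AddMonoidHom.mk' (fun a => (h.exists_conj e a).choose) fun a b => by
    apply Multiplicative.ofAdd.injective
    apply h.injective
    refine (h.exists_conj e (a + b)).choose_spec.trans ?_
    change _ = ι (.ofAdd (h.exists_conj e a).choose * .ofAdd (h.exists_conj e b).choose)
    rw [map_mul, (h.exists_conj e a).choose_spec, (h.exists_conj e b).choose_spec, ofAdd_add,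
      map_mul]
    group

theorem ι_act (h : IsAbExt p pr ι) (e : E) (a : A) :
    ι (.ofAdd (h.act e a)) = e * ι (.ofAdd a) * e⁻¹ :=
  (h.exists_conj e a).choose_spec

theorem ι_inj (h : IsAbExt p pr ι) {a b : A} (hab : ι (.ofAdd a) = ι (.ofAdd b)) : a = b :=
  Multiplicative.ofAdd.injective (h.injective hab)

theorem act_mul (h : IsAbExt p pr ι) (e f : E) (a : A) :
    h.act (e * f) a = h.act e (h.act f a) := by
  apply h.ι_inj
  simp only [h.ι_act]
  group

theorem act_ι (h : IsAbExt p pr ι) (b a : A) : h.act (ι (.ofAdd b)) a = a := by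
  apply h.ι_inj
  rw [h.ι_act, ← map_mul, mul_comm, map_mul]
  group

theorem act_eq (h : IsAbExt p pr ι) {e f : E} (hef : pr e = pr f) (a : A) :
    h.act e a = h.act f a := by
  obtain ⟨b, hb⟩ := h.exists_of_map_eq_one (e * f⁻¹) (by simp [hef])
  have : e = ι (.ofAdd (Multiplicative.toAdd b)) * f := by
    rw [ofAdd_toAdd, hb]; group
  rw [this, h.act_mul, h.act_ι]

variable {Γ : Type*} [Group Γ]

/-- A set-theoretic lift of a homomorphism to `Q` differs from being multiplicative by a
`2`-cocycle. -/
theorem exists_cocycle (h : IsAbExt p pr ι) (ρ : Γ →* Q) (s : Γ → E) (hs : ∀ γ, pr (s γ) = ρ γ) :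
    ∃ c : Γ → Γ → A, (∀ γ δ, ι (.ofAdd (c γ δ)) = s γ * s δ * (s (γ * δ))⁻¹) ∧
      ∀ γ δ ε, h.act (s γ) (c δ ε) + c γ (δ * ε) = c γ δ + c (γ * δ) ε := by
  have : ∀ γ δ, ∃ a : A, ι (.ofAdd a) = s γ * s δ * (s (γ * δ))⁻¹ := fun γ δ =>
    h.exists_of_map_eq_one _ (by simp [hs])
  choose c hc using this
  refine ⟨c, hc, fun γ δ ε => ?_⟩
  apply h.ι_inj
  rw [ofAdd_add, ofAdd_add, map_mul, map_mul, h.ι_act, hc, hc, hc, hc, mul_assoc γ]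
  group

theorem exists_lift (h : IsAbExt p pr ι) (ρ : Γ →* Q) (s : Γ → E) (hs : ∀ γ, pr (s γ) = ρ γ)
    (c : Γ → Γ → A) (hc : ∀ γ δ, ι (.ofAdd (c γ δ)) = s γ * s δ * (s (γ * δ))⁻¹)
    (β : Γ → A) (hβ : ∀ γ δ, β γ + h.act (s γ) (β δ) - β (γ * δ) = c γ δ) :
    ∃ ρ' : Γ →* E, (∀ γ, ρ' γ = ι (.ofAdd (-β γ)) * s γ) ∧ pr.comp ρ' = ρ := by
  refine ⟨MonoidHom.mk' (fun γ => ι (.ofAdd (-β γ)) * s γ) fun γ δ => ?_, fun γ => rfl, ?_⟩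
  · have e1 : s γ * ι (.ofAdd (-β δ)) = ι (.ofAdd (-h.act (s γ) (β δ))) * s γ := by
      rw [← map_neg, h.ι_act]; group
    have e2 : s γ * s δ = ι (.ofAdd (c γ δ)) * s (γ * δ) := by rw [hc]; group
    calc ι (.ofAdd (-β (γ * δ))) * s (γ * δ)
        = ι (.ofAdd (-β γ + -h.act (s γ) (β δ) + c γ δ)) * s (γ * δ) := by
          rw [← hβ]; congr 3; abel
      _ = ι (.ofAdd (-β γ)) * ι (.ofAdd (-h.act (s γ) (β δ))) * (s γ * s δ) := by
          rw [e2, ofAdd_add, ofAdd_add, map_mul, map_mul]; group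
      _ = ι (.ofAdd (-β γ)) * s γ * (ι (.ofAdd (-β δ)) * s δ) := by
          rw [mul_assoc _ (s γ), ← mul_assoc (s γ), e1]; group
  · ext γ
    simp [h.map_ι, hs]

/-- Gaschütz: a homomorphism lifts as soon as its restriction to a subgroup of index prime to `p`
lifts. -/
theorem exists_lift_of_index [Fact p.Prime] (h : IsAbExt p pr ι) (U : Subgroup Γ) [U.FiniteIndex]
    (hU : ¬ p ∣ U.index) (ρ : Γ →* Q) (σ : U →* E) (hσ : ∀ u : U, pr (σ u) = ρ u) :
    ∃ ρ' : Γ →* E, pr.comp ρ' = ρ ∧ ∀ N : Subgroup Γ, N.Normal → N ≤ U →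
      (∀ u : U, (u : Γ) ∈ N → σ u = 1) → ∀ γ ∈ N, ρ' γ = 1 := by
  choose sec hsec using h.surjective
  have hmem : ∀ γ : Γ, (γ : Γ ⧸ U).out⁻¹ * γ ∈ U := fun γ =>
    QuotientGroup.eq.1 (QuotientGroup.out_eq' (γ : Γ ⧸ U))
  let s : Γ → E := fun γ => sec (ρ (γ : Γ ⧸ U).out) * σ ⟨_, hmem γ⟩
  have hs : ∀ γ, pr (s γ) = ρ γ := fun γ => by
    simp only [s, map_mul, hsec, hσ, map_inv]; group
  have hsu : ∀ γ (u : U), s (γ * u) = s γ * σ u := fun γ u => by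
    have : ((γ * u : Γ) : Γ ⧸ U) = (γ : Γ ⧸ U) := by
      rw [QuotientGroup.eq]; simp
    simp only [s]
    rw [mul_assoc, ← map_mul]
    congr 2
    · rw [this]
    · ext; simp [this, mul_assoc]
  obtain ⟨c, hc, hcc⟩ := h.exists_cocycle ρ s hs
  have hcu : ∀ γ δ (u : U), c γ (δ * u) = c γ δ := fun γ δ u => h.ι_inj (by
    rw [hc, hc, ← mul_assoc γ, hsu, hsu]; group)
  have hout : ∀ γ δ : Γ, c γ (δ : Γ ⧸ U).out = c γ δ := fun γ δ => by
    have := hcu γ (δ : Γ ⧸ U).out ⟨_, hmem δ⟩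
    rw [← this]; simp
  let _ : Fintype (Γ ⧸ U) := Fintype.ofFinite _
  let S : Γ → A := fun γ => ∑ q : Γ ⧸ U, c γ q.out
  have hcard : Fintype.card (Γ ⧸ U) = U.index := by
    rw [← Nat.card_eq_fintype_card]; rfl
  have hS : ∀ γ δ, h.act (s γ) (S δ) + S γ = U.index • c γ δ + S (γ * δ) := fun γ δ => by
    have e1 : S γ = ∑ q : Γ ⧸ U, c γ (δ * q.out) := by
      refine (Equiv.sum_comp (MulAction.toPerm δ : Equiv.Perm (Γ ⧸ U))
        fun q => c γ q.out).symm.trans ?_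
      refine Finset.sum_congr rfl fun q _ => ?_
      rw [← hout γ (δ * q.out)]
      congr 2
      conv_lhs => rw [← QuotientGroup.out_eq' q]
      rfl
    rw [e1, map_sum, ← Finset.sum_add_distrib]
    simp only [hcc]
    rw [Finset.sum_add_distrib, Finset.sum_const, Finset.card_univ, hcard]
  obtain ⟨m, hm⟩ : ∃ m : ℕ, m * U.index ≡ 1 [MOD p] := by
    have := Nat.exists_mul_mod_eq_one_of_coprime
      ((Nat.Prime.coprime_iff_not_dvd Fact.out).2 hU).symm (Fact.out : p.Prime).one_lt
    obtain ⟨m, -, hm⟩ := this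
    exact ⟨m, by rw [mul_comm]; rw [Nat.ModEq, hm, Nat.mod_eq_of_lt (Fact.out : p.Prime).one_lt]⟩
  have hmA : ∀ a : A, (m * U.index) • a = a := fun a => by
    rw [← Nat.div_add_mod (m * U.index) p, hm, Nat.mod_eq_of_lt (Fact.out : p.Prime).one_lt,
      add_nsmul, mul_nsmul, h.nsmul_eq_zero, nsmul_zero, zero_add, one_nsmul]
  obtain ⟨ρ', hρ', hpr⟩ := h.exists_lift ρ s hs c hc (fun γ => m • S γ) fun γ δ => by
    rw [map_nsmul, ← nsmul_add, add_comm, hS, nsmul_add, add_sub_cancel_right, ← mul_nsmul',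
      hmA]
  refine ⟨ρ', hpr, fun N hN hNU hσN γ hγ => ?_⟩
  have h1 : ∀ δ, s (γ * δ) = s δ := fun δ => by
    have hmem' : δ⁻¹ * γ * δ ∈ N := by simpa using hN.conj_mem γ hγ δ⁻¹
    have := hsu δ ⟨δ⁻¹ * γ * δ, hNU hmem'⟩
    rw [hσN _ hmem', mul_one] at this
    rw [← this]
    congr 1
    simp [mul_assoc]
  have h2 : ∀ δ, ι (.ofAdd (c γ δ)) = s γ := fun δ => by rw [hc, h1]; group
  have h3 : m • S γ = c γ 1 := by
    have : S γ = U.index • c γ 1 := by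
      have : ∀ q : Γ ⧸ U, c γ q.out = c γ 1 := fun q => h.ι_inj (by rw [h2, h2])
      simp only [S, this]
      rw [Finset.sum_const, Finset.card_univ, hcard]
    rw [this, ← mul_nsmul', hmA]
  rw [hρ', h3, ofAdd_neg, map_inv, h2]
  group

end IsAbExt

theorem Subgroup.apply_out_eq {Γ X : Type*} [Group Γ] (N : Subgroup Γ) (f : Γ → X)
    (hf : ∀ γ, ∀ n ∈ N, f (γ * n) = f γ) (γ : Γ) : f (γ : Γ ⧸ N).out = f γ := by
  have hmem : (γ : Γ ⧸ N).out⁻¹ * γ ∈ N := QuotientGroup.eq.1 (QuotientGroup.out_eq' (γ : Γ ⧸ N))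
  rw [← hf _ _ hmem]
  simp

theorem Subgroup.sum_mul_out {Γ X : Type*} [Group Γ] [AddCommMonoid X] (N : Subgroup Γ)
    [Fintype (Γ ⧸ N)] (f : Γ → X) (hf : ∀ γ, ∀ n ∈ N, f (γ * n) = f γ) (τ : Γ) :
    ∑ q : Γ ⧸ N, f (τ * q.out) = ∑ q : Γ ⧸ N, f q.out := by
  refine Eq.trans (Finset.sum_congr rfl fun q _ => ?_)
    (Equiv.sum_comp (MulAction.toPerm τ : Equiv.Perm (Γ ⧸ N)) fun q => f q.out)
  rw [← N.apply_out_eq f hf (τ * q.out)]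
  congr 2
  conv_rhs => rw [← QuotientGroup.out_eq' q]
  rfl

section ArtinSchreier

open TensorProduct

variable (p : ℕ) [Fact p.Prime] (Ω : Type*) [Field Ω] [CharP Ω p] [Algebra (ZMod p) Ω]
  (A : Type*) [AddCommGroup A] [Module (ZMod p) A]

/-- The Frobenius of `Ω` acting on `Ω ⊗ A`. -/
noncomputable def frobeniusTensor : Ω ⊗[ZMod p] A →ₗ[ZMod p] Ω ⊗[ZMod p] A :=
  LinearMap.rTensor A ((frobenius Ω p).toAddMonoidHom.toZModLinearMap p)

theorem frobeniusTensor_tmul (x : Ω) (a : A) : frobeniusTensor p Ω A (x ⊗ₜ a) = (x ^ p) ⊗ₜ a := rfl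

theorem frobeniusTensor_sub_surjective [IsAlgClosed Ω] (m : Ω ⊗[ZMod p] A) :
    ∃ m', frobeniusTensor p Ω A m' - m' = m := by
  induction m with
  | zero => exact ⟨0, by simp⟩
  | tmul x a =>
    have hp := (Fact.out : p.Prime).one_lt
    obtain ⟨z, hz⟩ := IsAlgClosed.exists_root
      (Polynomial.X ^ p - Polynomial.X - Polynomial.C x : Polynomial Ω) (by
        have : (Polynomial.X ^ p - Polynomial.X - Polynomial.C x : Polynomial Ω).degree = p := by
          rw [sub_sub, Polynomial.degree_sub_eq_left_of_degree_lt] <;>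
            rw [Polynomial.degree_X_pow]
          rw [Polynomial.degree_X_add_C]
          exact_mod_cast hp
        rw [this]
        exact_mod_cast (Fact.out : p.Prime).ne_zero)
    refine ⟨z ⊗ₜ a, ?_⟩
    rw [frobeniusTensor_tmul, ← TensorProduct.sub_tmul]
    congr 1
    simpa [sub_eq_zero] using hz
  | add x y hx hy =>
    obtain ⟨x', rfl⟩ := hx
    obtain ⟨y', rfl⟩ := hy
    exact ⟨x' + y', by rw [map_add]; abel⟩

theorem exists_tmul_of_frobeniusTensor_eq (m : Ω ⊗[ZMod p] A) (hm : frobeniusTensor p Ω A m = m) :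
    ∃ a : A, m = 1 ⊗ₜ a := by
  classical
  let bA := Module.Basis.ofVectorSpace (ZMod p) A
  let e := TensorProduct.equivFinsuppOfBasisRight (M := Ω) bA
  have hfr : ∀ (x : Ω ⊗[ZMod p] A) i, e (frobeniusTensor p Ω A x) i = (e x i) ^ p := by
    intro x i
    induction x with
    | zero => simp [(Fact.out : p.Prime).ne_zero]
    | tmul x a =>
      rw [frobeniusTensor_tmul, TensorProduct.equivFinsuppOfBasisRight_apply_tmul_apply,
        TensorProduct.equivFinsuppOfBasisRight_apply_tmul_apply, smul_pow, ZMod.pow_card]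
    | add x y hx hy =>
      rw [map_add, map_add, map_add, Finsupp.add_apply, Finsupp.add_apply, hx, hy, add_pow_char]
  have hz : ∀ i, ∃ z : ZMod p, algebraMap (ZMod p) Ω z = e m i := by
    intro i
    have h1 : e m i ∈ (⊥ : Subfield Ω) := by
      rw [Subfield.mem_bot_iff_pow_eq_self Ω p, ← hfr, hm]
    have h2 : (⊥ : Subfield Ω) ≤ (algebraMap (ZMod p) Ω).fieldRange := bot_le
    exact h2 h1
  choose z hz using hz
  have hz0 : ∀ i, z i ≠ 0 → i ∈ (e m).support := fun i hi => by
    rw [Finsupp.mem_support_iff, ← hz]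
    simpa using hi
  refine ⟨bA.repr.symm (Finsupp.onFinset (e m).support z hz0), ?_⟩
  apply e.injective
  ext i
  rw [TensorProduct.equivFinsuppOfBasisRight_apply_tmul_apply, LinearEquiv.apply_symm_apply,
    Finsupp.onFinset_apply, Algebra.smul_def, mul_one, hz]

theorem one_tmul_injective : Function.Injective fun a : A => (1 : Ω) ⊗ₜ[ZMod p] a := by
  classical
  intro a b hab
  let bA := Module.Basis.ofVectorSpace (ZMod p) A
  apply bA.repr.injective
  ext i
  have := congrArg (fun m => TensorProduct.equivFinsuppOfBasisRight (M := Ω) bA m i) hab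
  simp only [TensorProduct.equivFinsuppOfBasisRight_apply_tmul_apply, Algebra.smul_def,
    mul_one] at this
  exact (algebraMap (ZMod p) Ω).injective this

end ArtinSchreier

namespace IsAbExt

open TensorProduct

variable {p : ℕ} {E Q A : Type*} [Group E] [Group Q] [AddCommGroup A]
  {pr : E →* Q} {ι : Multiplicative A →* E} {Γ : Type*} [Group Γ]

theorem exists_lift_of_charP_aux [Module (ZMod p) A] {Ω : Type*} [Field Ω]
    [Algebra (ZMod p) Ω] [Fact p.Prime] (h : IsAbExt p pr ι)
    [CharP Ω p] [IsAlgClosed Ω] [MulSemiringAction Γ Ω] (ρ : Γ →* Q) (N : Subgroup Γ)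
    [hNn : N.Normal] [Fintype (Γ ⧸ N)] (hN : N ≤ ρ.ker) (y : Ω) (hy : ∀ n ∈ N, n • y = y)
    (hsum : ∑ q : Γ ⧸ N, q.out • y = 1) :
    ∃ ρ' : Γ →* E, pr.comp ρ' = ρ ∧ ∃ S : Finset Ω,
      ∀ γ ∈ N, (∀ x ∈ S, γ • x = x) → ρ' γ = 1 := by
  choose sec hsec using h.surjective
  let s : Γ → E := fun γ => sec (ρ γ)
  have hs : ∀ γ, pr (s γ) = ρ γ := fun γ => hsec _
  obtain ⟨c, hc, hcc⟩ := h.exists_cocycle ρ s hs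
  have hsn : ∀ γ, ∀ n ∈ N, s (γ * n) = s γ := fun γ n hn => by
    simp only [s, map_mul, show ρ n = 1 from hN hn, mul_one]
  have hns : ∀ γ, ∀ n ∈ N, s (n * γ) = s γ := fun γ n hn => by
    simp only [s, map_mul, show ρ n = 1 from hN hn, one_mul]
  have hcn : ∀ γ δ, ∀ n ∈ N, c γ (δ * n) = c γ δ := fun γ δ n hn => h.ι_inj (by
    rw [hc, hc, ← mul_assoc γ, hsn _ n hn, hsn _ n hn])
  have hnc : ∀ γ δ, ∀ n ∈ N, c (γ * n) δ = c γ δ := fun γ δ n hn => h.ι_inj (by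
    rw [hc, hc, hsn _ n hn]
    congr 2
    have : γ * n * δ = γ * δ * (δ⁻¹ * n * δ) := by group
    rw [this, hsn]
    simpa using hNn.conj_mem n hn δ⁻¹)
  let D : Γ → ((Ω ⊗[ZMod p] A) →ₗ[ZMod p] (Ω ⊗[ZMod p] A)) := fun γ =>
    TensorProduct.map ((MulSemiringAction.toRingHom Γ Ω γ).toAddMonoidHom.toZModLinearMap p)
      ((h.act (s γ)).toZModLinearMap p)
  have hD : ∀ γ (x : Ω) (a : A), D γ (x ⊗ₜ a) = (γ • x) ⊗ₜ (h.act (s γ) a) := fun _ _ _ => rfl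
  have hDmul : ∀ γ δ m, D (γ * δ) m = D γ (D δ m) := fun γ δ m => by
    induction m with
    | zero => simp
    | tmul x a =>
      rw [hD, hD, hD, mul_smul, ← h.act_mul]
      congr 1
      exact h.act_eq (by simp [hs]) a
    | add x y hx hy => simp only [map_add, hx, hy]
  have hDsmul : ∀ γ (x : Ω) m, D γ (x • m) = (γ • x) • D γ m := fun γ x m => by
    induction m with
    | zero => simp
    | tmul z a => rw [TensorProduct.smul_tmul', hD, hD, TensorProduct.smul_tmul', smul_eq_mul,
        smul_eq_mul, smul_mul']
    | add x y hx hy => simp only [map_add, smul_add, hx, hy]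
  set Φ := frobeniusTensor p Ω A with hΦ
  have hΦD : ∀ γ m, Φ (D γ m) = D γ (Φ m) := fun γ m => by
    induction m with
    | zero => simp
    | tmul z a => rw [hD, hΦ, frobeniusTensor_tmul, frobeniusTensor_tmul, hD, smul_pow']
    | add x y hx hy => simp only [map_add, hx, hy]
  have hδny : ∀ δ, ∀ n ∈ N, (δ * n) • y = δ • y := fun δ n hn => by rw [mul_smul, hy n hn]
  have hsum' : ∀ γ, ∑ q : Γ ⧸ N, (γ * q.out) • y = 1 := fun γ => by
    rw [N.sum_mul_out (fun δ => δ • y) hδny, hsum]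
  let b : Γ → Ω ⊗[ZMod p] A := fun γ => ∑ q : Γ ⧸ N, ((γ * q.out) • y) ⊗ₜ c γ q.out
  have hb : ∀ γ δ, b γ + D γ (b δ) = b (γ * δ) + 1 ⊗ₜ c γ δ := fun γ δ => by
    have e1 : D γ (b δ) = ∑ q : Γ ⧸ N, ((γ * δ * q.out) • y) ⊗ₜ[ZMod p] c γ δ +
        ∑ q : Γ ⧸ N, ((γ * δ * q.out) • y) ⊗ₜ[ZMod p] c (γ * δ) q.out -
        ∑ q : Γ ⧸ N, ((γ * (δ * q.out)) • y) ⊗ₜ[ZMod p] c γ (δ * q.out) := by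
      rw [← Finset.sum_add_distrib, ← Finset.sum_sub_distrib, map_sum]
      refine Finset.sum_congr rfl fun q _ => ?_
      rw [hD, ← mul_smul, mul_assoc, ← TensorProduct.tmul_add, ← TensorProduct.tmul_sub, ← hcc,
        add_sub_cancel_right]
    have e2 := N.sum_mul_out (fun ε => ((γ * ε) • y) ⊗ₜ[ZMod p] c γ ε) (fun ε n hn => by
      simp only [← mul_assoc, hδny _ n hn, hcn _ _ n hn]) δ
    rw [e1, e2, ← TensorProduct.sum_tmul, hsum']
    abel
  let w : Γ → Ω ⊗[ZMod p] A := fun γ => Φ (b γ) - b γ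
  have hw : ∀ γ δ, D γ (w δ) = w (γ * δ) - w γ := fun γ δ => by
    have h1 := congrArg Φ (hb γ δ)
    rw [map_add, map_add, hΦD, hΦ, frobeniusTensor_tmul, one_pow, ← hΦ] at h1
    have h2 := hb γ δ
    simp only [w, map_sub]
    rw [← eq_sub_iff_add_eq'] at h1 h2
    rw [h1, h2]
    abel
  have hbn : ∀ γ, ∀ n ∈ N, b (γ * n) = b γ := fun γ n hn => by
    refine Finset.sum_congr rfl fun q _ => ?_
    rw [hnc _ _ n hn]
    congr 1
    have : γ * n * q.out = γ * q.out * (q.out⁻¹ * n * q.out) := by group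
    rw [this, hδny]
    simpa using hNn.conj_mem n hn q.out⁻¹
  let a0 : Ω ⊗[ZMod p] A := ∑ q : Γ ⧸ N, (q.out • y) • w q.out
  have ha0 : ∀ γ, D γ a0 = a0 - w γ := fun γ => by
    have e1 := N.sum_mul_out (fun ε => (ε • y) • w ε) (fun ε n hn => by
      simp only [w, hδny _ n hn, hbn _ n hn]) γ
    simp only [a0]
    conv_rhs => rw [← e1]
    rw [map_sum, eq_sub_iff_add_eq, ← one_smul Ω (w γ), ← hsum' γ, Finset.sum_smul,
      ← Finset.sum_add_distrib]
    refine Finset.sum_congr rfl fun q _ => ?_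
    rw [hDsmul, hw, mul_smul, ← smul_add, sub_add_cancel]
  obtain ⟨a1, ha1⟩ := frobeniusTensor_sub_surjective p Ω A a0
  rw [← hΦ] at ha1
  have hβ : ∀ γ, ∃ β : A, b γ - a1 + D γ a1 = 1 ⊗ₜ β := fun γ => by
    apply exists_tmul_of_frobeniusTensor_eq
    rw [← hΦ, map_add, map_sub, hΦD, ← sub_eq_zero]
    have e1 : Φ a1 = a0 + a1 := by rw [← ha1]; abel
    rw [e1, map_add, ha0]
    simp only [w]
    abel
  choose β hβ using hβ
  obtain ⟨ρ', hρ', hpr⟩ := h.exists_lift ρ s hs c hc β fun γ δ => by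
    apply one_tmul_injective p Ω A
    change (1 : Ω) ⊗ₜ[ZMod p] _ = (1 : Ω) ⊗ₜ[ZMod p] _
    have e1 : (1 : Ω) ⊗ₜ[ZMod p] h.act (s γ) (β δ) = D γ (1 ⊗ₜ β δ) := by rw [hD, smul_one]
    rw [TensorProduct.tmul_sub, TensorProduct.tmul_add, e1, ← hβ, ← hβ, ← hβ, map_add, map_sub,
      ← hDmul]
    have h2 := hb γ δ
    rw [← eq_sub_iff_add_eq'] at h2
    rw [h2]
    abel
  have hfix : ∀ m : Ω ⊗[ZMod p] A, ∃ S : Finset Ω, ∀ γ ∈ N, (∀ x ∈ S, γ • x = x) →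
      D γ m = m := by
    intro m
    classical
    induction m with
    | zero => exact ⟨∅, by simp⟩
    | tmul x a =>
      refine ⟨{x}, fun γ hγ hx => ?_⟩
      rw [hD, hx x (by simp)]
      congr 1
      rw [h.act_eq (f := 1) (by rw [hs, map_one, show ρ γ = 1 from hN hγ])]
      simpa using h.act_ι 0 a
    | add x y hx hy =>
      obtain ⟨S, hS⟩ := hx
      obtain ⟨T, hT⟩ := hy
      refine ⟨S ∪ T, fun γ hγ hST => ?_⟩
      rw [map_add, hS γ hγ fun x hx => hST x (by simp [hx]),
        hT γ hγ fun x hx => hST x (by simp [hx])]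
  obtain ⟨S, hS⟩ := hfix a1
  refine ⟨ρ', hpr, S, fun γ hγ hx => ?_⟩
  have h2 : ∀ δ, ι (.ofAdd (c γ δ)) = s γ := fun δ => by rw [hc, hns _ γ hγ]; group
  have h3 : β γ = c γ 1 := by
    apply one_tmul_injective p Ω A
    change (1 : Ω) ⊗ₜ[ZMod p] _ = (1 : Ω) ⊗ₜ[ZMod p] _
    rw [← hβ, hS γ hγ hx, sub_add_cancel, ← hsum' γ, TensorProduct.sum_tmul]
    refine Finset.sum_congr rfl fun q _ => ?_
    congr 1
    exact h.ι_inj (by rw [h2, h2])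
  rw [hρ', h3, ofAdd_neg, map_inv, h2]
  group

/-- Over a field of characteristic `p` every embedding problem with abelian kernel of exponent `p`
can be solved (weakly), by Artin–Schreier theory. -/
theorem exists_lift_of_charP [Fact p.Prime] (h : IsAbExt p pr ι) {Ω : Type*} [Field Ω]
    [CharP Ω p] [IsAlgClosed Ω] [MulSemiringAction Γ Ω] (ρ : Γ →* Q) (N : Subgroup Γ)
    [hNn : N.Normal] [Fintype (Γ ⧸ N)] (hN : N ≤ ρ.ker) (y : Ω) (hy : ∀ n ∈ N, n • y = y)
    (hsum : ∑ q : Γ ⧸ N, q.out • y = 1) :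
    ∃ ρ' : Γ →* E, pr.comp ρ' = ρ ∧ ∃ S : Finset Ω,
      ∀ γ ∈ N, (∀ x ∈ S, γ • x = x) → ρ' γ = 1 :=
  let _ : Module (ZMod p) A := AddCommGroup.zmodModule h.nsmul_eq_zero
  let _ : Algebra (ZMod p) Ω := ZMod.algebra Ω p
  exists_lift_of_charP_aux h ρ N hN y hy hsum

end IsAbExt

/-- A map on a group `Γ` of automorphisms of a field `Ω` is smooth if it only depends on the
action on finitely many elements of `Ω`. -/
def Smooth (Ω : Type*) {Γ X : Type*} [Group Γ] [MulAction Γ Ω] (f : Γ → X) : Prop :=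
  ∃ S : Finset Ω, ∀ γ n : Γ, (∀ x ∈ S, n • x = x) → f (γ * n) = f γ

namespace Smooth

section Basic

variable {Ω Γ X Y : Type*} [Group Γ] [MulAction Γ Ω]

theorem of_hom {E : Type*} [Group E] (ρ : Γ →* E) (S : Finset Ω)
    (hS : ∀ n, (∀ x ∈ S, n • x = x) → ρ n = 1) : Smooth Ω ρ :=
  ⟨S, fun γ n hn => by rw [map_mul, hS n hn, mul_one]⟩

theorem exists_hom {E : Type*} [Group E] {ρ : Γ →* E} (h : Smooth Ω ρ) :
    ∃ S : Finset Ω, ∀ n, (∀ x ∈ S, n • x = x) → ρ n = 1 := by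
  obtain ⟨S, hS⟩ := h
  exact ⟨S, fun n hn => by simpa using hS 1 n hn⟩

theorem comp {f : Γ → X} (hf : Smooth Ω f) (g : X → Y) : Smooth Ω fun γ => g (f γ) := by
  obtain ⟨S, hS⟩ := hf
  exact ⟨S, fun γ n hn => congrArg g (hS γ n hn)⟩

theorem const (x : X) : Smooth Ω fun _ : Γ => x := ⟨∅, fun _ _ _ => rfl⟩

theorem prod {f : Γ → X} {g : Γ → Y} (hf : Smooth Ω f) (hg : Smooth Ω g) :
    Smooth Ω fun γ => (f γ, g γ) := by
  classical
  obtain ⟨S, hS⟩ := hf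
  obtain ⟨T, hT⟩ := hg
  exact ⟨S ∪ T, fun γ n hn => by
    dsimp only
    rw [hS γ n fun x hx => hn x (by simp [hx]), hT γ n fun x hx => hn x (by simp [hx])]⟩

theorem comp₂ {Z : Type*} {f : Γ → X} {g : Γ → Y} (hf : Smooth Ω f) (hg : Smooth Ω g)
    (F : X → Y → Z) : Smooth Ω fun γ => F (f γ) (g γ) :=
  (hf.prod hg).comp fun z => F z.1 z.2

theorem restrict {f : Γ → X} (hf : Smooth Ω f) (U : Subgroup Γ) : Smooth Ω fun u : U => f u := by
  obtain ⟨S, hS⟩ := hf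
  exact ⟨S, fun γ n hn => hS γ n hn⟩

theorem congr_inj {f : Γ → X} {g : X → Y} (hg : Function.Injective g)
    (hf : Smooth Ω fun γ => g (f γ)) : Smooth Ω f := by
  obtain ⟨S, hS⟩ := hf
  exact ⟨S, fun γ n hn => hg (hS γ n hn)⟩

/-- Stability of a finite subset. -/
theorem exists_stable (hfin : ∀ x : Ω, (MulAction.orbit Γ x).Finite) (S : Finset Ω) :
    ∃ T : Finset Ω, S ⊆ T ∧ ∀ (γ : Γ), ∀ x ∈ T, γ • x ∈ T := by
  classical
  have h : (⋃ x ∈ S, MulAction.orbit Γ x).Finite := S.finite_toSet.biUnion fun x _ => hfin x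
  refine ⟨h.toFinset, fun x hx => ?_, fun γ x hx => ?_⟩
  · simp only [Set.Finite.mem_toFinset, Set.mem_iUnion]
    exact ⟨x, hx, MulAction.mem_orbit_self x⟩
  · simp only [Set.Finite.mem_toFinset, Set.mem_iUnion] at hx ⊢
    obtain ⟨z, hz, hx⟩ := hx
    exact ⟨z, hz, (MulAction.mem_orbit_of_mem_orbit γ hx)⟩

theorem finiteIndex_fixingSubgroup (hfin : ∀ x : Ω, (MulAction.orbit Γ x).Finite)
    (S : Finset Ω) : (fixingSubgroup Γ (S : Set Ω)).FiniteIndex := by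
  have h : fixingSubgroup Γ (S : Set Ω) = ⨅ x : S, MulAction.stabilizer Γ (x : Ω) := by
    ext γ
    simp [mem_fixingSubgroup_iff, Subgroup.mem_iInf]
  rw [h]
  refine Subgroup.finiteIndex_iInf fun x => ⟨?_⟩
  rw [MulAction.index_stabilizer]
  have := (hfin (x : Ω)).to_subtype
  exact (Set.ncard_pos (hfin _)).2 ⟨_, MulAction.mem_orbit_self _⟩ |>.ne'

theorem normal_fixingSubgroup {S : Finset Ω} (hS : ∀ (γ : Γ), ∀ x ∈ S, γ • x ∈ S) :
    (fixingSubgroup Γ (S : Set Ω)).Normal := by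
  refine ⟨fun n hn γ => ?_⟩
  rw [mem_fixingSubgroup_iff] at hn ⊢
  intro x hx
  rw [mul_smul, mul_smul, hn _ (hS γ⁻¹ x hx), smul_inv_smul]

end Basic

section Field

variable {Ω Γ : Type*} [Group Γ] [Field Ω] [MulSemiringAction Γ Ω]

/-- Dedekind's independence of characters. -/
theorem exists_sum_ne_zero {T : Finset Ω}
    {N : Subgroup Γ} (hN : N = fixingSubgroup Γ (T : Set Ω)) [Fintype (Γ ⧸ N)]
    (c : Γ ⧸ N → Ω) (hc : c ≠ 0) : ∃ x : Ω, (∀ n ∈ N, n • x = x) ∧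
      ∑ q, c q * (q.out • x) ≠ 0 := by
  classical
  let M : Submonoid Ω :=
    { carrier := {x | ∀ n ∈ N, n • x = x}
      one_mem' := fun n _ => smul_one n
      mul_mem' := fun {a b} ha hb n hn => by rw [smul_mul', ha n hn, hb n hn] }
  let χ : Γ ⧸ N → (M →* Ω) := fun q => (MulSemiringAction.toRingHom Γ Ω q.out : Ω →* Ω).comp M.subtype
  have hχ : Function.Injective χ := by
    intro q r hqr
    rw [← QuotientGroup.out_eq' q, ← QuotientGroup.out_eq' r, QuotientGroup.eq]
    refine hN.ge ((mem_fixingSubgroup_iff Γ).2 fun x hx => ?_)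
    have : q.out • x = r.out • x := DFunLike.congr_fun hqr ⟨x, fun n hn =>
      (mem_fixingSubgroup_iff Γ).1 (hN ▸ hn) x hx⟩
    rw [mul_smul, ← this, inv_smul_smul]
  have hli := (linearIndependent_monoidHom M Ω).comp χ hχ
  rw [Fintype.linearIndependent_iff] at hli
  by_contra! hcon
  refine hc (funext fun q => hli c ?_ q)
  funext x
  simp only [Finset.sum_apply, Pi.smul_apply, smul_eq_mul, Function.comp_apply, Pi.zero_apply]
  exact hcon x x.2

end Field

end Smooth

namespace IsAbExt

variable {p : ℕ} {E Q A : Type*} [Group E] [Group Q] [AddCommGroup A]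
  {pr : E →* Q} {ι : Multiplicative A →* E} {Γ Ω : Type*} [Group Γ] [Field Ω]
  [MulSemiringAction Γ Ω]

theorem exists_smooth_lift_of_charP [Fact p.Prime] (h : IsAbExt p pr ι)
    [CharP Ω p] [IsAlgClosed Ω] (hfin : ∀ x : Ω, (MulAction.orbit Γ x).Finite)
    (ρ : Γ →* Q) (hρ : Smooth Ω ρ) :
    ∃ ρ' : Γ →* E, Smooth Ω ρ' ∧ pr.comp ρ' = ρ := by
  classical
  obtain ⟨S, hS⟩ := hρ.exists_hom
  obtain ⟨T, hST, hT⟩ := Smooth.exists_stable hfin S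
  have := Smooth.finiteIndex_fixingSubgroup hfin T
  have := Smooth.normal_fixingSubgroup hT
  set N := fixingSubgroup Γ (T : Set Ω) with hN
  let _ : Fintype (Γ ⧸ N) := Fintype.ofFinite _
  have hNρ : N ≤ ρ.ker := fun n hn => hS n fun x hx => (mem_fixingSubgroup_iff Γ).1 hn x (hST hx)
  obtain ⟨x, hx, hne⟩ := Smooth.exists_sum_ne_zero hN (fun _ => 1) (fun h =>
    one_ne_zero (congrFun h 1))
  simp only [one_mul] at hne
  set s := ∑ q : Γ ⧸ N, q.out • x with hs
  have hsγ : ∀ γ : Γ, γ • s = s := fun γ => by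
    rw [hs, Finset.smul_sum]
    simp only [← mul_smul]
    exact N.sum_mul_out (fun δ => δ • x) (fun δ n hn => by rw [mul_smul, hx n hn]) γ
  obtain ⟨ρ', h1, S', h2⟩ := h.exists_lift_of_charP ρ N hNρ (x / s)
    (fun n hn => by rw [smul_div₀', hx n hn, hsγ]) (by
      simp only [smul_div₀', hsγ]
      rw [← Finset.sum_div, ← hs, div_self hne])
  refine ⟨ρ', Smooth.of_hom ρ' (T ∪ S') fun n hn => h2 n ?_ fun x hx => hn x (by simp [hx]), h1⟩
  rw [hN, mem_fixingSubgroup_iff]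
  exact fun x hx => hn x (by simp [Finset.mem_coe.1 hx])

theorem exists_smooth_lift_of_index (h : IsAbExt p pr ι)
    (hfin : ∀ x : Ω, (MulAction.orbit Γ x).Finite) (U : Subgroup Γ) (S : Finset Ω)
    (hS : fixingSubgroup Γ (S : Set Ω) ≤ U) (hU : ¬ p ∣ U.index)
    (hp : p.Prime) (ρ : Γ →* Q) (σ : U →* E) (hσs : Smooth Ω σ) (hσ : ∀ u, pr (σ u) = ρ u) :
    ∃ ρ' : Γ →* E, Smooth Ω ρ' ∧ pr.comp ρ' = ρ := by
  classical
  have : U.FiniteIndex := ⟨fun h0 => hU (h0 ▸ dvd_zero p)⟩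
  have := Fact.mk hp
  obtain ⟨ρ', h1, h2⟩ := h.exists_lift_of_index U hU ρ σ hσ
  obtain ⟨S', hS'⟩ := hσs.exists_hom
  obtain ⟨T, hST, hT⟩ := Smooth.exists_stable hfin (S ∪ S')
  refine ⟨ρ', Smooth.of_hom ρ' T fun n hn => h2 (fixingSubgroup Γ (T : Set Ω))
    (Smooth.normal_fixingSubgroup hT) ?_ ?_ n ((mem_fixingSubgroup_iff Γ).2 hn), h1⟩
  · exact fun γ hγ => hS ((mem_fixingSubgroup_iff Γ).2 fun x hx =>
      (mem_fixingSubgroup_iff Γ).1 hγ x (hST (by simp [Finset.mem_coe.1 hx])))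
  · exact fun u hu => hS' u fun x hx =>
      (mem_fixingSubgroup_iff Γ).1 hu x (hST (by simp [hx]))

end IsAbExt

section Hilbert90

variable {Ω Γ : Type*} [Group Γ] [Field Ω] [MulSemiringAction Γ Ω]

/-- Hilbert 90 for the `Γ`-module of functions from a finite `Γ`-set to `Ωˣ`. -/
theorem exists_eq_div_smul_of_cocycle (hfin : ∀ x : Ω, (MulAction.orbit Γ x).Finite)
    {S : Type*} [MulAction Γ S] (hS : Smooth Ω fun (γ : Γ) (s : S) => γ • s)
    (b : Γ → S → Ω) (hb0 : ∀ γ s, b γ s ≠ 0) (hb : Smooth Ω b)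
    (hcoc : ∀ σ τ s, b (σ * τ) s = b σ s * σ • b τ (σ⁻¹ • s)) :
    ∃ f : S → Ω, (∀ s, f s ≠ 0) ∧ ∀ σ s, b σ s * σ • f (σ⁻¹ • s) = f s := by
  classical
  obtain ⟨T₀, hT₀⟩ := hS.prod hb
  obtain ⟨T, hTT, hT⟩ := Smooth.exists_stable hfin T₀
  have := Smooth.finiteIndex_fixingSubgroup hfin T
  have hNn := Smooth.normal_fixingSubgroup hT
  obtain ⟨N, hN⟩ : ∃ N, N = fixingSubgroup Γ (T : Set Ω) := ⟨_, rfl⟩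
  rw [← hN] at this hNn
  let _ : Fintype (Γ ⧸ N) := Fintype.ofFinite _
  have hT1 : ∀ γ, ∀ n ∈ N, (∀ s : S, (γ * n) • s = γ • s) ∧ b (γ * n) = b γ := fun γ n hn => by
    have := hT₀ γ n fun x hx => (mem_fixingSubgroup_iff Γ).1 (hN ▸ hn) x (hTT hx)
    exact ⟨fun s => congrFun (Prod.ext_iff.1 this).1 s, (Prod.ext_iff.1 this).2⟩
  have hnS : ∀ n ∈ N, ∀ s : S, n • s = s := fun n hn s => by simpa using (hT1 1 n hn).1 s
  have hb1 : b 1 = 1 := by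
    funext s
    have := hcoc 1 1 s
    simp only [mul_one, inv_one, one_smul] at this
    exact (mul_eq_left₀ (hb0 1 s)).1 this.symm
  have hbn : ∀ n ∈ N, b n = 1 := fun n hn => by
    have := (hT1 1 n hn).2
    rwa [one_mul, hb1] at this
  have hx : ∀ r : S, ∃ x : Ω, (∀ n ∈ N, n • x = x) ∧
      ∑ q : Γ ⧸ N, (if q.out⁻¹ • r = r then b q.out r else 0) * (q.out • x) ≠ 0 := fun r => by
    refine Smooth.exists_sum_ne_zero hN _ fun h => ?_
    have := congrFun h ((1 : Γ) : Γ ⧸ N)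
    have hmem : ((1 : Γ) : Γ ⧸ N).out ∈ N := by
      simpa using QuotientGroup.eq.1 (QuotientGroup.out_eq' ((1 : Γ) : Γ ⧸ N)).symm
    rw [if_pos (hnS _ (inv_mem hmem) _)] at this
    exact hb0 _ _ this
  choose x hxN hx using hx
  let rep : S → S := fun s => (Quotient.mk (MulAction.orbitRel Γ S) s).out
  have hrep : ∀ γ s, rep (γ • s) = rep s := fun γ s => by
    simp only [rep]
    congr 1
    exact Quotient.sound (MulAction.orbitRel_apply.2 (MulAction.mem_orbit s γ))
  let z : S → Ω := fun s => if rep s = s then x s else 0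
  have hzN : ∀ s, ∀ n ∈ N, n • z s = z s := fun s n hn => by
    simp only [z]
    split_ifs
    · exact hxN s n hn
    · exact smul_zero n
  let g : S → Γ → Ω := fun s γ => b γ s * (γ • z (γ⁻¹ • s))
  have hgN : ∀ s γ, ∀ n ∈ N, g s (γ * n) = g s γ := fun s γ n hn => by
    simp only [g]
    rw [(hT1 γ n hn).2, _root_.mul_inv_rev, mul_smul, mul_smul n⁻¹, hnS _ (inv_mem hn), hzN _ n hn]
  let f : S → Ω := fun s => ∑ q : Γ ⧸ N, g s q.out
  have hf : ∀ σ s, b σ s * σ • f (σ⁻¹ • s) = f s := fun σ s => by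
    simp only [f]
    rw [← N.sum_mul_out (g s) (hgN s) σ, Finset.smul_sum, Finset.mul_sum]
    refine Finset.sum_congr rfl fun q _ => ?_
    simp only [g]
    rw [hcoc, smul_mul', _root_.mul_inv_rev, mul_smul, mul_smul, mul_assoc]
  refine ⟨f, fun s => ?_, hf⟩
  have hfr : f (rep s) ≠ 0 := by
    have hrr : rep (rep s) = rep s := by
      simp only [rep]
      rw [Quotient.out_eq]
    have : f (rep s) = ∑ q : Γ ⧸ N, (if q.out⁻¹ • rep s = rep s then b q.out (rep s) else 0) *
        (q.out • x (rep s)) := by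
      refine Finset.sum_congr rfl fun q _ => ?_
      simp only [g, z, hrep, hrr]
      by_cases hq : q.out⁻¹ • rep s = rep s
      · simp only [hq, if_true]
      · rw [if_neg hq, if_neg fun h => hq h.symm, smul_zero, mul_zero, zero_mul]
    rw [this]
    exact hx _
  obtain ⟨γ, hγ⟩ : ∃ γ : Γ, γ • s = rep s := by
    have : rep s ∈ MulAction.orbit Γ s := MulAction.orbitRel_apply.1
      (Quotient.exact (Quotient.out_eq (Quotient.mk (MulAction.orbitRel Γ S) s)))
    exact this
  intro h0
  apply hfr
  rw [← hf γ, ← hγ, inv_smul_smul, h0, smul_zero, mul_zero]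

end Hilbert90

section Kummer

theorem IsPrimitiveRoot.pow_val_eq_pow {M : Type*} [CommMonoid M] {η : M} {m : ℕ} [NeZero m]
    (hη : η ^ m = 1) (k : ℕ) (a : ZMod m) (h : (k : ZMod m) = a) : η ^ a.val = η ^ k := by
  rw [← h, ZMod.val_natCast, ← pow_mod_orderOf, Nat.mod_mod_of_dvd _ (orderOf_dvd_of_pow_eq_one hη),
    pow_mod_orderOf]

theorem IsPrimitiveRoot.pow_val_add {M : Type*} [CommMonoid M] {η : M} {m : ℕ} [NeZero m]
    (hη : η ^ m = 1) (a b : ZMod m) : η ^ (a + b).val = η ^ a.val * η ^ b.val := by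
  rw [← pow_add]
  exact pow_val_eq_pow hη _ _ (by simp)

theorem IsPrimitiveRoot.pow_val_mul {M : Type*} [CommMonoid M] {η : M} {m : ℕ} [NeZero m]
    (hη : η ^ m = 1) (a b : ZMod m) : η ^ (a * b).val = (η ^ a.val) ^ b.val := by
  rw [← pow_mul]
  exact pow_val_eq_pow hη _ _ (by simp)

theorem IsPrimitiveRoot.pow_val_inj {M : Type*} [CommMonoid M] {η : M} {m : ℕ} [NeZero m]
    (hη : IsPrimitiveRoot η m) {a b : ZMod m} (h : η ^ a.val = η ^ b.val) : a = b :=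
  ZMod.val_injective m (hη.pow_inj (ZMod.val_lt a) (ZMod.val_lt b) h)

theorem IsPrimitiveRoot.exists_pow_val {K : Type*} [Field K] {η : K} {m : ℕ} [NeZero m]
    (hη : IsPrimitiveRoot η m) {x : K} (hx : x ^ m = 1) : ∃ a : ZMod m, η ^ a.val = x := by
  obtain ⟨i, -, hi⟩ := hη.eq_pow_of_pow_eq_one hx
  exact ⟨i, by rw [pow_val_eq_pow hη.pow_eq_one i _ rfl, hi]⟩

variable {Ω Γ : Type*} [Group Γ] [Field Ω] [MulSemiringAction Γ Ω]

/-- The cyclotomic character. -/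
theorem exists_cyclotomic {η : Ω} {m : ℕ} [NeZero m] (hη : IsPrimitiveRoot η m) :
    ∃ ε : Γ →* (ZMod m)ˣ, Smooth Ω ε ∧ ∀ γ, γ • η = η ^ (ε γ : ZMod m).val := by
  have h : ∀ γ : Γ, ∃ a : ZMod m, η ^ a.val = γ • η := fun γ =>
    hη.exists_pow_val (by rw [← smul_pow', hη.pow_eq_one, smul_one])
  choose a ha using h
  let φ : Γ →* ZMod m :=
    { toFun := a
      map_one' := hη.pow_val_inj (by
        rw [ha, one_smul, IsPrimitiveRoot.pow_val_eq_pow hη.pow_eq_one 1 _ (by simp), pow_one])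
      map_mul' := fun γ δ => hη.pow_val_inj (by
        rw [IsPrimitiveRoot.pow_val_mul hη.pow_eq_one, ha, ha, ← smul_pow', ha, mul_smul]) }
  refine ⟨φ.toHomUnits, ⟨{η}, fun γ n hn => Units.ext (hη.pow_val_inj ?_)⟩, fun γ => (ha γ).symm⟩
  change η ^ (a (γ * n)).val = η ^ (a γ).val
  rw [ha, ha, mul_smul, hn η (by simp)]

/-- Cocycles with values in a permutation module modulo `p` lift to (cyclotomically twisted)
cocycles modulo `p ^ 2`. -/
theorem exists_cocycle_lift [IsAlgClosed Ω] (hfin : ∀ x : Ω, (MulAction.orbit Γ x).Finite)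
    {p : ℕ} [Fact p.Prime] {η : Ω} (hη : IsPrimitiveRoot η (p ^ 2))
    (ε : Γ →* (ZMod (p ^ 2))ˣ) (hε : ∀ γ, γ • η = η ^ (ε γ : ZMod (p ^ 2)).val)
    (hζ : ∀ γ : Γ, γ • η ^ p = η ^ p)
    {S : Type*} [Finite S] [MulAction Γ S] (hS : Smooth Ω fun (γ : Γ) (s : S) => γ • s)
    (b : Γ → S → ZMod p) (hb : Smooth Ω b)
    (hcoc : ∀ σ τ s, b (σ * τ) s = b σ s + b τ (σ⁻¹ • s)) :
    ∃ b' : Γ → S → ZMod (p ^ 2), Smooth Ω b' ∧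
      (∀ σ τ s, b' (σ * τ) s = b' σ s + (ε σ : ZMod (p ^ 2)) * b' τ (σ⁻¹ • s)) ∧
      ∀ σ s, ((b' σ s).val : ZMod p) = b σ s := by
  have hp := (Fact.out : p.Prime)
  have hp0 : p ≠ 0 := hp.ne_zero
  have hζp : IsPrimitiveRoot (η ^ p) p := hη.pow (by positivity) (by ring)
  obtain ⟨f, hf0, hf⟩ := exists_eq_div_smul_of_cocycle hfin hS
    (fun γ s => (η ^ p) ^ (b γ s).val) (fun γ s => pow_ne_zero _ (hζp.ne_zero hp0))
    (hb.comp fun c s => (η ^ p) ^ (c s).val) (fun σ τ s => by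
      rw [hcoc, IsPrimitiveRoot.pow_val_add hζp.pow_eq_one, smul_pow', hζ])
  have hh : ∀ s, ∃ h : Ω, h ^ p = f s := fun s => IsAlgClosed.exists_pow_nat_eq _ hp.pos
  choose h hh using hh
  have hh0 : ∀ s, h s ≠ 0 := fun s h0 => hf0 s (by rw [← hh, h0, zero_pow hp0])
  have hhσ0 : ∀ (σ : Γ) s, σ • h s ≠ 0 := fun σ s h0 => hh0 s ((smul_eq_zero_iff_eq σ).1 h0)
  have hβ : ∀ (σ : Γ) s, (h s / σ • h (σ⁻¹ • s)) ^ p = (η ^ p) ^ (b σ s).val := fun σ s => by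
    rw [div_pow, hh, ← smul_pow', hh, div_eq_iff, hf]
    exact fun h0 => hf0 (σ⁻¹ • s) ((smul_eq_zero_iff_eq σ).1 h0)
  have hex : ∀ (σ : Γ) s, ∃ a : ZMod (p ^ 2), η ^ a.val = h s / σ • h (σ⁻¹ • s) := fun σ s =>
    hη.exists_pow_val (by
      rw [pow_two, pow_mul, hβ, ← pow_mul, mul_comm, pow_mul, hζp.pow_eq_one, one_pow])
  choose b' hb' using hex
  refine ⟨b', ?_, fun σ τ s => ?_, fun σ s => ?_⟩
  · classical
    cases nonempty_fintype S
    obtain ⟨T, hT⟩ := hS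
    refine ⟨T ∪ Finset.univ.image h, fun γ n hn => funext fun s => hη.pow_val_inj ?_⟩
    have hn1 : ∀ s : S, n⁻¹ • s = s := fun s => by
      rw [inv_smul_eq_iff]
      have := congrFun (hT 1 n fun x hx => hn x (by simp [hx])) s
      simpa using this.symm
    rw [hb', hb', _root_.mul_inv_rev, mul_smul, mul_smul n⁻¹, hn1, hn (h _) (by simp)]
  · apply hη.pow_val_inj
    rw [IsPrimitiveRoot.pow_val_add hη.pow_eq_one, IsPrimitiveRoot.pow_val_mul hη.pow_eq_one, hb',
      hb', ← hε, ← smul_pow', hb', _root_.mul_inv_rev, mul_smul, mul_smul, smul_div₀']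
    rw [div_mul_div_cancel₀ (hhσ0 _ _)]
  · have h1 := hβ σ s
    rw [← hb', ← pow_mul, mul_comm, pow_mul] at h1
    apply hζp.pow_val_inj
    rw [IsPrimitiveRoot.pow_val_eq_pow hζp.pow_eq_one _ _ rfl, h1]

end Kummer

section Rank4

/-- The translation by `a` as a permutation matrix. -/
def shiftMatrix (R : Type*) [CommRing R] (a : Fin 2) : Matrix (Fin 2) (Fin 2) R :=
  fun i j => if i = j + a then 1 else 0

/-- A homomorphic section of unipotent matrices of size two, over any ring. -/
def signedUnipotent (R : Type*) [CommRing R] (a : Fin 2) : Matrix (Fin 2) (Fin 2) R :=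
  !![1, (a.val : R); 0, (-1) ^ a.val]

/-- The base change from permutation matrices to triangular ones. -/
def permToTriangular (R : Type*) [CommRing R] : Matrix (Fin 2) (Fin 2) R :=
  !![0, 1; 1, -1]

/-- The inverse of `permToTriangular`. -/
def triangularToPerm (R : Type*) [CommRing R] : Matrix (Fin 2) (Fin 2) R :=
  !![1, 1; 1, 0]

theorem shiftMatrix_mul_mul (R : Type*) [CommRing R] (a d : Fin 2)
    (C : Matrix (Fin 2) (Fin 2) R) (i j : Fin 2) :
    (shiftMatrix R a * C * shiftMatrix R d) i j = C (i - a) (j + d) := by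
  have h1 : ∀ x : Fin 2, i = x + a ↔ i - a = x := fun x => sub_eq_iff_eq_add.symm
  simp [Matrix.mul_apply, shiftMatrix, h1]

/-- The compatibilities between the above matrices. -/
structure PermTriangular (R : Type*) [CommRing R] : Prop where
  mul_inv : permToTriangular R * triangularToPerm R = 1
  inv_mul : triangularToPerm R * permToTriangular R = 1
  signed_mul : ∀ a : Fin 2,
    signedUnipotent R a * permToTriangular R = permToTriangular R * shiftMatrix R a
  mul_signed : ∀ a : Fin 2,
    triangularToPerm R * signedUnipotent R a = shiftMatrix R a * triangularToPerm R
  signed_add : ∀ a b : Fin 2,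
    signedUnipotent R (a + b) = signedUnipotent R a * signedUnipotent R b
  signed_self : ∀ a : Fin 2, signedUnipotent R a * signedUnipotent R a = 1

theorem permTriangular_two : PermTriangular (ZMod 2) := by
  constructor <;> decide

theorem permTriangular_four : PermTriangular (ZMod (2 ^ 2)) := by
  constructor <;> decide

theorem PermTriangular.exists_hom {R : Type*} [CommRing R] (Q : PermTriangular R) {Γ : Type*}
    [Group Γ] (a d : Γ → Fin 2) (ha : ∀ γ δ, a (γ * δ) = a γ + a δ)
    (hd : ∀ γ δ, d (γ * δ) = d γ + d δ) (ε : Γ →* R) (C : Γ → Matrix (Fin 2) (Fin 2) R)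
    (hC : ∀ γ δ, C (γ * δ) = C γ + ε γ • (shiftMatrix R (a γ) * C δ * shiftMatrix R (d γ))) :
    ∃ ρ : Γ →* Matrix (Fin 2 ⊕ Fin 2) (Fin 2 ⊕ Fin 2) R, ∀ γ,
      ρ γ = fromBlocks (ε γ • signedUnipotent R (a γ))
        (permToTriangular R * C γ * (triangularToPerm R * signedUnipotent R (d γ))) 0
        (signedUnipotent R (d γ)) := by
  have ha1 : a 1 = 0 := by simpa using ha 1 1
  have hd1 : d 1 = 0 := by simpa using hd 1 1
  have hs0 : signedUnipotent R 0 = 1 := by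
    ext i j
    fin_cases i <;> fin_cases j <;> simp [signedUnipotent]
  have hsh0 : ∀ M : Matrix (Fin 2) (Fin 2) R, shiftMatrix R 0 * M * shiftMatrix R 0 = M := fun M => by
    ext i j
    rw [shiftMatrix_mul_mul, sub_zero, add_zero]
  have hC1 : C 1 = 0 := by
    have := hC 1 1
    rwa [ha1, hd1, hsh0, map_one, one_smul, mul_one, left_eq_add] at this
  let B : Γ → Matrix (Fin 2) (Fin 2) R := fun γ =>
    permToTriangular R * C γ * (triangularToPerm R * signedUnipotent R (d γ))
  have hB : ∀ γ δ, B (γ * δ) =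
      (ε γ • signedUnipotent R (a γ)) * B δ + B γ * signedUnipotent R (d δ) := fun γ δ => by
    simp only [B]
    rw [hC, hd, mul_add, add_mul, add_comm, Q.signed_add]
    congr 1
    · simp only [smul_mul_assoc, mul_smul_comm]
      congr 1
      have e1 : signedUnipotent R (a γ) * (permToTriangular R * C δ *
          (triangularToPerm R * signedUnipotent R (d δ))) = (signedUnipotent R (a γ) *
          permToTriangular R) * C δ * (triangularToPerm R * signedUnipotent R (d δ)) := by
        simp only [mul_assoc]
      have e2 : signedUnipotent R (d γ) * signedUnipotent R (d δ) =
          signedUnipotent R (d γ) * signedUnipotent R (d δ) := rfl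
      have e3 : shiftMatrix R (d γ) * (triangularToPerm R * (signedUnipotent R (d γ) *
          signedUnipotent R (d δ))) = triangularToPerm R * signedUnipotent R (d δ) := by
        rw [← mul_assoc, ← Q.mul_signed, mul_assoc, ← mul_assoc (signedUnipotent R (d γ)),
          Q.signed_self, one_mul]
      rw [e1, Q.signed_mul, ← e3]
      simp only [mul_assoc]
    · simp only [mul_assoc]
  exact ⟨
    { toFun := fun γ => fromBlocks (ε γ • signedUnipotent R (a γ)) (B γ) 0
        (signedUnipotent R (d γ))
      map_one' := by
        simp only [B]
        rw [ha1, hd1, hC1, hs0, map_one, one_smul, mul_zero, zero_mul, fromBlocks_one]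
      map_mul' := fun γ δ => by
        rw [fromBlocks_multiply, hB, ha, hd, Q.signed_add, Q.signed_add]
        simp only [map_mul, mul_zero, add_zero, zero_mul, zero_add, smul_mul_smul_comm] },
    fun γ => rfl⟩

theorem PermTriangular.conj_add_mul {R : Type*} [CommRing R] (P : PermTriangular R)
    (a d d' : Fin 2) (B B' : Matrix (Fin 2) (Fin 2) R) :
    triangularToPerm R * ((signedUnipotent R a * B' + B * signedUnipotent R d') *
      signedUnipotent R (d + d')) * permToTriangular R =
    triangularToPerm R * (B * signedUnipotent R d) * permToTriangular R +
      shiftMatrix R a * (triangularToPerm R * (B' * signedUnipotent R d') * permToTriangular R) *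
        shiftMatrix R d := by
  have e1 : B * signedUnipotent R d' * signedUnipotent R (d + d') = B * signedUnipotent R d := by
    rw [add_comm, P.signed_add, mul_assoc, ← mul_assoc (signedUnipotent R d'), P.signed_self,
      one_mul]
  have e2 : triangularToPerm R * (signedUnipotent R a * B' * signedUnipotent R (d + d')) *
      permToTriangular R = shiftMatrix R a * (triangularToPerm R * (B' * signedUnipotent R d') *
        permToTriangular R) * shiftMatrix R d := by
    rw [add_comm, P.signed_add]
    calc _ = (triangularToPerm R * signedUnipotent R a) * (B' * signedUnipotent R d') *
          (signedUnipotent R d * permToTriangular R) := by simp only [mul_assoc]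
      _ = _ := by rw [P.mul_signed, P.signed_mul]; simp only [mul_assoc]
  rw [add_mul, e1, mul_add, add_mul, add_comm, e2]

theorem PermTriangular.map_fromBlocks {R S : Type*} [CommRing R] [CommRing S]
    (P : PermTriangular S) (φ : R →+* S) (a d : Fin 2) {ε : R} (hε : φ ε = 1)
    (C : Matrix (Fin 2) (Fin 2) R) (C' B : Matrix (Fin 2) (Fin 2) S) (hC : C.map φ = C')
    (hB : C' = triangularToPerm S * (B * signedUnipotent S d) * permToTriangular S) :
    (fromBlocks (ε • signedUnipotent R a)
      (permToTriangular R * C * (triangularToPerm R * signedUnipotent R d)) 0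
      (signedUnipotent R d)).map φ =
      fromBlocks (signedUnipotent S a) B 0 (signedUnipotent S d) := by
  have hs : ∀ x, (signedUnipotent R x).map φ = signedUnipotent S x := fun x => by
    ext i j
    fin_cases i <;> fin_cases j <;> simp [signedUnipotent]
  have hp : (permToTriangular R).map φ = permToTriangular S := by
    ext i j
    fin_cases i <;> fin_cases j <;> simp [permToTriangular]
  have ht : (triangularToPerm R).map φ = triangularToPerm S := by
    ext i j
    fin_cases i <;> fin_cases j <;> simp [triangularToPerm]
  have h1 : (ε • signedUnipotent R a).map φ = signedUnipotent S a := by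
    rw [← hs]
    ext i j
    simp [hε]
  have h2 : (permToTriangular R * C * (triangularToPerm R * signedUnipotent R d)).map φ = B := by
    rw [Matrix.map_mul, Matrix.map_mul, Matrix.map_mul, hp, ht, hs, hC, hB]
    calc _ = (permToTriangular S * triangularToPerm S) * B * (signedUnipotent S d *
          (permToTriangular S * triangularToPerm S) * signedUnipotent S d) := by
            simp only [mul_assoc]
      _ = B := by rw [P.mul_inv, one_mul, mul_one, P.signed_self, mul_one]
  rw [fromBlocks_map, h1, h2, hs, Matrix.map_zero _ (map_zero φ)]

/-- The block decomposition of unitriangular representations of rank four over `𝔽₂`. -/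
theorem exists_blocks_of_unitriangular {Γ : Type*} [Group Γ]
    (ρ : Γ →* Matrix (Fin 4) (Fin 4) (ZMod 2)) (a d : Γ → Fin 2) (ha : ∀ γ, a γ = ρ γ 0 1)
    (hd : ∀ γ, d γ = ρ γ 2 3)
    (htri : ∀ γ, (ρ γ).BlockTriangular id) (hdiag : ∀ γ i, ρ γ i i = 1) (γ : Γ) :
    (ρ γ).submatrix (finSumFinEquiv : Fin 2 ⊕ Fin 2 ≃ Fin 4) (finSumFinEquiv : Fin 2 ⊕ Fin 2 ≃ Fin 4) =
      fromBlocks (signedUnipotent (ZMod 2) (a γ))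
        ((ρ γ).submatrix (finSumFinEquiv : Fin 2 ⊕ Fin 2 ≃ Fin 4) (finSumFinEquiv : Fin 2 ⊕ Fin 2 ≃ Fin 4)).toBlocks₁₂
        0 (signedUnipotent (ZMod 2) (d γ)) := by
  have hsU : ∀ x : Fin 2, (signedUnipotent (ZMod 2) x 0 0 = 1 ∧
      signedUnipotent (ZMod 2) x 0 1 = (show ZMod 2 from x) ∧ signedUnipotent (ZMod 2) x 1 0 = 0 ∧
      signedUnipotent (ZMod 2) x 1 1 = 1) := by decide
  have h1 := hsU (a γ)
  have h2 := hsU (d γ)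
  have hz : ∀ i j : Fin 4, j < i → ρ γ i j = 0 := fun i j hij => htri γ hij
  ext i j
  rcases i with i | i <;> rcases j with j | j
  · fin_cases i <;> fin_cases j
    · exact (hdiag γ 0).trans h1.1.symm
    · exact (ha γ).symm.trans h1.2.1.symm
    · exact (hz 1 0 (by decide)).trans h1.2.2.1.symm
    · exact (hdiag γ 1).trans h1.2.2.2.symm
  · rfl
  · fin_cases i <;> fin_cases j <;> exact hz _ _ (by decide)
  · fin_cases i <;> fin_cases j
    · exact (hdiag γ 2).trans h2.1.symm
    · exact (hd γ).symm.trans h2.2.1.symm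
    · exact (hz 3 2 (by decide)).trans h2.2.2.1.symm
    · exact (hdiag γ 3).trans h2.2.2.2.symm

variable {Ω Γ : Type*} [Group Γ] [Field Ω] [MulSemiringAction Γ Ω]

theorem exists_lift_rank_four [IsAlgClosed Ω] (hfin : ∀ x : Ω, (MulAction.orbit Γ x).Finite)
    {η : Ω} (hη : IsPrimitiveRoot η (2 ^ 2)) (hζ : ∀ γ : Γ, γ • η ^ 2 = η ^ 2)
    (ρ : Γ →* Matrix (Fin 4) (Fin 4) (ZMod 2)) (hρ : Smooth Ω ρ)
    (htri : ∀ γ, (ρ γ).BlockTriangular id) (hdiag : ∀ γ i, ρ γ i i = 1) (φ : ZMod (2 ^ 2) →+* ZMod 2) :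
    ∃ ρ' : Γ →* Matrix (Fin 4) (Fin 4) (ZMod (2 ^ 2)), Smooth Ω ρ' ∧
      (∀ γ, (ρ' γ).BlockTriangular id) ∧
      ∀ γ, (ρ' γ).map φ = ρ γ := by
  obtain ⟨ε, hεs, hε⟩ := exists_cyclotomic (Γ := Γ) hη
  let e : Fin 2 ⊕ Fin 2 ≃ Fin 4 := finSumFinEquiv
  obtain ⟨a, ha⟩ : ∃ a : Γ → Fin 2, ∀ γ, a γ = ρ γ 0 1 := ⟨fun γ => ρ γ 0 1, fun _ => rfl⟩
  obtain ⟨d, hd⟩ : ∃ d : Γ → Fin 2, ∀ γ, d γ = ρ γ 2 3 := ⟨fun γ => ρ γ 2 3, fun _ => rfl⟩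
  let B : Γ → Matrix (Fin 2) (Fin 2) (ZMod 2) := fun γ => ((ρ γ).submatrix e e).toBlocks₁₂
  have P := permTriangular_two
  have Q := permTriangular_four
  have hsUi : ∀ x y : Fin 2, signedUnipotent (ZMod 2) x = signedUnipotent (ZMod 2) y → x = y := by
    decide
  have hblock : ∀ γ, (ρ γ).submatrix e e =
      fromBlocks (signedUnipotent (ZMod 2) (a γ)) (B γ) 0 (signedUnipotent (ZMod 2) (d γ)) :=
    fun γ => exists_blocks_of_unitriangular ρ a d ha hd htri hdiag γ
  have hmul : ∀ γ δ, a (γ * δ) = a γ + a δ ∧ d (γ * δ) = d γ + d δ ∧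
      B (γ * δ) = signedUnipotent _ (a γ) * B δ + B γ * signedUnipotent _ (d δ) := by
    intro γ δ
    have h1 := hblock (γ * δ)
    rw [map_mul, ← submatrix_mul_equiv _ _ _ e, hblock γ, hblock δ, fromBlocks_multiply,
      fromBlocks_inj] at h1
    refine ⟨hsUi _ _ ?_, hsUi _ _ ?_, h1.2.1.symm⟩
    · rw [P.signed_add, ← h1.1, mul_zero, add_zero]
    · rw [P.signed_add, ← h1.2.2.2, zero_mul, zero_add]
  obtain ⟨C, hCdef⟩ : ∃ C : Γ → Matrix (Fin 2) (Fin 2) (ZMod 2), ∀ γ, C γ =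
      triangularToPerm _ * (B γ * signedUnipotent _ (d γ)) * permToTriangular _ :=
    ⟨_, fun _ => rfl⟩
  have hC : ∀ γ δ, C (γ * δ) = C γ + shiftMatrix _ (a γ) * C δ * shiftMatrix _ (d γ) := fun γ δ => by
    rw [hCdef, hCdef, hCdef, (hmul γ δ).2.2, (hmul γ δ).2.1]
    exact P.conj_add_mul _ _ _ _ _
  have ha1 : a 1 = 0 := by simpa using (hmul 1 1).1
  have hd1 : d 1 = 0 := by simpa using (hmul 1 1).2.1
  let _ : MulAction Γ (Fin 2 × Fin 2) :=
    { smul := fun γ s => (s.1 + a γ, s.2 + d γ)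
      one_smul := fun s => by
        change (s.1 + a 1, s.2 + d 1) = s
        rw [ha1, hd1, add_zero, add_zero]
      mul_smul := fun γ δ s => by
        change (s.1 + a (γ * δ), s.2 + d (γ * δ)) = (s.1 + a δ + a γ, s.2 + d δ + d γ)
        rw [(hmul γ δ).1, (hmul γ δ).2.1, add_assoc, add_assoc, add_comm (a γ), add_comm (d γ)] }
  have hsmul : ∀ (γ : Γ) (s : Fin 2 × Fin 2), γ • s = (s.1 + a γ, s.2 + d γ) := fun _ _ => rfl
  have hismul : ∀ (γ : Γ) (s : Fin 2 × Fin 2), γ⁻¹ • s = (s.1 - a γ, s.2 - d γ) := fun γ s => by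
    rw [inv_smul_eq_iff, hsmul]
    simp
  have has : Smooth Ω a := by
    rw [show a = fun γ => (ρ γ 0 1 : Fin 2) from funext ha]
    exact hρ.comp fun M => (M 0 1 : Fin 2)
  have hds : Smooth Ω d := by
    rw [show d = fun γ => (ρ γ 2 3 : Fin 2) from funext hd]
    exact hρ.comp fun M => (M 2 3 : Fin 2)
  have hBs : Smooth Ω B := hρ.comp fun M => (M.submatrix e e).toBlocks₁₂
  have hSs : Smooth Ω fun (γ : Γ) (s : Fin 2 × Fin 2) => γ • s := by
    have := has.comp₂ hds fun x y (s : Fin 2 × Fin 2) => (s.1 + x, s.2 + y)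
    exact this
  let c : Γ → Fin 2 × Fin 2 → ZMod 2 := fun γ s => C γ s.1 s.2
  have hcs : Smooth Ω c := by
    refine Smooth.comp (f := C) ?_ fun M (s : Fin 2 × Fin 2) => M s.1 s.2
    rw [funext hCdef]
    exact hBs.comp₂ hds fun B d => (triangularToPerm _ * (B * signedUnipotent _ d) *
      permToTriangular _ : Matrix (Fin 2) (Fin 2) (ZMod 2))
  have hcc : ∀ σ τ s, c (σ * τ) s = c σ s + c τ (σ⁻¹ • s) := fun σ τ s => by
    have hneg : ∀ x : Fin 2, -x = x := by decide
    have := congrFun (congrFun (hC σ τ) s.1) s.2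
    rw [Matrix.add_apply, shiftMatrix_mul_mul] at this
    rw [hismul, sub_eq_add_neg s.2, hneg]
    exact this
  obtain ⟨b, hbs, hb, hbr⟩ := exists_cocycle_lift hfin hη ε hε hζ hSs c hcs hcc
  let ε' : Γ →* ZMod (2 ^ 2) := (Units.coeHom (ZMod (2 ^ 2))).comp ε
  let C' : Γ → Matrix (Fin 2) (Fin 2) (ZMod (2 ^ 2)) := fun γ i j => b γ (i, j)
  have hC' : ∀ γ δ, C' (γ * δ) =
      C' γ + ε' γ • (shiftMatrix _ (a γ) * C' δ * shiftMatrix _ (d γ)) := fun γ δ => by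
    have hneg : ∀ x : Fin 2, -x = x := by decide
    ext i j
    rw [Matrix.add_apply, Matrix.smul_apply, shiftMatrix_mul_mul]
    have := hb γ δ (i, j)
    rw [hismul, sub_eq_add_neg j, hneg] at this
    exact this
  obtain ⟨σ, hσ⟩ := Q.exists_hom a d (fun γ δ => (hmul γ δ).1) (fun γ δ => (hmul γ δ).2.1)
    ε' C' hC'
  have hσs : Smooth Ω σ := by
    have h1 : Smooth Ω ε' := hεs.comp fun u => (u : ZMod (2 ^ 2))
    have h2 : Smooth Ω C' := hbs.comp fun b i j => b (i, j)
    rw [show (σ : Γ → _) = fun γ => _ from funext hσ]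
    exact ((h1.prod has).prod (h2.prod hds)).comp fun z => fromBlocks
      (z.1.1 • signedUnipotent (ZMod (2 ^ 2)) z.1.2) (permToTriangular _ * z.2.1 *
        (triangularToPerm _ * signedUnipotent _ z.2.2)) 0 (signedUnipotent _ z.2.2)
  have hφC : ∀ γ, (C' γ).map φ = C γ := fun γ => by
    ext i j
    change φ (b γ (i, j)) = c γ (i, j)
    rw [← hbr, ← map_natCast φ, ZMod.natCast_zmod_val]
  have hφε : ∀ γ, φ (ε' γ) = 1 := fun γ => by
    have h1 : IsUnit (φ (ε' γ)) := (ε γ).isUnit.map φ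
    have h2 : ∀ x : ZMod 2, x ≠ 0 → x = 1 := by decide
    exact h2 _ h1.ne_zero
  refine ⟨(Matrix.reindexAlgEquiv (ZMod (2 ^ 2)) (ZMod (2 ^ 2)) e : _ →* _).comp σ,
    hσs.comp _, fun γ => ?_, fun γ => ?_⟩
  · intro i j hij
    change σ γ (e.symm i) (e.symm j) = 0
    obtain ⟨i, rfl⟩ := e.surjective i
    obtain ⟨j, rfl⟩ := e.surjective j
    rw [e.symm_apply_apply, e.symm_apply_apply, hσ]
    have h10 : ∀ x, signedUnipotent (ZMod (2 ^ 2)) x 1 0 = 0 := fun x => by simp [signedUnipotent]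
    rcases i with i | i <;> rcases j with j | j
    · fin_cases i <;> fin_cases j <;> first | exact absurd hij (by decide) | skip
      rw [fromBlocks_apply₁₁, Matrix.smul_apply]
      exact (congrArg _ (h10 (a γ))).trans (smul_zero _)
    · fin_cases i <;> fin_cases j <;> exact absurd hij (by decide)
    · rfl
    · fin_cases i <;> fin_cases j <;> first | exact absurd hij (by decide) | skip
      exact h10 (d γ)
  · have h1 : (σ γ).map φ = (ρ γ).submatrix e e := by
      rw [hσ, hblock]
      exact P.map_fromBlocks φ _ _ (hφε γ) _ _ _ (hφC γ) (hCdef γ)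
    ext i j
    obtain ⟨i, rfl⟩ := e.surjective i
    obtain ⟨j, rfl⟩ := e.surjective j
    have h2 := congrFun (congrFun h1 i) j
    change φ (σ γ (e.symm (e i)) (e.symm (e j))) = _
    rw [e.symm_apply_apply, e.symm_apply_apply]
    exact h2

end Rank4

section Unitriangular

theorem Smooth.finite_range {Ω Γ X : Type*} [Group Γ] [MulAction Γ Ω]
    (hfin : ∀ x : Ω, (MulAction.orbit Γ x).Finite) {f : Γ → X} (hf : Smooth Ω f) :
    (Set.range f).Finite := by
  obtain ⟨S, hS⟩ := hf
  have := Smooth.finiteIndex_fixingSubgroup hfin S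
  refine (Set.finite_range fun q : Γ ⧸ fixingSubgroup Γ (S : Set Ω) => f q.out).subset ?_
  rintro _ ⟨γ, rfl⟩
  refine ⟨γ, ?_⟩
  obtain ⟨n, hn⟩ := QuotientGroup.mk_out_eq_mul (fixingSubgroup Γ (S : Set Ω)) γ
  dsimp only
  rw [hn]
  exact hS _ _ ((mem_fixingSubgroup_iff _).1 n.2)

theorem IsW2.exists_ringHom {p : ℕ} [Fact p.Prime] {k W : Type*} [Field k] [CharP k p]
    [CommRing W] {π : W →+* k} {v : k →+ W} (h : IsW2 p π v) :
    Nonempty (ZMod (p ^ 2) →+* W) := by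
  let _ := ringChar.charP W
  exact ⟨ZMod.castHom (ringChar.dvd h.natCast_sq) W⟩

variable {Ω Γ : Type*} [Group Γ] [Field Ω] [MulSemiringAction Γ Ω]
  {p : ℕ} [Fact p.Prime] {k W : Type*} [Field k] [CharP k p]
    [CommRing W] {π : W →+* k} {v : k →+ W}

/-- Every upper unitriangular representation of rank `n` lifts to an upper triangular one. -/
def UnitriangularLifts (Ω Γ : Type*) [Group Γ] [MulAction Γ Ω] {k W : Type*} [CommRing k]
    [CommRing W] (π : W →+* k) (n : ℕ) : Prop :=
  ∀ ρ : Γ →* Matrix (Fin n) (Fin n) k, Smooth Ω ρ → (∀ γ, (ρ γ).BlockTriangular id) →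
    (∀ γ i, ρ γ i i = 1) → ∃ ρ' : Γ →* Matrix (Fin n) (Fin n) W, Smooth Ω ρ' ∧
      (∀ γ, (ρ' γ).BlockTriangular id) ∧ ∀ γ, (ρ' γ).map π = ρ γ

theorem UnitriangularLifts.of_add {n r : ℕ} (hL : UnitriangularLifts Ω Γ π (n + r)) :
    UnitriangularLifts Ω Γ π n := by
  intro ρ hρ htri hdiag
  let e : Fin n ⊕ Fin r ≃ Fin (n + r) := finSumFinEquiv
  let E : Matrix (Fin n) (Fin n) k →* Matrix (Fin (n + r)) (Fin (n + r)) k :=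
    { toFun := fun M => (fromBlocks M 0 0 1).submatrix e.symm e.symm
      map_one' := by rw [fromBlocks_one, submatrix_one_equiv]
      map_mul' := fun M N => by
        rw [submatrix_mul_equiv, fromBlocks_multiply]
        simp }
  have hE : ∀ M i j, E M (e i) (e j) = fromBlocks M 0 0 1 i j := fun M i j => by
    change fromBlocks M 0 0 1 (e.symm (e i)) (e.symm (e j)) = _
    rw [e.symm_apply_apply, e.symm_apply_apply]
  have hl : ∀ i, e (Sum.inl i) = Fin.castAdd r i := fun _ => rfl
  have hr : ∀ i, e (Sum.inr i) = Fin.natAdd n i := fun _ => rfl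
  obtain ⟨σ, hσs, hσ, hσπ⟩ := hL (E.comp ρ) (hρ.comp E) (fun γ i j hij => by
    obtain ⟨i, rfl⟩ := e.surjective i
    obtain ⟨j, rfl⟩ := e.surjective j
    change E (ρ γ) (e i) (e j) = 0
    rw [hE]
    rcases i with i | i <;> rcases j with j | j
    · exact htri γ (i := i) (j := j) hij
    · rfl
    · rfl
    · rw [fromBlocks_apply₂₂, one_apply_ne]
      rintro rfl
      exact lt_irrefl _ hij) (fun γ i => by
    obtain ⟨i, rfl⟩ := e.surjective i
    change E (ρ γ) (e i) (e i) = 1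
    rw [hE]
    rcases i with i | i
    · exact hdiag γ i
    · rw [fromBlocks_apply₂₂, one_apply_eq])
  let c : Fin n → Fin (n + r) := Fin.castAdd r
  refine ⟨{ toFun := fun γ => (σ γ).submatrix c c, map_one' := ?_, map_mul' := fun γ δ => ?_ },
    hσs.comp fun M => M.submatrix c c, fun γ i j hij => hσ γ (i := c i) (j := c j) hij,
    fun γ => ?_⟩
  · rw [map_one]
    exact submatrix_one _ (Fin.castAdd_injective n r)
  · ext i j
    rw [map_mul, submatrix_apply, Matrix.mul_apply, Matrix.mul_apply, Fin.sum_univ_add]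
    conv_rhs => rw [← add_zero (∑ _, _)]
    congr 1
    refine Finset.sum_eq_zero fun l _ => ?_
    rw [hσ δ (show id (c j) < id (Fin.natAdd n l) from ?_), mul_zero]
    simp only [c, id, Fin.lt_def, Fin.val_castAdd, Fin.val_natAdd]
    omega
  · ext i j
    have h1 := congrFun (congrFun (hσπ γ) (c i)) (c j)
    rw [Matrix.map_apply] at h1 ⊢
    exact h1.trans (hE (ρ γ) (Sum.inl i) (Sum.inl j))

theorem IsW2.unitriangularLifts_two (h : IsW2 p π v) [IsAlgClosed Ω]
    (hfin : ∀ x : Ω, (MulAction.orbit Γ x).Finite) {η : Ω} (hη : IsPrimitiveRoot η (p ^ 2))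
    (hζ : ∀ γ : Γ, γ • η ^ p = η ^ p) : UnitriangularLifts Ω Γ π 2 := by
  intro ρ hρ htri hdiag
  have hp := (Fact.out : p.Prime)
  obtain ⟨F⟩ := h.exists_ringHom
  obtain ⟨ε, hεs, hε⟩ := exists_cyclotomic (Γ := Γ) hη
  let _ : Algebra (ZMod p) k := ZMod.algebra k p
  let b : Γ → k := fun γ => ρ γ 0 1
  have hb : ∀ γ δ, b (γ * δ) = b γ + b δ := fun γ δ => by
    simp only [b]
    rw [map_mul, Matrix.mul_apply, Fin.sum_univ_two, hdiag, hdiag]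
    ring
  have hbs : Smooth Ω b := hρ.comp fun M => M 0 1
  let V := Submodule.span (ZMod p) (Set.range b)
  have : Module.Finite (ZMod p) V := FiniteDimensional.span_of_finite _ (hbs.finite_range hfin)
  let B := Module.finBasis (ZMod p) V
  let m := Module.finrank (ZMod p) V
  let b1 : Γ → V := fun γ => ⟨b γ, Submodule.subset_span ⟨γ, rfl⟩⟩
  have hb1s : Smooth Ω b1 := Smooth.congr_inj Subtype.val_injective hbs
  let _ : MulAction Γ (Fin m) :=
    { smul := fun _ s => s
      one_smul := fun _ => rfl
      mul_smul := fun _ _ _ => rfl }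
  obtain ⟨b', hb's, hb', hb'r⟩ := exists_cocycle_lift hfin hη ε hε hζ (S := Fin m)
    (Smooth.const (id : Fin m → Fin m)) (fun γ s => B.repr (b1 γ) s)
    (hb1s.comp fun x s => B.repr x s) (fun σ τ s => by
      have : b1 (σ * τ) = b1 σ + b1 τ := Subtype.ext (hb σ τ)
      rw [this, map_add]
      rfl)
  choose a ha using fun s => h.surjective (B s : k)
  have hπF : ∀ x : ZMod (p ^ 2), π (F x) = algebraMap (ZMod p) k (x.val : ZMod p) := fun x => by
    conv_lhs => rw [← ZMod.natCast_zmod_val x]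
    rw [map_natCast, map_natCast, map_natCast]
  have hε1 : ∀ γ, π (F (ε γ : ZMod (p ^ 2))) = 1 := fun γ => by
    have h1 := hζ γ
    rw [smul_pow', hε, ← pow_mul, mul_comm, pow_mul] at h1
    have h2 : IsPrimitiveRoot (η ^ p) p := hη.pow (pow_pos hp.pos 2) (sq p)
    have h3 : ((ε γ : ZMod (p ^ 2)).val : ZMod p) = 1 := h2.pow_val_inj (by
      rw [IsPrimitiveRoot.pow_val_eq_pow h2.pow_eq_one _ _ rfl, h1,
        IsPrimitiveRoot.pow_val_eq_pow h2.pow_eq_one 1 _ (by simp), pow_one])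
    rw [hπF, h3, map_one]
  let C : Γ → W := fun γ => ∑ s, F (b' γ s) * a s
  have hC : ∀ γ δ, C (γ * δ) = C γ + F (ε γ : ZMod (p ^ 2)) * C δ := fun γ δ => by
    simp only [C]
    rw [Finset.mul_sum, ← Finset.sum_add_distrib]
    refine Finset.sum_congr rfl fun s _ => ?_
    rw [hb', map_add, map_mul, add_mul, mul_assoc]
    rfl
  have hC1 : C 1 = 0 := by
    have := hC 1 1
    rwa [mul_one, map_one, Units.val_one, map_one, one_mul, left_eq_add] at this
  have hCπ : ∀ γ, π (C γ) = b γ := fun γ => by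
    have h1 := congrArg Subtype.val (B.sum_repr (b1 γ))
    rw [AddSubmonoidClass.coe_finsetSum] at h1
    simp only [C]
    rw [map_sum, ← show _ = b γ from h1]
    refine Finset.sum_congr rfl fun s _ => ?_
    rw [map_mul, hπF, hb'r, ha, Submodule.coe_smul, Algebra.smul_def]
  refine ⟨{ toFun := fun γ => !![F (ε γ : ZMod (p ^ 2)), C γ; 0, 1]
            map_one' := ?_, map_mul' := fun γ δ => ?_ }, ?_, fun γ i j hij => ?_, fun γ => ?_⟩
  · rw [hC1, map_one, Units.val_one, map_one, one_fin_two]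
  · rw [hC, map_mul, Units.val_mul, map_mul]
    ext i j
    fin_cases i <;> fin_cases j <;> simp [Matrix.mul_apply, add_comm]
  · have hCs : Smooth Ω C := hb's.comp fun x => ∑ s, F (x s) * a s
    exact hεs.comp₂ hCs fun x y => !![F (x : ZMod (p ^ 2)), y; 0, 1]
  · fin_cases i <;> fin_cases j <;> first | exact absurd hij (by decide) | rfl
  · have h10 : ρ γ 1 0 = 0 := htri γ (by decide)
    ext i j
    fin_cases i <;> fin_cases j
    · exact (hε1 γ).trans (hdiag γ 0).symm
    · exact hCπ γ
    · exact (map_zero π).trans h10.symm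
    · exact (map_one π).trans (hdiag γ 1).symm

theorem IsW2.unitriangularLifts_four (h : IsW2 p π v) [IsAlgClosed Ω]
    (hfin : ∀ x : Ω, (MulAction.orbit Γ x).Finite) {η : Ω} (hη : IsPrimitiveRoot η (p ^ 2))
    (hζ : ∀ γ : Γ, γ • η ^ p = η ^ p) (hk : Nat.card k = 2) : UnitriangularLifts Ω Γ π 4 := by
  have hp := (Fact.out : p.Prime)
  have : Finite k := Nat.finite_of_card_ne_zero (by rw [hk]; decide)
  have := Fintype.ofFinite k
  have hp2 : p = 2 := by
    have h1 : (p : ℕ) ∣ 2 := by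
      rw [← CharP.cast_eq_zero_iff k, ← hk, Nat.card_eq_fintype_card]
      exact FiniteField.cast_card_eq_zero k
    exact (Nat.prime_dvd_prime_iff_eq hp Nat.prime_two).1 h1
  subst hp2
  intro ρ hρ htri hdiag
  obtain ⟨F⟩ := h.exists_ringHom
  let θ : ZMod 2 →+* k := ZMod.castHom (dvd_refl 2) k
  have hθ : Function.Bijective θ :=
    (Nat.bijective_iff_injective_and_card _).2 ⟨θ.injective, by rw [hk, Nat.card_zmod]⟩
  let θe : ZMod 2 ≃+* k := RingEquiv.ofBijective θ hθ
  let φ : ZMod (2 ^ 2) →+* ZMod 2 := ZMod.castHom (by decide) _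
  let G : Matrix (Fin 4) (Fin 4) k →* Matrix (Fin 4) (Fin 4) (ZMod 2) :=
    (RingHom.mapMatrix (θe.symm : k →+* ZMod 2) : _ →+* _).toMonoidHom
  have hG : ∀ M i j, G M i j = θe.symm (M i j) := fun _ _ _ => rfl
  let H : Matrix (Fin 4) (Fin 4) (ZMod (2 ^ 2)) →* Matrix (Fin 4) (Fin 4) W := (F.mapMatrix : _ →+* _).toMonoidHom
  have hH : ∀ M i j, H M i j = F (M i j) := fun _ _ _ => rfl
  obtain ⟨σ, hσs, hσ, hσφ⟩ := exists_lift_rank_four hfin hη hζ (G.comp ρ) (hρ.comp G)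
    (fun γ i j hij => by
      change G (ρ γ) i j = 0
      rw [hG, htri γ hij, map_zero])
    (fun γ i => by
      change G (ρ γ) i i = 1
      rw [hG, hdiag, map_one]) φ
  refine ⟨H.comp σ, hσs.comp H, fun γ i j hij => ?_, fun γ => ?_⟩
  · change H (σ γ) i j = 0
    rw [hH, hσ γ hij, map_zero]
  · ext i j
    change π (F (σ γ i j)) = _
    have h1 : π.comp F = θ.comp φ := RingHom.ext_zmod _ _
    have h2 : φ (σ γ i j) = θe.symm (ρ γ i j) := congrFun (congrFun (hσφ γ) i) j
    change (π.comp F) (σ γ i j) = _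
    rw [h1, RingHom.comp_apply, h2]
    exact θe.apply_symm_apply _

theorem IsW2.unitriangularLifts (h : IsW2 p π v) [IsAlgClosed Ω]
    (hfin : ∀ x : Ω, (MulAction.orbit Γ x).Finite) {η : Ω} (hη : IsPrimitiveRoot η (p ^ 2))
    (hζ : ∀ γ : Γ, γ • η ^ p = η ^ p) {n : ℕ} (hn : n ≤ 2 ∨ Nat.card k = 2 ∧ n ≤ 4) :
    UnitriangularLifts Ω Γ π n := by
  rcases hn with hn | ⟨hk, hn⟩
  · obtain ⟨r, hr⟩ := Nat.exists_eq_add_of_le hn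
    exact .of_add (r := r) (hr ▸ h.unitriangularLifts_two hfin hη hζ)
  · obtain ⟨r, hr⟩ := Nat.exists_eq_add_of_le hn
    exact .of_add (r := r) (hr ▸ h.unitriangularLifts_four hfin hη hζ hk)

end Unitriangular

section PGroup

variable {p : ℕ} [Fact p.Prime] {k : Type*} [Field k] [CharP k p] {G : Type*} [Group G] [Finite G]

theorem IsPGroup.exists_fixed_vector (hG : IsPGroup p G) {V : Type*} [AddCommGroup V] [Module k V]
    [Nontrivial V] (ρ : G →* Module.End k V) : ∃ v : V, v ≠ 0 ∧ ∀ g, ρ g v = v := by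
  obtain ⟨v, hv⟩ := exists_ne (0 : V)
  let _ : Algebra (ZMod p) k := ZMod.algebra k p
  let _ : Module (ZMod p) V := Module.compHom V (algebraMap (ZMod p) k)
  let N := Submodule.span (ZMod p) (Set.range fun g => ρ g v)
  have hN : ∀ (g : G), ∀ x ∈ N, ρ g x ∈ N := fun g x hx => by
    induction hx using Submodule.span_induction with
    | mem x hx =>
      obtain ⟨h, rfl⟩ := hx
      refine Submodule.subset_span ⟨g * h, ?_⟩
      simp only [map_mul, Module.End.mul_apply]
    | zero => rw [map_zero]; exact N.zero_mem
    | add x y _ _ hx hy => rw [map_add]; exact N.add_mem hx hy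
    | smul a x _ hx =>
      have : ρ g (a • x) = a • ρ g x := map_smul (ρ g) (algebraMap (ZMod p) k a) x
      rw [this]
      exact N.smul_mem a hx
  have : Module.Finite (ZMod p) N := FiniteDimensional.span_of_finite _ (Set.finite_range _)
  have : Finite N := Module.finite_of_finite (ZMod p)
  let _ : MulAction G N :=
    { smul := fun g x => ⟨ρ g x, hN g x x.2⟩
      one_smul := fun x => Subtype.ext (by change ρ 1 (x : V) = x; rw [map_one]; rfl)
      mul_smul := fun g h x => Subtype.ext (by
        change ρ (g * h) (x : V) = ρ g (ρ h x); rw [map_mul]; rfl) }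
  have hvN : v ∈ N := Submodule.subset_span ⟨1, by simp⟩
  have hdvd : p ∣ Nat.card N := by
    have h1 : addOrderOf (⟨v, hvN⟩ : N) = p := by
      refine addOrderOf_eq_prime (Subtype.ext ?_) fun h => hv (congrArg Subtype.val h)
      change p • v = 0
      rw [← Nat.cast_smul_eq_nsmul k, CharP.cast_eq_zero, zero_smul]
    exact h1.symm.dvd.trans (addOrderOf_dvd_natCard _)
  obtain ⟨w, hw, hw0⟩ := hG.exists_fixed_point_of_prime_dvd_card_of_fixed_point N hdvd (a := 0)
    (fun g => Subtype.ext (map_zero (ρ g)))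
  exact ⟨w, fun h => hw0 (Subtype.ext h.symm), fun g => congrArg Subtype.val (hw g)⟩

/-- Representations of `p`-groups in characteristic `p` are triangularizable. -/
theorem IsPGroup.exists_basis (hG : IsPGroup p G) (n : ℕ) (V : Type*) [AddCommGroup V]
    [Module k V] [Module.Finite k V] (hn : Module.finrank k V = n) (ρ : G →* Module.End k V) :
    ∃ b : Module.Basis (Fin n) k V, ∀ g i j, j < i → b.repr (ρ g (b j)) i = 0 := by
  induction n generalizing V with
  | zero => exact ⟨Module.finBasisOfFinrankEq k V hn, fun g i => i.elim0⟩
  | succ n ih =>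
    have : Nontrivial V := Module.nontrivial_of_finrank_pos (R := k) (by omega)
    obtain ⟨v, hv0, hv⟩ := hG.exists_fixed_vector ρ
    let W := Submodule.span k {v}
    have hW : ∀ g, W ≤ W.comap (ρ g) := fun g => by
      rw [Submodule.span_singleton_le_iff_mem, Submodule.mem_comap, hv]
      exact Submodule.mem_span_singleton_self v
    let ρ' : G →* Module.End k (V ⧸ W) :=
      { toFun := fun g => W.mapQ W (ρ g) (hW g)
        map_one' := by
          ext x
          simp
        map_mul' := fun g h => by
          ext x
          simp }
    have hρ' : ∀ g x, ρ' g (W.mkQ x) = W.mkQ (ρ g x) := fun g x => rfl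
    have hWr : Module.finrank k W = 1 := finrank_span_singleton hv0
    have hQ : Module.finrank k (V ⧸ W) = n := by
      have := W.finrank_quotient_add_finrank
      omega
    obtain ⟨b, hb⟩ := ih (V ⧸ W) hQ ρ'
    let bW := Module.finBasisOfFinrankEq k W hWr
    let e : Fin 1 ⊕ Fin n ≃ Fin (n + 1) := finSumFinEquiv.trans (finCongr (add_comm 1 n))
    have he0 : ∀ i, ((e (Sum.inl i) : Fin (n + 1)) : ℕ) = i := fun _ => rfl
    have he1 : ∀ i, ((e (Sum.inr i) : Fin (n + 1)) : ℕ) = 1 + i := fun _ => rfl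
    refine ⟨(Module.Basis.sumQuot bW b).reindex e, fun g i j hij => ?_⟩
    obtain ⟨i, rfl⟩ := e.surjective i
    obtain ⟨j, rfl⟩ := e.surjective j
    rw [Module.Basis.reindex_apply, Module.Basis.repr_reindex_apply, e.symm_apply_apply,
      e.symm_apply_apply]
    rw [Fin.lt_def] at hij
    rcases i with i | i
    · rw [he0] at hij
      omega
    · rw [Module.Basis.sumQuot_repr_inr, ← hρ']
      rcases j with j | j
      · rw [Module.Basis.sumQuot_inl, (show W.mkQ (bW j : V) = 0 from (Submodule.Quotient.mk_eq_zero W).2 (bW j).2)]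
        simp
      · rw [he1, he1] at hij
        have := Module.Basis.sumQuot_inr bW b j
        rw [Submodule.mkQ_apply, this]
        exact hb g i j (by rw [Fin.lt_def]; omega)

/-- A finite `p`-subgroup of `GL_n(k)` is conjugate to a group of triangular matrices. -/
theorem IsPGroup.exists_conj_blockTriangular (hG : IsPGroup p G) {n : ℕ} (ρ : G →* GL (Fin n) k) :
    ∃ A : GL (Fin n) k, ∀ g, ((A * ρ g * A⁻¹ : GL (Fin n) k) : Matrix (Fin n) (Fin n) k).BlockTriangular id := by
  let ρ' : G →* Module.End k (Fin n → k) :=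
    (Matrix.toLinAlgEquiv' : Matrix (Fin n) (Fin n) k ≃ₐ[k] _).toMonoidHom.comp
      ((Units.coeHom _).comp ρ)
  have hρ' : ∀ g, ρ' g = Matrix.toLin' (ρ g : Matrix (Fin n) (Fin n) k) := fun _ => rfl
  obtain ⟨b, hb⟩ := hG.exists_basis n (Fin n → k) (Module.finrank_fin_fun k) ρ'
  let e := Pi.basisFun k (Fin n)
  refine ⟨⟨b.toMatrix e, e.toMatrix b, b.toMatrix_mul_toMatrix_flip e,
    e.toMatrix_mul_toMatrix_flip b⟩, fun g i j hij => ?_⟩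
  have h1 := basis_toMatrix_mul_linearMap_toMatrix_mul_basis_toMatrix b e b e (ρ' g)
  rw [hρ', LinearMap.toMatrix_eq_toMatrix', LinearMap.toMatrix'_toLin', ← hρ'] at h1
  change (b.toMatrix e * (ρ g : Matrix (Fin n) (Fin n) k) * e.toMatrix b) i j = 0
  rw [h1, LinearMap.toMatrix_apply]
  exact hb g i j hij

end PGroup

theorem Matrix.BlockTriangular.mul_apply_self {n : ℕ} {R : Type*} [CommRing R]
    {M N : Matrix (Fin n) (Fin n) R} (hM : M.BlockTriangular id) (hN : N.BlockTriangular id)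
    (i : Fin n) : (M * N) i i = M i i * N i i := by
  rw [Matrix.mul_apply]
  refine Finset.sum_eq_single i (fun j _ hj => ?_) (by simp)
  rcases lt_or_gt_of_ne hj with h | h
  · rw [hM (i := i) (j := j) h, zero_mul]
  · rw [hN (i := j) (j := i) h, mul_zero]

theorem Matrix.BlockTriangular.pow_apply_self {n : ℕ} {R : Type*} [CommRing R]
    {M : Matrix (Fin n) (Fin n) R} (hM : M.BlockTriangular id) (m : ℕ) :
    (M ^ m).BlockTriangular id ∧ ∀ i, (M ^ m) i i = M i i ^ m := by
  induction m with
  | zero => exact ⟨by rw [pow_zero]; exact blockTriangular_one, fun i => by simp⟩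
  | succ m ih => exact ⟨by rw [pow_succ]; exact ih.1.mul hM, fun i => by
      rw [pow_succ, ih.1.mul_apply_self hM, ih.2, pow_succ]⟩

theorem eq_one_of_pow_prime_pow_eq_one {p : ℕ} [Fact p.Prime] {k : Type*} [Field k] [CharP k p]
    {x : k} {m : ℕ} (hx : x ^ p ^ m = 1) : x = 1 := by
  have : (x - 1) ^ p ^ m = 0 := by rw [sub_pow_char_pow, hx, one_pow, sub_self]
  exact sub_eq_zero.1 ((pow_eq_zero_iff (pow_pos (Fact.out : p.Prime).pos m).ne').1 this)

section Extensions

variable {p : ℕ} [Fact p.Prime] {k W : Type*} [Field k] [CharP k p]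
    [CommRing W] {π : W →+* k} {v : k →+ W} {n : ℕ}

/-- The kernel of reduction on `GL_n`. -/
noncomputable def IsW2.kerHom (h : IsW2 p π v) (n : ℕ) :
    Multiplicative (Matrix (Fin n) (Fin n) k) →* GL (Fin n) W where
  toFun X := h.kerElem X.toAdd
  map_one' := h.kerElem_zero
  map_mul' X Y := h.kerElem_add X.toAdd Y.toAdd

theorem IsW2.isAbExt_gl (h : IsW2 p π v) :
    IsAbExt p (GeneralLinearGroup.map (n := Fin n) π) (h.kerHom n) where
  surjective A := by
    choose f hf using h.surjective
    have h1 : ((A : Matrix (Fin n) (Fin n) k).map f).map π = A := by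
      ext i j
      exact hf _
    obtain ⟨B, hB⟩ := h.isUnit_of_map_matrix (A := (A : Matrix (Fin n) (Fin n) k).map f)
      (by rw [h1]; exact A.isUnit)
    refine ⟨B, Units.ext ?_⟩
    change (B : Matrix (Fin n) (Fin n) W).map π = A
    rw [hB, h1]
  injective X Y hXY := h.kerElem_injective hXY
  exists_of_map_eq_one e he := by
    obtain ⟨X, hX⟩ := h.exists_kerElem he
    exact ⟨Multiplicative.ofAdd X, hX.symm⟩
  map_ι X := h.map_kerElem _
  nsmul_eq_zero X := by
    rw [← Nat.cast_smul_eq_nsmul k, CharP.cast_eq_zero, zero_smul]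

/-- Upper triangular matrices. -/
def upperTriangular (n : ℕ) (k : Type*) [CommRing k] : AddSubgroup (Matrix (Fin n) (Fin n) k) where
  carrier := {M | M.BlockTriangular id}
  zero_mem' := blockTriangular_zero
  add_mem' := BlockTriangular.add
  neg_mem' := BlockTriangular.neg

/-- The kernel of reduction on the Borel subgroup. -/
noncomputable def IsW2.kerBorelHom (h : IsW2 p π v) (n : ℕ) :
    Multiplicative (upperTriangular n k) →* BorelSubgroup n W where
  toFun X := ⟨h.kerElem X.toAdd, fun i j hij => by
    rw [h.coe_kerElem, Matrix.add_apply, Matrix.map_apply, X.toAdd.2 hij, map_zero,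
      one_apply_ne (i := i) (j := j) (ne_of_gt hij), zero_add]⟩
  map_one' := Subtype.ext h.kerElem_zero
  map_mul' X Y := Subtype.ext (h.kerElem_add _ _)

theorem IsW2.isAbExt_borel (h : IsW2 p π v) :
    IsAbExt p (BorelSubgroup.map (n := n) π) (h.kerBorelHom n) where
  surjective A := by
    have h0 : ∀ x, ∃ y, π y = x ∧ (x = 0 → y = 0) := fun x => by
      by_cases hx : x = 0
      · exact ⟨0, by rw [map_zero, hx], fun _ => rfl⟩
      · obtain ⟨y, hy⟩ := h.surjective x
        exact ⟨y, hy, fun h => absurd h hx⟩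
    choose f hf hf0 using h0
    have h1 : ((A.1 : Matrix (Fin n) (Fin n) k).map f).map π = A.1 := by
      ext i j
      exact hf _
    obtain ⟨B, hB⟩ := h.isUnit_of_map_matrix (A := (A.1 : Matrix (Fin n) (Fin n) k).map f)
      (by rw [h1]; exact A.1.isUnit)
    refine ⟨⟨B, fun i j hij => ?_⟩, Subtype.ext (Units.ext ?_)⟩
    · rw [hB]
      exact hf0 _ (A.2 hij)
    · change (B : Matrix (Fin n) (Fin n) W).map π = A.1
      rw [hB, h1]
  injective X Y hXY := Subtype.ext (h.kerElem_injective (congrArg Subtype.val hXY))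
  exists_of_map_eq_one e he := by
    obtain ⟨X, hX⟩ := h.exists_kerElem (A := e.1) (congrArg Subtype.val he)
    refine ⟨Multiplicative.ofAdd (⟨X, fun i j hij => h.injective ?_⟩ : upperTriangular n k),
      Subtype.ext hX.symm⟩
    have h2 := e.2 hij
    rw [hX, h.coe_kerElem, Matrix.add_apply, one_apply_ne (i := i) (j := j) (ne_of_gt hij), zero_add,
      Matrix.map_apply] at h2
    rw [h2, map_zero]
  map_ι X := Subtype.ext (h.map_kerElem _)
  nsmul_eq_zero X := Subtype.ext (by
    change p • (X : Matrix (Fin n) (Fin n) k) = 0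
    rw [← Nat.cast_smul_eq_nsmul k, CharP.cast_eq_zero, zero_smul])

end Extensions

section Positive

variable {Ω Γ : Type*} [Group Γ] [Field Ω] [MulSemiringAction Γ Ω]

theorem Smooth.exists_sylow (hfin : ∀ x : Ω, (MulAction.orbit Γ x).Finite) (p : ℕ) [Fact p.Prime]
    {Q : Type*} [Group Q] (ψ : Γ →* Q) (hψ : Smooth Ω ψ) :
    ∃ (U : Subgroup Γ) (S : Finset Ω), fixingSubgroup Γ (S : Set Ω) ≤ U ∧ ¬ p ∣ U.index ∧
      Finite (U.map ψ) ∧ IsPGroup p (U.map ψ) := by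
  have h1 := hψ.finite_range hfin
  have : Finite ψ.range := h1.to_subtype
  obtain ⟨S, hS⟩ := hψ.exists_hom
  let P : Sylow p ψ.range := default
  refine ⟨(P : Subgroup ψ.range).comap ψ.rangeRestrict, S, fun γ hγ => ?_, ?_, ?_, ?_⟩
  · rw [Subgroup.mem_comap, show ψ.rangeRestrict γ = 1 from
      Subtype.ext (hS γ ((mem_fixingSubgroup_iff _).1 hγ))]
    exact one_mem _
  · rw [Subgroup.index_comap_of_surjective _ ψ.rangeRestrict_surjective]
    exact P.not_dvd_index
  · refine (h1.subset ?_).to_subtype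
    rintro _ ⟨u, -, rfl⟩
    exact ⟨u, rfl⟩
  · rintro ⟨_, u, hu, rfl⟩
    obtain ⟨m, hm⟩ := P.isPGroup' ⟨ψ.rangeRestrict u, hu⟩
    exact ⟨m, Subtype.ext (congrArg (fun x : P => ((x : ψ.range) : Q)) hm)⟩

variable {p : ℕ} [Fact p.Prime] {k W : Type*} [Field k] [CharP k p]
    [CommRing W] {π : W →+* k} {v : k →+ W} {n : ℕ}

/-- Reduction of the lifting problem to representations in upper unitriangular matrices. -/
theorem IsW2.exists_restrict_unitriangular (h : IsW2 p π v) [IsAlgClosed Ω]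
    (hfin : ∀ x : Ω, (MulAction.orbit Γ x).Finite) (hp : (p : Ω) ≠ 0)
    (hn : n ≤ 2 ∨ Nat.card k = 2 ∧ n ≤ 4) (ρ : Γ →* GL (Fin n) k) (hρ : Smooth Ω ρ) :
    ∃ (U : Subgroup Γ) (S : Finset Ω), fixingSubgroup Γ (S : Set Ω) ≤ U ∧ ¬ p ∣ U.index ∧
      ∃ A : GL (Fin n) k, ((∀ γ, ρ γ ∈ BorelSubgroup n k) → A = 1) ∧
        ∃ σ : U →* BorelSubgroup n W, Smooth Ω σ ∧
          ∀ u, GeneralLinearGroup.map π (σ u) = A * ρ u * A⁻¹ := by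
  have hpp := (Fact.out : p.Prime)
  have : NeZero ((p ^ 2 : ℕ) : Ω) := ⟨by rw [Nat.cast_pow]; exact pow_ne_zero 2 hp⟩
  obtain ⟨η, hη⟩ := HasEnoughRootsOfUnity.exists_primitiveRoot Ω (p ^ 2)
  have hζ : IsPrimitiveRoot (η ^ p) p := hη.pow (pow_pos hpp.pos 2) (sq p)
  obtain ⟨ω, hωs, hω⟩ := exists_cyclotomic (Γ := Γ) hζ
  obtain ⟨U, S, hSU, hU, hfinU, hP⟩ := Smooth.exists_sylow hfin p (ρ.prod ω) (hρ.prod hωs)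
  have hpow : ∀ u : U, ∃ m, ρ u ^ p ^ m = 1 ∧ ω u ^ p ^ m = 1 := fun u => by
    obtain ⟨m, hm⟩ := hP ⟨_, Subgroup.mem_map_of_mem _ u.2⟩
    have := congrArg Subtype.val hm
    exact ⟨m, congrArg Prod.fst this, congrArg Prod.snd this⟩
  have hω1 : ∀ (u : U), u • η ^ p = η ^ p := fun u => by
    obtain ⟨m, -, hm⟩ := hpow u
    have h1 : (ω u : ZMod p) = 1 := eq_one_of_pow_prime_pow_eq_one (p := p) (m := m) (by
      rw [← Units.val_pow_eq_pow_val, hm, Units.val_one])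
    change (u : Γ) • η ^ p = _
    rw [hω, h1, IsPrimitiveRoot.pow_val_eq_pow hζ.pow_eq_one 1 _ (by simp), pow_one]
  have hA : ∃ A : GL (Fin n) k, ((∀ γ, ρ γ ∈ BorelSubgroup n k) → A = 1) ∧
      ∀ u : U, A * ρ u * A⁻¹ ∈ BorelSubgroup n k := by
    by_cases hB : ∀ γ, ρ γ ∈ BorelSubgroup n k
    · exact ⟨1, fun _ => rfl, fun u => by simpa using hB u⟩
    · obtain ⟨A, hA⟩ := hP.exists_conj_blockTriangular
        ((MonoidHom.fst _ _).comp (U.map (ρ.prod ω)).subtype)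
      exact ⟨A, fun h => absurd h hB, fun u => hA ⟨_, Subgroup.mem_map_of_mem _ u.2⟩⟩
  obtain ⟨A, hA1, hA⟩ := hA
  let τ : U →* GL (Fin n) k := (MulAut.conj A).toMonoidHom.comp (ρ.comp U.subtype)
  have hτ : ∀ u, τ u = A * ρ u * A⁻¹ := fun u => rfl
  have hτs : Smooth Ω τ := (hρ.restrict U).comp (MulAut.conj A)
  obtain ⟨σ, hσs, hσ, hσπ⟩ := h.unitriangularLifts (Γ := U) (n := n)
    (fun x => (hfin x).subset (by
      rintro _ ⟨u, rfl⟩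
      exact ⟨u, rfl⟩)) hη hω1 hn
    ((Units.coeHom _).comp τ) (hτs.comp Units.val) hA (fun u i => by
      obtain ⟨m, hm, -⟩ := hpow u
      refine eq_one_of_pow_prime_pow_eq_one (p := p) (m := m) ?_
      have h2 : (τ u : Matrix (Fin n) (Fin n) k) ^ p ^ m = 1 := by
        rw [← Units.val_pow_eq_pow_val, hτ, conj_pow, hm, mul_one, mul_inv_cancel, Units.val_one]
      have h3 := ((hA u).pow_apply_self (p ^ m)).2 i
      change (τ u : Matrix (Fin n) (Fin n) k) i i ^ p ^ m = 1
      refine h3.symm.trans ?_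
      exact (congrFun (congrFun h2 i) i).trans (one_apply_eq i))
  refine ⟨U, S, hSU, hU, A, hA1, σ.toHomUnits.codRestrict (BorelSubgroup n W) hσ, ?_, fun u => ?_⟩
  · refine Smooth.congr_inj (g := fun x => ((x : GL (Fin n) W) : Matrix (Fin n) (Fin n) W))
      (fun x y hxy => Subtype.ext (Units.ext hxy)) hσs
  · rw [← hτ]
    exact Units.ext (hσπ u)

theorem IsW2.exists_smooth_lift_gl (h : IsW2 p π v) [IsAlgClosed Ω]
    (hfin : ∀ x : Ω, (MulAction.orbit Γ x).Finite)
    (hn : (p : Ω) = 0 ∨ n ≤ 2 ∨ Nat.card k = 2 ∧ n ≤ 4) (ρ : Γ →* GL (Fin n) k)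
    (hρ : Smooth Ω ρ) :
    ∃ ρ' : Γ →* GL (Fin n) W, Smooth Ω ρ' ∧ (GeneralLinearGroup.map π).comp ρ' = ρ := by
  by_cases hp : (p : Ω) = 0
  · have : CharP Ω p := (CharP.charP_iff_prime_eq_zero Fact.out).2 hp
    exact h.isAbExt_gl.exists_smooth_lift_of_charP hfin ρ hρ
  · obtain ⟨U, S, hSU, hU, A, -, σ, hσs, hσ⟩ :=
      h.exists_restrict_unitriangular hfin hp (hn.resolve_left hp) ρ hρ
    obtain ⟨B, hB⟩ := h.isAbExt_gl.surjective A
    refine h.isAbExt_gl.exists_smooth_lift_of_index hfin U S hSU hU Fact.out ρ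
      ((MulAut.conj B⁻¹).toMonoidHom.comp ((BorelSubgroup n W).subtype.comp σ)) ?_ fun u => ?_
    · exact hσs.comp fun x => MulAut.conj B⁻¹ (x : GL (Fin n) W)
    · change GeneralLinearGroup.map π (B⁻¹ * (σ u : GL (Fin n) W) * B⁻¹⁻¹) = _
      rw [inv_inv, map_mul, map_mul, hσ, map_inv, hB]
      simp only [mul_assoc, inv_mul_cancel, mul_one, inv_mul_cancel_left]

theorem IsW2.exists_smooth_lift_borel (h : IsW2 p π v) [IsAlgClosed Ω]
    (hfin : ∀ x : Ω, (MulAction.orbit Γ x).Finite)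
    (hn : (p : Ω) = 0 ∨ n ≤ 2 ∨ Nat.card k = 2 ∧ n ≤ 4) (ρ : Γ →* BorelSubgroup n k)
    (hρ : Smooth Ω ρ) :
    ∃ ρ' : Γ →* BorelSubgroup n W, Smooth Ω ρ' ∧ (BorelSubgroup.map π).comp ρ' = ρ := by
  by_cases hp : (p : Ω) = 0
  · have : CharP Ω p := (CharP.charP_iff_prime_eq_zero Fact.out).2 hp
    exact h.isAbExt_borel.exists_smooth_lift_of_charP hfin ρ hρ
  · obtain ⟨U, S, hSU, hU, A, hA, σ, hσs, hσ⟩ :=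
      h.exists_restrict_unitriangular hfin hp (hn.resolve_left hp)
        ((BorelSubgroup n k).subtype.comp ρ) (hρ.comp (BorelSubgroup n k).subtype)
    refine h.isAbExt_borel.exists_smooth_lift_of_index hfin U S hSU hU Fact.out ρ σ hσs
      fun u => Subtype.ext ?_
    change GeneralLinearGroup.map π (σ u : GL (Fin n) W) = _
    rw [hσ, hA fun γ => (ρ γ).2]
    simp

end Positive

section Galois

variable {K L : Type*} [Field K] [Field L] [Algebra K L]

theorem Gal.finite_orbit [Algebra.IsIntegral K L] (x : L) :
    (MulAction.orbit (L ≃ₐ[K] L) x).Finite := by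
  classical
  have hx := Algebra.IsIntegral.isIntegral (R := K) x
  have h0 : (minpoly K x).map (algebraMap K L) ≠ 0 :=
    (Polynomial.map_ne_zero_iff (algebraMap K L).injective).2 (minpoly.ne_zero hx)
  refine (((minpoly K x).map (algebraMap K L)).roots.toFinset.finite_toSet).subset ?_
  rintro _ ⟨σ, rfl⟩
  simp only [Finset.mem_coe, Multiset.mem_toFinset, Polynomial.mem_roots h0,
    Polynomial.IsRoot.def, Polynomial.eval_map_algebraMap]
  change Polynomial.aeval (σ x) (minpoly K x) = 0
  rw [← minpoly.algEquiv_eq σ x, minpoly.aeval]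

theorem Gal.smooth_iff_continuous [Algebra.IsIntegral K L] {E : Type*} [Group E]
    (ρ : (L ≃ₐ[K] L) →* E) : Continuous[_, ⊥] ρ ↔ Smooth L ρ := by
  let _ : TopologicalSpace E := ⊥
  have : DiscreteTopology E := ⟨rfl⟩
  change Continuous ρ ↔ _
  constructor
  · intro h
    have h1 : ρ ⁻¹' {1} ∈ 𝓝 (1 : L ≃ₐ[K] L) :=
      (h.isOpen_preimage _ (isOpen_discrete _)).mem_nhds (map_one ρ)
    obtain ⟨F, hF, hF1⟩ := (krullTopology_mem_nhds_one_iff K L _).1 h1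
    let b := Module.finBasis K F
    classical
    refine Smooth.of_hom ρ (Finset.univ.image fun i => (b i : L)) fun n hn => ?_
    refine hF1 ((IntermediateField.mem_fixingSubgroup_iff _ _).2 fun x hx => ?_)
    have h2 := congrArg Subtype.val (b.sum_repr ⟨x, hx⟩)
    rw [AddSubmonoidClass.coe_finsetSum] at h2
    rw [← show _ = x from h2, map_sum]
    refine Finset.sum_congr rfl fun i _ => ?_
    have h3 : n (b i : L) = b i := hn _ (Finset.mem_image.2 ⟨i, Finset.mem_univ _, rfl⟩)
    rw [IntermediateField.coe_smul, map_smul, h3]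
  · rintro ⟨S, hS⟩
    rw [← IsLocallyConstant.iff_continuous, IsLocallyConstant.iff_exists_open]
    intro γ
    refine ⟨(fun δ => γ⁻¹ * δ) ⁻¹' ⋂ x ∈ S, (MulAction.stabilizer (L ≃ₐ[K] L) x : Set _),
      (isOpen_biInter_finset fun x _ => stabilizer_isOpen_of_isIntegral x).preimage
        (continuous_const_mul _), ?_, fun δ hδ => ?_⟩
    · simp
    · have := hS γ (γ⁻¹ * δ) fun x hx => Set.mem_iInter₂.1 hδ x hx
      rwa [mul_inv_cancel_left] at this

end Galois

section PositiveGalois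

variable (p : ℕ) [Fact p.Prime] {F : Type} [Field F] {k : Type} [Field k] [CharP k p] (n : ℕ)

theorem natCast_algebraicClosure_eq_zero {F K : Type*} [Field F] [Field K] [Algebra F K] {p : ℕ}
    (h : ringChar F = p) : (p : AlgebraicClosure K) = 0 := by
  have h1 : (p : F) = 0 := by rw [← h, ringChar.Nat.cast_ringChar]
  have := congrArg ((algebraMap K (AlgebraicClosure K)).comp (algebraMap F K)) h1
  rwa [map_natCast, map_zero] at this

theorem exists_lift_gl_of_condition
    (hn : ringChar F = p ∨ n ≤ 2 ∨ Nat.card k = 2 ∧ n ≤ 4) (K : Type) [Field K] [Algebra F K]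
    (ρ : Field.absoluteGaloisGroup K →* GL (Fin n) k) (hρ : Continuous[_, ⊥] ⇑ρ) :
    ∃ ρ' : Field.absoluteGaloisGroup K →* GL (Fin n) (TruncatedWittVector p 2 k),
      Continuous[_, ⊥] ⇑ρ' ∧ (Matrix.GeneralLinearGroup.map (wittReduce p k)).comp ρ' = ρ := by
  obtain ⟨ρ', h1, h2⟩ := (isW2_wittReduce p k).exists_smooth_lift_gl
    (Γ := AlgebraicClosure K ≃ₐ[K] AlgebraicClosure K) Gal.finite_orbit
    (hn.imp_left natCast_algebraicClosure_eq_zero) ρ ((Gal.smooth_iff_continuous _).1 hρ)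
  exact ⟨ρ', (Gal.smooth_iff_continuous _).2 h1, h2⟩

theorem exists_lift_borel_of_condition
    (hn : ringChar F = p ∨ n ≤ 2 ∨ Nat.card k = 2 ∧ n ≤ 4) (K : Type) [Field K] [Algebra F K]
    (ρ : Field.absoluteGaloisGroup K →* BorelSubgroup n k) (hρ : Continuous[_, ⊥] ⇑ρ) :
    ∃ ρ' : Field.absoluteGaloisGroup K →* BorelSubgroup n (TruncatedWittVector p 2 k),
      Continuous[_, ⊥] ⇑ρ' ∧ (BorelSubgroup.map (wittReduce p k)).comp ρ' = ρ := by
  obtain ⟨ρ', h1, h2⟩ := (isW2_wittReduce p k).exists_smooth_lift_borel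
    (Γ := AlgebraicClosure K ≃ₐ[K] AlgebraicClosure K) Gal.finite_orbit
    (hn.imp_left natCast_algebraicClosure_eq_zero) ρ ((Gal.smooth_iff_continuous _).1 hρ)
  exact ⟨ρ', (Gal.smooth_iff_continuous _).2 h1, h2⟩

end PositiveGalois

/-- Three orthogonal idempotents of a ring together with subgroups `X`, `Y`, `Z` of the corresponding
strictly upper-triangular blocks, such that `1 + X + Y + Z` is a group. -/
structure HeisDatum (A : Type*) [Ring A] where
  e₁ : A
  e₂ : A
  e₃ : A
  e₁₁ : e₁ * e₁ = e₁
  e₂₂ : e₂ * e₂ = e₂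
  e₃₃ : e₃ * e₃ = e₃
  e₁₂ : e₁ * e₂ = 0
  e₂₁ : e₂ * e₁ = 0
  e₁₃ : e₁ * e₃ = 0
  e₃₁ : e₃ * e₁ = 0
  e₂₃ : e₂ * e₃ = 0
  e₃₂ : e₃ * e₂ = 0
  X : AddSubgroup A
  Y : AddSubgroup A
  Z : AddSubgroup A
  hX : ∀ x ∈ X, e₁ * x * e₂ = x
  hY : ∀ x ∈ Y, e₂ * x * e₃ = x
  hZ : ∀ x ∈ Z, e₁ * x * e₃ = x
  mul_mem : ∀ x ∈ X, ∀ y ∈ Y, x * y ∈ Z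

namespace HeisDatum

variable {A : Type*} [Ring A] (D : HeisDatum A)

theorem mul_eq_zero_of {A : Type*} [Ring A] {a b e e' f f' : A} (ha : e * a * e' = a)
    (hb : f * b * f' = b) (h : e' * f = 0) : a * b = 0 := by
  rw [← ha, ← hb, show e * a * e' * (f * b * f') = e * a * (e' * f) * b * f' by noncomm_ring, h]
  simp

@[ext] structure Grp where
  x : D.X
  y : D.Y
  z : D.Z

namespace Grp

instance [Finite D.X] [Finite D.Y] [Finite D.Z] : Finite D.Grp :=
  Finite.of_injective (fun g : D.Grp => (g.x, g.y, g.z)) fun g h hgh => by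
    simp only [Prod.mk.injEq] at hgh
    exact Grp.ext hgh.1 hgh.2.1 hgh.2.2

variable {D}

instance : Mul D.Grp where
  mul g h := ⟨g.x + h.x, g.y + h.y, g.z + h.z + ⟨g.x * h.y, D.mul_mem _ g.x.2 _ h.y.2⟩⟩

instance : One D.Grp where one := ⟨0, 0, 0⟩

instance : Inv D.Grp where
  inv g := ⟨-g.x, -g.y, -g.z + ⟨g.x * g.y, D.mul_mem _ g.x.2 _ g.y.2⟩⟩

@[simp] theorem mul_x (g h : D.Grp) : (g * h).x = g.x + h.x := rfl
@[simp] theorem mul_y (g h : D.Grp) : (g * h).y = g.y + h.y := rfl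
@[simp] theorem mul_z (g h : D.Grp) :
    (g * h).z = g.z + h.z + ⟨g.x * h.y, D.mul_mem _ g.x.2 _ h.y.2⟩ := rfl
@[simp] theorem one_x : (1 : D.Grp).x = 0 := rfl
@[simp] theorem one_y : (1 : D.Grp).y = 0 := rfl
@[simp] theorem one_z : (1 : D.Grp).z = 0 := rfl
@[simp] theorem inv_x (g : D.Grp) : (g⁻¹).x = -g.x := rfl
@[simp] theorem inv_y (g : D.Grp) : (g⁻¹).y = -g.y := rfl
@[simp] theorem inv_z (g : D.Grp) :
    (g⁻¹).z = -g.z + ⟨g.x * g.y, D.mul_mem _ g.x.2 _ g.y.2⟩ := rfl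

instance : Group D.Grp := Group.ofLeftAxioms
  (fun a b c => by
    ext <;> simp [mul_add, add_mul] <;> abel)
  (fun a => by ext <;> simp)
  (fun a => by ext <;> simp)

/-- The inclusion of the group into the ring. -/
def toRing : D.Grp →* A where
  toFun g := 1 + g.x + g.y + g.z
  map_one' := by simp
  map_mul' g h := by
    have h1 := mul_eq_zero_of (D.hX _ g.x.2) (D.hX _ h.x.2) D.e₂₁
    have h2 := mul_eq_zero_of (D.hX _ g.x.2) (D.hZ _ h.z.2) D.e₂₁
    have h3 := mul_eq_zero_of (D.hY _ g.y.2) (D.hX _ h.x.2) D.e₃₁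
    have h4 := mul_eq_zero_of (D.hY _ g.y.2) (D.hY _ h.y.2) D.e₃₂
    have h5 := mul_eq_zero_of (D.hY _ g.y.2) (D.hZ _ h.z.2) D.e₃₁
    have h6 := mul_eq_zero_of (D.hZ _ g.z.2) (D.hX _ h.x.2) D.e₃₁
    have h7 := mul_eq_zero_of (D.hZ _ g.z.2) (D.hY _ h.y.2) D.e₃₂
    have h8 := mul_eq_zero_of (D.hZ _ g.z.2) (D.hZ _ h.z.2) D.e₃₁
    simp only [mul_x, mul_y, mul_z, AddSubgroup.coe_add, mul_add, add_mul, mul_one, one_mul,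
      h1, h2, h3, h4, h5, h6, h7, h8]
    abel

theorem toRing_apply (g : D.Grp) : toRing g = 1 + g.x + g.y + g.z := rfl

/-- The element `1 + z`. -/
def ofZ (z : D.Z) : D.Grp := ⟨0, 0, z⟩

theorem ofZ_add (z z' : D.Z) : ofZ (z + z') = ofZ z * ofZ z' := by
  ext <;> simp [ofZ]

theorem ofZ_zero : ofZ (0 : D.Z) = 1 := rfl

theorem ofZ_mul_comm (z : D.Z) (g : D.Grp) : ofZ z * g = g * ofZ z := by
  ext <;> simp [ofZ, add_comm]

end Grp

end HeisDatum

namespace HeisDatum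

variable {A : Type*} [Ring A]

/-- The nondegeneracy hypotheses on a `HeisDatum`, relative to a ring endomorphism `φ`. -/
structure IsGood (D : HeisDatum A) (φ : A →+* A) (E E' : A) : Prop where
  inj : Function.Injective φ
  map_e₁ : φ D.e₁ = D.e₁
  map_e₂ : φ D.e₂ = D.e₂
  map_e₃ : φ D.e₃ = D.e₃
  mem : E ∈ D.Z
  mul₁ : E * E' = D.e₁
  mul₃ : E' * E = D.e₃
  rank_one : ∀ u v, u * D.e₂ * v = 0 → u * D.e₂ = 0 ∨ D.e₂ * v = 0
  scalar : ∀ b, (∀ z ∈ D.Z, φ z * b = b * φ z) →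
    ∃ s, (∀ t, s * t = t * s) ∧ D.e₁ * b * D.e₁ = s * D.e₁ ∧ D.e₃ * b * D.e₃ = s * D.e₃
  span : D.Z ≤ AddSubgroup.closure {z | ∃ x ∈ D.X, ∃ y ∈ D.Y, x * y = z}

theorem block_left {e a f : A} (he : e * e = e) (h : e * a * f = a) : e * a = a := by
  rw [← h, ← mul_assoc, ← mul_assoc, he]

theorem block_right {e a f : A} (hf : f * f = f) (h : e * a * f = a) : a * f = a := by
  rw [← h, mul_assoc, hf]

theorem block_map {φ : A →+* A} {e a f : A} (he : φ e = e) (hf : φ f = f) (h : e * a * f = a) :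
    e * φ a * f = φ a := by
  conv_rhs => rw [← h, map_mul, map_mul, he, hf]

theorem central_right {s z e b : A} (hs : ∀ t, s * t = t * s) (hz : z * e = z)
    (h : e * b * e = s * e) : z * b * e = s * z := by
  calc z * b * e = z * (e * b * e) := by rw [← mul_assoc, ← mul_assoc, hz]
    _ = s * z := by rw [h, ← mul_assoc, ← hs, mul_assoc, hz]

theorem central_left {s z e b : A} (hz : e * z = z) (h : e * b * e = s * e) :
    e * b * z = s * z := by
  calc e * b * z = e * b * e * z := by rw [mul_assoc _ e, hz]
    _ = s * z := by rw [h, mul_assoc, hz]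

namespace IsGood

variable {D : HeisDatum A} {φ : A →+* A} {E E' : A}

theorem mapX (H : IsGood D φ E E') {x : A} (hx : x ∈ D.X) : D.e₁ * φ x * D.e₂ = φ x :=
  block_map H.map_e₁ H.map_e₂ (D.hX x hx)

theorem mapY (H : IsGood D φ E E') {x : A} (hx : x ∈ D.Y) : D.e₂ * φ x * D.e₃ = φ x :=
  block_map H.map_e₂ H.map_e₃ (D.hY x hx)

theorem mapZ (H : IsGood D φ E E') {x : A} (hx : x ∈ D.Z) : D.e₁ * φ x * D.e₃ = φ x :=
  block_map H.map_e₁ H.map_e₃ (D.hZ x hx)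

theorem map_mul₁ (H : IsGood D φ E E') : φ E * φ E' = D.e₁ := by
  rw [← map_mul, H.mul₁, H.map_e₁]

theorem map_mul₃ (H : IsGood D φ E E') : φ E' * φ E = D.e₃ := by
  rw [← map_mul, H.mul₃, H.map_e₃]

section Commute

variable {b : A} (hb : ∀ z ∈ D.Z, φ z * b = b * φ z)

theorem b₂₁ (H : IsGood D φ E E') (hb : ∀ z ∈ D.Z, φ z * b = b * φ z) : D.e₂ * b * D.e₁ = 0 := by
  rw [← H.map_mul₁, mul_assoc, ← mul_assoc b, ← hb E H.mem,
    ← block_left D.e₁₁ (H.mapZ H.mem)]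
  simp only [← mul_assoc, D.e₂₁, zero_mul]

theorem b₃₁ (H : IsGood D φ E E') (hb : ∀ z ∈ D.Z, φ z * b = b * φ z) : D.e₃ * b * D.e₁ = 0 := by
  rw [← H.map_mul₁, mul_assoc, ← mul_assoc b, ← hb E H.mem,
    ← block_left D.e₁₁ (H.mapZ H.mem)]
  simp only [← mul_assoc, D.e₃₁, zero_mul]

theorem b₃₂ (H : IsGood D φ E E') (hb : ∀ z ∈ D.Z, φ z * b = b * φ z) : D.e₃ * b * D.e₂ = 0 := by
  rw [← H.map_mul₃, mul_assoc (φ E'), hb E H.mem, ← block_right D.e₃₃ (H.mapZ H.mem)]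
  simp only [mul_assoc, D.e₃₂, mul_zero]

/-- The block equations expressing `b' * (1 + x + y + z) = (1 + x + y + z) * b`. -/
theorem block_eqs (H : IsGood D φ E E') {b b' : A}
    (hb : ∀ z ∈ D.Z, φ z * b = b * φ z) (hb' : ∀ z ∈ D.Z, φ z * b' = b' * φ z) {g : D.Grp}
    (h : b' * φ (Grp.toRing g) = φ (Grp.toRing g) * b) :
    D.e₁ * b' * D.e₁ = D.e₁ * b * D.e₁ ∧
    D.e₁ * b' * D.e₂ + D.e₁ * b' * φ g.x = D.e₁ * b * D.e₂ + φ g.x * b * D.e₂ ∧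
    D.e₂ * b' * D.e₃ + D.e₂ * b' * φ g.y = D.e₂ * b * D.e₃ + φ g.y * b * D.e₃ ∧
    D.e₁ * b' * D.e₃ + D.e₁ * b' * φ g.y + D.e₁ * b' * φ g.z =
      D.e₁ * b * D.e₃ + φ g.x * b * D.e₃ + φ g.z * b * D.e₃ := by
  have x1 := block_left D.e₁₁ (H.mapX g.x.2)
  have x2 := block_right D.e₂₂ (H.mapX g.x.2)
  have y1 := block_left D.e₂₂ (H.mapY g.y.2)
  have y2 := block_right D.e₃₃ (H.mapY g.y.2)
  have z1 := block_left D.e₁₁ (H.mapZ g.z.2)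
  have z2 := block_right D.e₃₃ (H.mapZ g.z.2)
  simp only [Grp.toRing_apply, map_add, map_one] at h
  generalize φ g.x = x at *
  generalize φ g.y = y at *
  generalize φ g.z = z at *
  have q1 := H.b₂₁ hb
  have q2 := H.b₃₁ hb
  have q3 := H.b₃₂ hb
  have q4 := H.b₂₁ hb'
  have q5 := H.b₃₁ hb'
  have q6 := H.b₃₂ hb'
  have xe1 : x * D.e₁ = 0 := by rw [← x2, mul_assoc, D.e₂₁, mul_zero]
  have xe3 : x * D.e₃ = 0 := by rw [← x2, mul_assoc, D.e₂₃, mul_zero]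
  have ye1 : y * D.e₁ = 0 := by rw [← y2, mul_assoc, D.e₃₁, mul_zero]
  have ye2 : y * D.e₂ = 0 := by rw [← y2, mul_assoc, D.e₃₂, mul_zero]
  have ze1 : z * D.e₁ = 0 := by rw [← z2, mul_assoc, D.e₃₁, mul_zero]
  have ze2 : z * D.e₂ = 0 := by rw [← z2, mul_assoc, D.e₃₂, mul_zero]
  have ey1 : D.e₁ * y = 0 := by rw [← y1, ← mul_assoc, D.e₁₂, zero_mul]
  have ex2 : D.e₂ * x = 0 := by rw [← x1, ← mul_assoc, D.e₂₁, zero_mul]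
  have ez2 : D.e₂ * z = 0 := by rw [← z1, ← mul_assoc, D.e₂₁, zero_mul]
  have xb1 : x * b * D.e₁ = 0 := by rw [← x2, mul_assoc x, mul_assoc x, q1, mul_zero]
  have zb1 : z * b * D.e₁ = 0 := by rw [← z2, mul_assoc z, mul_assoc z, q2, mul_zero]
  have zb2 : z * b * D.e₂ = 0 := by rw [← z2, mul_assoc z, mul_assoc z, q3, mul_zero]
  have zb2' : D.e₂ * b' * z = 0 := by rw [← z1, ← mul_assoc, q4, zero_mul]
  refine ⟨?_, ?_, ?_, ?_⟩
  · have := congrArg (fun t => D.e₁ * t * D.e₁) h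
    simp only [mul_add, add_mul, mul_one, one_mul, ← mul_assoc, x1, ey1, z1, zero_mul, xb1,
      zb1, add_zero] at this
    simpa only [mul_assoc, xe1, ye1, ze1, mul_zero, add_zero] using this
  · have := congrArg (fun t => D.e₁ * t * D.e₂) h
    simp only [mul_add, add_mul, mul_one, one_mul, ← mul_assoc, x1, ey1, z1, zero_mul, zb2,
      add_zero] at this
    simpa only [mul_assoc, x2, ye2, ze2, mul_zero, add_zero] using this
  · have := congrArg (fun t => D.e₂ * t * D.e₃) h
    simp only [mul_add, add_mul, mul_one, one_mul, ← mul_assoc, ex2, y1, ez2, zero_mul,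
      zb2', add_zero] at this
    simpa only [mul_assoc, xe3, y2, z2, mul_zero, add_zero, zb2', ← mul_assoc D.e₂ b' z] using this
  · have := congrArg (fun t => D.e₁ * t * D.e₃) h
    simp only [mul_add, add_mul, mul_one, one_mul, ← mul_assoc, x1, ey1, z1, zero_mul,
      add_zero] at this
    simpa only [mul_assoc, xe3, y2, z2, mul_zero, add_zero] using this

end Commute

/-- The effect of conjugation on the blocks. -/
theorem block_conj (H : IsGood D φ E E') {b b' s s' : A}
    (hb : ∀ z ∈ D.Z, φ z * b = b * φ z) (hb' : ∀ z ∈ D.Z, φ z * b' = b' * φ z)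
    (hs : ∀ t, s * t = t * s) (hs' : ∀ t, s' * t = t * s')
    (h₁ : D.e₁ * b * D.e₁ = s * D.e₁) (h₁' : D.e₁ * b' * D.e₁ = s' * D.e₁)
    (h₂ : D.e₂ * b * D.e₂ = s * D.e₂) (h₂' : D.e₂ * b' * D.e₂ = s' * D.e₂)
    (h₃ : D.e₃ * b * D.e₃ = s * D.e₃) {g : D.Grp}
    (h : b' * φ (Grp.toRing g) = φ (Grp.toRing g) * b) :
    D.e₁ * b' * D.e₂ = D.e₁ * b * D.e₂ ∧ D.e₂ * b' * D.e₃ = D.e₂ * b * D.e₃ ∧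
    D.e₁ * b' * D.e₃ = D.e₁ * b * D.e₃ + φ g.x * b * D.e₃ - D.e₁ * b * φ g.y := by
  obtain ⟨k1, k2, k3, k4⟩ := H.block_eqs hb hb' h
  have x1 := block_left D.e₁₁ (H.mapX g.x.2)
  have x2 := block_right D.e₂₂ (H.mapX g.x.2)
  have y1 := block_left D.e₂₂ (H.mapY g.y.2)
  have y2 := block_right D.e₃₃ (H.mapY g.y.2)
  have z1 := block_left D.e₁₁ (H.mapZ g.z.2)
  have z2 := block_right D.e₃₃ (H.mapZ g.z.2)
  have E2 := block_left D.e₁₁ (H.mapZ H.mem)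
  generalize φ g.x = x at *
  generalize φ g.y = y at *
  generalize φ g.z = z at *
  have c1 : s' * D.e₁ = s * D.e₁ := by rw [← h₁', ← h₁, k1]
  have c3 : s' * D.e₃ = s * D.e₃ := by
    calc s' * D.e₃ = φ E' * (s' * D.e₁ * φ E) := by
          rw [← H.map_mul₃, ← mul_assoc, hs', mul_assoc s', E2, mul_assoc]
      _ = s * D.e₃ := by
          rw [c1, ← H.map_mul₃, ← mul_assoc s, hs (φ E'), mul_assoc s, E2, mul_assoc]
  have m1 : D.e₁ * b' * x = s * x := by rw [central_left x1 h₁', ← x1, ← mul_assoc, c1, mul_assoc]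
  have m2 : x * b * D.e₂ = s * x := central_right hs x2 h₂
  have m3 : D.e₂ * b' * y = s * y := by
    rw [central_left y1 h₂', hs' y, hs y]
    nth_rw 1 [← y2]
    rw [mul_assoc, ← hs', c3, hs, ← mul_assoc, y2]
  have m4 : y * b * D.e₃ = s * y := central_right hs y2 h₃
  have m5 : D.e₁ * b' * z = s * z := by rw [central_left z1 h₁', ← z1, ← mul_assoc, c1, mul_assoc]
  have m6 : z * b * D.e₃ = s * z := central_right hs z2 h₃
  rw [m1, m2, add_left_inj] at k2
  rw [m3, m4, add_left_inj] at k3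
  rw [m5, m6, add_left_inj] at k4
  refine ⟨k2, k3, ?_⟩
  rw [← k4, ← y1, ← mul_assoc, ← mul_assoc, k2, add_sub_cancel_right]

theorem block₂₂ (H : IsGood D φ E E') {b s : A}
    (hb : ∀ z ∈ D.Z, φ z * b = b * φ z) (hs : ∀ t, s * t = t * s)
    (h₁ : D.e₁ * b * D.e₁ = s * D.e₁) (h₃ : D.e₃ * b * D.e₃ = s * D.e₃) {g : D.Grp}
    (h : b * φ (Grp.toRing g) = φ (Grp.toRing g) * b) (hg : g.x ≠ 0 ∨ g.y ≠ 0) :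
    D.e₂ * b * D.e₂ = s * D.e₂ := by
  obtain ⟨-, k2, k3, -⟩ := H.block_eqs hb hb h
  have x1 := block_left D.e₁₁ (H.mapX g.x.2)
  have x2 := block_right D.e₂₂ (H.mapX g.x.2)
  have y1 := block_left D.e₂₂ (H.mapY g.y.2)
  have y2 := block_right D.e₃₃ (H.mapY g.y.2)
  rw [add_right_inj] at k2 k3
  rcases hg with hg | hg
  · have hx : φ g.x ≠ 0 := fun h0 => hg (Subtype.ext (H.inj (h0.trans (map_zero φ).symm)))
    rw [central_left x1 h₁, hs] at k2
    have : φ g.x * D.e₂ * (b * D.e₂ - s * D.e₂) = 0 := by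
      rw [x2, mul_sub, ← mul_assoc, ← k2, hs, ← mul_assoc, x2, sub_self]
    rcases H.rank_one _ _ this with h | h
    · exact (hx (x2 ▸ h)).elim
    · rw [mul_sub, sub_eq_zero, ← mul_assoc, ← mul_assoc, ← hs, mul_assoc s, D.e₂₂] at h
      exact h
  · have hy : φ g.y ≠ 0 := fun h0 => hg (Subtype.ext (H.inj (h0.trans (map_zero φ).symm)))
    rw [central_right hs y2 h₃] at k3
    have : (D.e₂ * b - s * D.e₂) * D.e₂ * φ g.y = 0 := by
      rw [mul_assoc, y1, sub_mul, k3, mul_assoc, y1, sub_self]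
    rcases H.rank_one _ _ this with h | h
    · rwa [sub_mul, sub_eq_zero, mul_assoc s, D.e₂₂] at h
    · exact (hy (y1 ▸ h)).elim

end IsGood
end HeisDatum

theorem AddSubgroup.exists_zmod_hom_of_module {p : ℕ} [Fact p.Prime] {V : Type*}
    [AddCommGroup V] [Module (ZMod p) V] (U : AddSubgroup V) (hU : U ≠ ⊤) :
    ∃ ψ : V →+ ZMod p, (∃ v, ψ v = 1) ∧ ∀ u ∈ U, ψ u = 0 := by
  obtain ⟨v, hvU⟩ : ∃ v, v ∉ U := by
    by_contra! h
    exact hU ((AddSubgroup.eq_top_iff' U).2 h)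
  obtain ⟨f, hv, hf'⟩ := Submodule.exists_le_ker_of_notMem
    (p := AddSubgroup.toZModSubmodule p U) (v := v) hvU
  refine ⟨f.toAddMonoidHom, ⟨(f v)⁻¹ • v, ?_⟩, fun u hu => hf' hu⟩
  change f ((f v)⁻¹ • v) = 1
  rw [map_smul, smul_eq_mul, inv_mul_cancel₀ hv]

theorem AddSubgroup.exists_zmod_hom {p : ℕ} [Fact p.Prime] {V : Type*} [AddCommGroup V]
    (hV : ∀ v : V, p • v = 0) (U : AddSubgroup V) (hU : U ≠ ⊤) :
    ∃ ψ : V →+ ZMod p, (∃ v, ψ v = 1) ∧ ∀ u ∈ U, ψ u = 0 :=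
  @exists_zmod_hom_of_module p _ V _ (AddCommGroup.zmodModule hV) U hU

theorem AddMonoidHom.exists_ne_zero_of_card_lt {p : ℕ} [Fact p.Prime] {V : Type*} [AddCommGroup V]
    [Finite V] (ψ : V →+ ZMod p) (h : p < Nat.card V) : ∃ v, v ≠ 0 ∧ ψ v = 0 := by
  by_contra! h'
  have hψ : Function.Injective ψ := (injective_iff_map_eq_zero ψ).2 fun v hv => by
    by_contra hv'
    exact h' v hv' hv
  have := Nat.card_le_card_of_injective ψ hψ
  rw [Nat.card_zmod] at this
  omega

theorem ZMod.sum_eq_sum_range {p : ℕ} [NeZero p] {A : Type*} [AddCommMonoid A] (f : ZMod p → A) :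
    ∑ i, f i = ∑ m ∈ Finset.range p, f m :=
  Finset.sum_nbij' ZMod.val (fun m => (m : ZMod p)) (by simp [ZMod.val_lt]) (by simp) (by simp)
    (fun m hm => ZMod.val_cast_of_lt (Finset.mem_range.1 hm)) (by simp)

theorem Finset.sum_range_nsmul_eq_zero {p : ℕ} [Fact p.Prime] (hp : p ≠ 2) {A : Type*}
    [AddCommGroup A] (hA : ∀ a : A, p • a = 0) (c δ : A) :
    ∑ m ∈ Finset.range p, (c + m • δ) = 0 := by
  have h2 : p ∣ ∑ m ∈ Finset.range p, m := by
    have h3 : p ∣ (∑ m ∈ Finset.range p, m) * 2 := by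
      rw [Finset.sum_range_id_mul_two]; exact dvd_mul_right _ _
    exact (Nat.Coprime.dvd_of_dvd_mul_right
      ((Nat.coprime_primes Fact.out Nat.prime_two).2 hp) h3)
  obtain ⟨t, ht⟩ := h2
  rw [Finset.sum_add_distrib, ← Finset.sum_smul, ht]
  simp [hA, mul_comm p t, mul_smul]

namespace HeisDatum

variable {A : Type*} [Ring A] {D : HeisDatum A} {S M : Type*} [MulAction D.Grp S] [CommGroup M]

/-- If the stabilizer of a point surjects onto `X × Y`, then the cocycle is trivial on `Z`. -/
theorem cocycle_ofZ (hspan : D.Z ≤ AddSubgroup.closure {z | ∃ x ∈ D.X, ∃ y ∈ D.Y, x * y = z})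
    (θ : D.Grp → S → M) (hθ : ∀ (g h : D.Grp) (s : S), θ (g * h) s = θ g (h • s) * θ h s) (x₀ : S)
    (hst : ∀ (x : D.X) (y : D.Y), ∃ g : D.Grp, g • x₀ = x₀ ∧ g.x = x ∧ g.y = y) (z : D.Z) :
    θ (Grp.ofZ z) x₀ = 1 := by
  have h1 : θ 1 x₀ = 1 := by simpa using hθ 1 1 x₀
  suffices h : ∃ h : (z : A) ∈ D.Z, Grp.ofZ (D := D) ⟨z, h⟩ • x₀ = x₀ ∧ θ (Grp.ofZ (D := D) ⟨z, h⟩) x₀ = 1 from h.2.2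
  have hz := hspan z.2
  generalize (z : A) = c at hz ⊢
  induction hz using AddSubgroup.closure_induction with
  | mem a ha =>
    obtain ⟨x, hx, y, hy, rfl⟩ := ha
    obtain ⟨g, hg, gx, gy⟩ := hst ⟨x, hx⟩ 0
    obtain ⟨h, hh, hhx, hhy⟩ := hst 0 ⟨y, hy⟩
    have h2 : g * h = Grp.ofZ ⟨x * y, D.mul_mem x hx y hy⟩ * (h * g) := by
      ext <;> simp [Grp.ofZ, gx, gy, hhx, hhy]
      abel
    refine ⟨D.mul_mem x hx y hy, ?_, ?_⟩
    · have := congrArg (· • x₀) h2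
      simpa [mul_smul, hg, hh] using this.symm
    · have := congrArg (θ · x₀) h2
      simpa [hθ, mul_smul, hg, hh, mul_comm] using this.symm
  | zero => exact ⟨D.Z.zero_mem, one_smul _ _, h1⟩
  | add a b _ _ ha hb =>
    obtain ⟨ha, ha1, ha2⟩ := ha
    obtain ⟨hb, hb1, hb2⟩ := hb
    have : Grp.ofZ ⟨a + b, D.Z.add_mem ha hb⟩ = Grp.ofZ ⟨a, ha⟩ * Grp.ofZ ⟨b, hb⟩ :=
      Grp.ofZ_add ⟨a, ha⟩ ⟨b, hb⟩
    exact ⟨D.Z.add_mem ha hb, by rw [this, mul_smul, hb1, ha1],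
      by rw [this, hθ, hb1, ha2, hb2, one_mul]⟩
  | neg a _ ha =>
    obtain ⟨ha, ha1, ha2⟩ := ha
    have : Grp.ofZ ⟨-a, D.Z.neg_mem ha⟩ * Grp.ofZ ⟨a, ha⟩ = 1 := by
      rw [← Grp.ofZ_add, ← Grp.ofZ_zero]
      congr 1
      ext
      simp
    have h3 : Grp.ofZ ⟨-a, D.Z.neg_mem ha⟩ • x₀ = x₀ := by
      nth_rw 1 [← ha1]
      rw [← mul_smul, this, one_smul]
    refine ⟨D.Z.neg_mem ha, h3, ?_⟩
    rw [← this, hθ, ha1, ha2, mul_one] at h1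
    exact h1

open Classical in
theorem IsGood.orbit_sum {p : ℕ} [Fact p.Prime] (hpA : ∀ a : A, p • a = 0) {φ : A →+* A}
    {E E' : A} (H : IsGood D φ E E') [Finite D.X] [Finite D.Y] [Fintype S] (a : S → A)
    (ha : ∀ (g : D.Grp) (x : S), φ (Grp.toRing g) * a x = a (g • x) * φ (Grp.toRing g))
    (θ : D.Grp → S → M) (hθ : ∀ (g h : D.Grp) (s : S), θ (g * h) s = θ g (h • s) * θ h s) (x₀ : S) (z : D.Z)
    (hz : θ (Grp.ofZ z) x₀ ≠ 1)
    (hXY : p < Nat.card (D.X × D.Y)) (hp : p ≠ 2 ∨ p < Nat.card D.X ∧ p < Nat.card D.Y) :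
    D.e₁ * (∑ x with x ∈ MulAction.orbit D.Grp x₀, a x) * D.e₃ = 0 := by
  let U : AddSubgroup (D.X × D.Y) :=
    { carrier := {v | ∃ g : D.Grp, g • x₀ = x₀ ∧ g.x = v.1 ∧ g.y = v.2}
      zero_mem' := ⟨1, by simp⟩
      add_mem' := by
        rintro _ _ ⟨g, hg, hx, hy⟩ ⟨g', hg', hx', hy'⟩
        exact ⟨g * g', by rw [mul_smul, hg', hg], by simp [hx, hx'], by simp [hy, hy']⟩
      neg_mem' := by
        rintro _ ⟨g, hg, hx, hy⟩
        exact ⟨g⁻¹, by rw [inv_smul_eq_iff, hg], by simp [hx], by simp [hy]⟩ }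
  have hU : U ≠ ⊤ := fun h => hz (cocycle_ofZ H.span θ hθ x₀ (fun x y => by
    have : (x, y) ∈ U := h ▸ AddSubgroup.mem_top _
    exact this) z)
  have hpv : ∀ v : D.X × D.Y, p • v = 0 := fun v => by
    ext <;> simpa using hpA _
  obtain ⟨ψ, ⟨v, hv⟩, hψ⟩ := AddSubgroup.exists_zmod_hom hpv U hU
  let Ψ : D.Grp → ZMod p := fun g => ψ (g.x, g.y)
  have hΨ : ∀ g h, Ψ (g * h) = Ψ g + Ψ h := fun g h => map_add ψ (g.x, g.y) (h.x, h.y)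
  have hΨst : ∀ g, g • x₀ = x₀ → Ψ g = 0 := fun g hg => hψ _ ⟨g, hg, rfl, rfl⟩
  obtain ⟨f, hf⟩ : ∃ f : S → ZMod p, ∀ g : D.Grp, f (g • x₀) = Ψ g := by
    refine ⟨fun x => if h : ∃ g : D.Grp, g • x₀ = x then Ψ h.choose else 0, fun g => ?_⟩
    have hex : ∃ g' : D.Grp, g' • x₀ = g • x₀ := ⟨g, rfl⟩
    simp only [dif_pos hex]
    have h1 : hex.choose = g * (g⁻¹ * hex.choose) := by group
    rw [h1, hΨ, hΨst (g⁻¹ * hex.choose), add_zero]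
    rw [mul_smul, inv_smul_eq_iff]
    exact hex.choose_spec
  let b : ZMod p → A := fun i => ∑ x with x ∈ MulAction.orbit D.Grp x₀ ∧ f x = i, a x
  have hsum : ∑ x with x ∈ MulAction.orbit D.Grp x₀, a x = ∑ i, b i := by
    rw [← Finset.sum_fiberwise _ f]
    simp only [Finset.filter_filter, b]
  have hbconj : ∀ g i, b (i + Ψ g) * φ (Grp.toRing g) = φ (Grp.toRing g) * b i := by
    intro g i
    simp only [b, Finset.sum_mul, Finset.mul_sum]
    symm
    refine Finset.sum_bij (fun x _ => g • x) ?_ ?_ ?_ ?_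
    · simp only [Finset.mem_filter, Finset.mem_univ, true_and]
      rintro _ ⟨⟨h, rfl⟩, rfl⟩
      refine ⟨⟨g * h, mul_smul _ _ _⟩, ?_⟩
      simp only [← mul_smul, hf, hΨ, add_comm]
    · exact fun x _ y _ h => smul_left_cancel g h
    · simp only [Finset.mem_filter, Finset.mem_univ, true_and]
      rintro _ ⟨⟨h, rfl⟩, hx⟩
      simp only [hf] at hx
      refine ⟨(g⁻¹ * h) • x₀, ⟨⟨_, rfl⟩, ?_⟩, ?_⟩
      · have := hΨ g (g⁻¹ * h)
        rw [mul_inv_cancel_left, hx] at this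
        rw [hf]
        rwa [add_comm, add_right_inj, eq_comm] at this
      · simp only [mul_smul, smul_inv_smul]
    · exact fun x _ => ha g x
  have hbM : ∀ g i, Ψ g = 0 → b i * φ (Grp.toRing g) = φ (Grp.toRing g) * b i := fun g i hg => by
    simpa [hg] using hbconj g i
  have hbZ : ∀ i, ∀ z ∈ D.Z, φ z * b i = b i * φ z := by
    intro i z hz
    have := hbM (Grp.ofZ ⟨z, hz⟩) i (by simp only [Ψ, Grp.ofZ]; exact map_zero ψ)
    simpa [Grp.toRing_apply, Grp.ofZ, mul_add, add_mul, eq_comm] using this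
  choose s hs h₁ h₃ using fun i => H.scalar (b i) (hbZ i)
  have h₂ : ∀ i, D.e₂ * b i * D.e₂ = s i * D.e₂ := by
    intro i
    obtain ⟨w, hw, hw'⟩ := ψ.exists_ne_zero_of_card_lt hXY
    refine H.block₂₂ (g := ⟨w.1, w.2, 0⟩) (hbZ i) (hs i) (h₁ i) (h₃ i) (hbM _ i hw') ?_
    by_contra! h
    exact hw (Prod.ext h.1 h.2)
  obtain ⟨q, hq⟩ : ∃ q : D.Grp, Ψ q = 1 := ⟨⟨v.1, v.2, 0⟩, hv⟩
  have key : ∀ i, D.e₁ * b (i + 1) * D.e₂ = D.e₁ * b i * D.e₂ ∧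
      D.e₂ * b (i + 1) * D.e₃ = D.e₂ * b i * D.e₃ ∧
      D.e₁ * b (i + 1) * D.e₃ = D.e₁ * b i * D.e₃ + φ q.x * (D.e₂ * b i * D.e₃) -
        D.e₁ * b i * D.e₂ * φ q.y := by
    intro i
    obtain ⟨k1, k2, k3⟩ := H.block_conj (hbZ i) (hbZ (i + 1)) (hs i) (hs (i + 1)) (h₁ i)
      (h₁ (i + 1)) (h₂ i) (h₂ (i + 1)) (h₃ i) (by simpa only [hq] using hbconj q i)
    refine ⟨k1, k2, k3.trans ?_⟩
    rw [mul_assoc _ D.e₂ (φ q.y), block_left D.e₂₂ (H.mapY q.y.2), ← mul_assoc (φ q.x),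
      ← mul_assoc (φ q.x), block_right D.e₂₂ (H.mapX q.x.2)]
  set δ := φ q.x * (D.e₂ * b 0 * D.e₃) - D.e₁ * b 0 * D.e₂ * φ q.y with hδ
  have key2 : ∀ m : ℕ, D.e₁ * b m * D.e₂ = D.e₁ * b 0 * D.e₂ ∧
      D.e₂ * b m * D.e₃ = D.e₂ * b 0 * D.e₃ ∧
      D.e₁ * b m * D.e₃ = D.e₁ * b 0 * D.e₃ + m • δ := by
    intro m
    induction m with
    | zero => simp
    | succ m ih =>
      obtain ⟨i1, i2, i3⟩ := ih
      obtain ⟨k1, k2, k3⟩ := key m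
      push_cast
      refine ⟨k1.trans i1, k2.trans i2, ?_⟩
      rw [k3, i1, i2, i3, succ_nsmul, hδ]
      abel
  have hfinal : D.e₁ * (∑ x with x ∈ MulAction.orbit D.Grp x₀, a x) * D.e₃ =
      ∑ m ∈ Finset.range p, (D.e₁ * b 0 * D.e₃ + m • δ) := by
    rw [hsum, Finset.mul_sum, Finset.sum_mul, ZMod.sum_eq_sum_range]
    exact Finset.sum_congr rfl fun m _ => (key2 m).2.2
  rw [hfinal]
  rcases hp with hp | ⟨hX, hY⟩
  · exact Finset.sum_range_nsmul_eq_zero hp hpA _ _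
  · suffices hδ0 : δ = 0 by simp [hδ0, hpA]
    have hx0 : D.e₂ * b 0 * D.e₃ = 0 := by
      obtain ⟨x, hx, hx'⟩ := (ψ.comp (AddMonoidHom.inl D.X D.Y)).exists_ne_zero_of_card_lt hX
      obtain ⟨-, -, k3⟩ := H.block_conj (g := ⟨x, 0, 0⟩) (hbZ 0) (hbZ 0) (hs 0) (hs 0) (h₁ 0)
        (h₁ 0) (h₂ 0) (h₂ 0) (h₃ 0) (hbM _ 0 hx')
      have h4 : φ (x : A) * D.e₂ * (b 0 * D.e₃) = 0 := by
        rw [block_right D.e₂₂ (H.mapX x.2), ← mul_assoc]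
        simpa using k3
      rcases H.rank_one _ _ h4 with h | h
      · rw [block_right D.e₂₂ (H.mapX x.2)] at h
        exact (hx (Subtype.ext (H.inj (h.trans (map_zero φ).symm)))).elim
      · rwa [mul_assoc]
    have hy0 : D.e₁ * b 0 * D.e₂ = 0 := by
      obtain ⟨y, hy, hy'⟩ := (ψ.comp (AddMonoidHom.inr D.X D.Y)).exists_ne_zero_of_card_lt hY
      obtain ⟨-, -, k3⟩ := H.block_conj (g := ⟨0, y, 0⟩) (hbZ 0) (hbZ 0) (hs 0) (hs 0) (h₁ 0)
        (h₁ 0) (h₂ 0) (h₂ 0) (h₃ 0) (hbM _ 0 hy')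
      have h4 : D.e₁ * b 0 * D.e₂ * φ (y : A) = 0 := by
        rw [mul_assoc, block_left D.e₂₂ (H.mapY y.2)]
        simpa [eq_sub_iff_add_eq] using k3
      rcases H.rank_one _ _ h4 with h | h
      · exact h
      · rw [block_left D.e₂₂ (H.mapY y.2)] at h
        exact (hy (Subtype.ext (H.inj (h.trans (map_zero φ).symm)))).elim
    rw [hδ, hx0, hy0, mul_zero, zero_mul, sub_zero]

open Classical in
/-- The trace lemma. -/
theorem IsGood.sum_eq_zero {p : ℕ} [Fact p.Prime] (hpA : ∀ a : A, p • a = 0) {φ : A →+* A}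
    {E E' : A} (H : IsGood D φ E E') [Finite D.X] [Finite D.Y] [Fintype S] (a : S → A)
    (ha : ∀ (g : D.Grp) (x : S), φ (Grp.toRing g) * a x = a (g • x) * φ (Grp.toRing g))
    (θ : D.Grp → S → M) (hθ : ∀ (g h : D.Grp) (s : S), θ (g * h) s = θ g (h • s) * θ h s)
    (hXY : p < Nat.card (D.X × D.Y)) (hp : p ≠ 2 ∨ p < Nat.card D.X ∧ p < Nat.card D.Y)
    (ε : S → ℕ) (hε : ∀ (g : D.Grp) x, ε (g • x) = ε x)
    (hne : ∀ x, ε x ≠ 0 → ∃ z : D.Z, θ (Grp.ofZ z) x ≠ 1) :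
    D.e₁ * (∑ x, ε x • a x) * D.e₃ = 0 := by
  rw [← Finset.sum_fiberwise Finset.univ (fun x : S => (⟦x⟧ : MulAction.orbitRel.Quotient D.Grp S)),
    Finset.mul_sum, Finset.sum_mul]
  refine Finset.sum_eq_zero fun ω _ => ?_
  obtain ⟨x₀, rfl⟩ := Quotient.exists_rep ω
  have h1 : ∀ x : S, (⟦x⟧ : MulAction.orbitRel.Quotient D.Grp S) = ⟦x₀⟧ ↔
      x ∈ MulAction.orbit D.Grp x₀ := fun x => Quotient.eq
  simp only [h1]
  have h2 : ∑ x with x ∈ MulAction.orbit D.Grp x₀, ε x • a x =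
      ε x₀ • ∑ x with x ∈ MulAction.orbit D.Grp x₀, a x := by
    rw [Finset.smul_sum]
    refine Finset.sum_congr rfl fun x hx => ?_
    obtain ⟨g, rfl⟩ := (Finset.mem_filter.1 hx).2
    simp only [hε]
  rw [h2]
  by_cases h3 : ε x₀ = 0
  · simp [h3]
  · obtain ⟨z, hz⟩ := hne x₀ h3
    rw [mul_smul_comm, smul_mul_assoc, H.orbit_sum hpA a ha θ hθ x₀ z hz hXY hp, smul_zero]

end HeisDatum

/-- A cocycle whose restriction to stabilizers extends to an invariant family of characters is
cohomologous to that family. -/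
theorem MulAction.exists_split_cocycle {C S M : Type*} [Group C] [CommGroup M] [MulAction C S]
    (θ : C → S → M) (hθ : ∀ (g h : C) (s : S), θ (g * h) s = θ g (h • s) * θ h s) (e : S → C →* M)
    (he : ∀ (c : C) (s : S), e (c • s) = e s) (hst : ∀ (c : C) (s : S), c • s = s → θ c s = e s c) :
    ∃ m : S → M, ∀ c s, θ c s = e s c * (m (c • s) / m s) := by
  have hout : ∀ s : S, ∃ c : C, c • (Quotient.mk (MulAction.orbitRel C S) s).out = s := fun s => by
    obtain ⟨c, hc⟩ := (MulAction.orbitRel C S).symm (@Quotient.exact _ (MulAction.orbitRel C S) _ _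
      (Quotient.out_eq (Quotient.mk (MulAction.orbitRel C S) s)))
    exact ⟨c, hc⟩
  choose γ hγ using hout
  refine ⟨fun s => θ (γ s) (Quotient.mk (MulAction.orbitRel C S) s).out / e s (γ s), fun c s => ?_⟩
  have h1 : Quotient.mk (MulAction.orbitRel C S) (c • s) = Quotient.mk (MulAction.orbitRel C S) s :=
    Quotient.sound ⟨c, rfl⟩
  beta_reduce
  have h2 := hγ (c • s)
  have h3 := hγ s
  rw [h1] at h2 ⊢
  generalize (Quotient.mk (MulAction.orbitRel C S) s).out = r at h2 h3 ⊢
  have hes : e s = e r := by rw [← h3, he]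
  have h4 : ((γ (c • s))⁻¹ * (c * γ s)) • r = r := by
    rw [mul_smul, mul_smul, h3, inv_smul_eq_iff, h2]
  have h5 := hst _ _ h4
  have h6 : θ (c * γ s) r = θ (γ (c • s)) r * e r ((γ (c • s))⁻¹ * (c * γ s)) := by
    rw [← h5]
    nth_rewrite 2 [← h4]
    rw [← hθ, mul_inv_cancel_left]
  rw [hθ, h3] at h6
  rw [he, hes, eq_comm]
  rw [map_mul, map_mul, map_inv] at h6
  rw [eq_div_of_mul_eq' h6]
  simp only [div_eq_mul_inv, _root_.mul_inv_rev, inv_inv, mul_assoc, mul_comm, mul_left_comm]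

theorem Submodule.exists_extend_apply_eq_zero {K V V' : Type*} [Field K] [AddCommGroup V] [Module K V]
    [AddCommGroup V'] [Module K V'] (H : Submodule K V) (f : H →ₗ[K] V') (z : V) :
    ∃ g : V →ₗ[K] V', (∀ h : H, g h = f h) ∧ (z ∉ H → g z = 0) := by
  obtain ⟨g, hg⟩ := LinearMap.exists_extend f
  have hg' : ∀ h : H, g h = f h := fun h => LinearMap.congr_fun hg h
  by_cases hz : z ∈ H
  · exact ⟨g, hg', fun h => (h hz).elim⟩
  obtain ⟨l, hl, hl'⟩ := Submodule.exists_le_ker_of_notMem hz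
  refine ⟨g - ((l z)⁻¹ • l).smulRight (g z), fun h => ?_, fun _ => ?_⟩
  · have : l h = 0 := hl' h.2
    simp [this, hg']
  · simp [inv_mul_cancel₀ hl]

theorem AddSubgroup.exists_extend_zmod {p : ℕ} [Fact p.Prime] {V V' : Type*} [AddCommGroup V]
    [AddCommGroup V'] [Module (ZMod p) V] [Module (ZMod p) V'] (H : AddSubgroup V) (f : H →+ V')
    (z : V) : ∃ g : V →+ V', (∀ h : H, g h = f h) ∧ (z ∉ H → g z = 0) := by
  obtain ⟨g, hg, hz⟩ := Submodule.exists_extend_apply_eq_zero (K := ZMod p)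
    (AddSubgroup.toZModSubmodule p H) (AddMonoidHom.toZModLinearMap p f) z
  exact ⟨g.toAddMonoidHom, hg, hz⟩

theorem Subgroup.exists_extend {p : ℕ} [Fact p.Prime] {C M : Type*} [CommGroup C] [CommGroup M]
    (hC : ∀ c : C, c ^ p = 1) (H : Subgroup C) (f : H →* M) (z : C) :
    ∃ e : C →* M, (∀ h : H, e h = f h) ∧ (z ∉ H → e z = 1) := by
  let f' : H →* (powMonoidHom p : M →* M).ker := f.codRestrict _ fun h => by
    rw [MonoidHom.mem_ker, powMonoidHom_apply, ← map_pow]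
    rw [show h ^ p = 1 from Subtype.ext (hC h), map_one]
  let _ : Module (ZMod p) (Additive C) := AddCommGroup.zmodModule hC
  let _ : Module (ZMod p) (Additive (powMonoidHom p : M →* M).ker) :=
    AddCommGroup.zmodModule fun x => Subtype.ext (x.toMul.2)
  obtain ⟨g, hg, hz⟩ := AddSubgroup.exists_extend_zmod (p := p) (Subgroup.toAddSubgroup H)
    (V' := Additive (powMonoidHom p : M →* M).ker)
    (MonoidHom.toAdditive f' : Additive H →+ Additive (powMonoidHom p : M →* M).ker) (.ofMul z)
  refine ⟨(Subgroup.subtype _).comp (MonoidHom.toAdditive.symm g), fun h => ?_, fun h => ?_⟩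
  · exact congrArg Subtype.val (hg h)
  · exact congrArg Subtype.val (hz h)

open Classical in
theorem Subgroup.exists_extend_fun {p : ℕ} [Fact p.Prime] {C M : Type*} [CommGroup C] [CommGroup M]
    (hC : ∀ c : C, c ^ p = 1) (z : C) :
    ∃ E : Subgroup C → (C → M) → C →* M, ∀ H f, (∀ a ∈ H, ∀ b ∈ H, f (a * b) = f a * f b) →
      (∀ h ∈ H, E H f h = f h) ∧ (z ∉ H → E H f z = 1) ∧ ((∀ h ∈ H, f h = 1) → E H f = 1) := by
  have : ∀ (H : Subgroup C) (f : C → M), ∃ E : C →* M, (∀ a ∈ H, ∀ b ∈ H, f (a * b) = f a * f b) →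
      (∀ h ∈ H, E h = f h) ∧ (z ∉ H → E z = 1) ∧ ((∀ h ∈ H, f h = 1) → E = 1) := by
    intro H f
    by_cases h1 : ∀ a ∈ H, ∀ b ∈ H, f (a * b) = f a * f b
    swap
    · exact ⟨1, fun h => (h1 h).elim⟩
    by_cases h2 : ∀ h ∈ H, f h = 1
    · exact ⟨1, fun _ => ⟨fun h hh => (h2 h hh).symm, fun _ => rfl, fun _ => rfl⟩⟩
    obtain ⟨e, he, hz⟩ := H.exists_extend hC
      (MonoidHom.mk' (fun h : H => f h) fun a b => h1 a a.2 b b.2) z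
    exact ⟨e, fun _ => ⟨fun h hh => he ⟨h, hh⟩, hz, fun h => (h2 h).elim⟩⟩
  choose E hE using this
  exact ⟨E, hE⟩

section LiftData

variable {p : ℕ} [Fact p.Prime] {k W : Type*} [Field k] [CharP k p] [CommRing W]
  {π : W →+* k} {v : k →+ W} {n : Type*} [Fintype n] [DecidableEq n]

/-- Lifts to `W₂` of a representation `u` of a finite group `G`, after an extension of `G` by a group
of `p`-th roots of unity described by a cocycle `θ` on a finite `G`-set `S`. -/
structure LiftData (h : IsW2 p π v) {G : Type*} [Group G] (u : G →* GL n k) (S : Type*) [Fintype S]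
    [MulAction G S] {M : Type*} [CommGroup M] (ζ : M) where
  θ : G → S → M
  θ_mul : ∀ g h s, θ (g * h) s = θ g (h • s) * θ h s
  a : S → Matrix n n k
  Ψ : G → (S → M) → GL n W
  map_Ψ : ∀ g t, (∀ s, t s ^ p = θ g s) → GeneralLinearGroup.map π (Ψ g t) = u g
  mul_Ψ : ∀ g g' t t', (∀ s, t s ^ p = θ g s) → (∀ s, t' s ^ p = θ g' s) →
    Ψ g t * Ψ g' t' = Ψ (g * g') fun s => t (g' • s) * t' s
  ker_Ψ : ∀ ε : S → ℕ, Ψ 1 (fun s => ζ ^ ε s) = h.kerElem (∑ s, ε s • a s)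

namespace LiftData

variable {h : IsW2 p π v} {G : Type*} [Group G] {u : G →* GL n k} {S : Type*} [Fintype S]
    [MulAction G S] {M : Type*} [CommGroup M] {ζ : M} (L : LiftData h u S ζ)

theorem θ_one (s : S) : L.θ 1 s = 1 := by simpa using L.θ_mul 1 1 s

theorem map_mul_a (hζ : ζ ^ p = 1) (hroot : ∀ d : M, ∃ r, r ^ p = d) (g : G) (x : S) :
    (u g : Matrix n n k).map (frobenius k p) * L.a x =
      L.a (g • x) * (u g : Matrix n n k).map (frobenius k p) := by
  classical
  choose R hR using hroot
  have key : ∀ ε : S → ℕ, ∀ s, (ζ ^ ε s) ^ p = L.θ 1 s := fun ε s => by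
    rw [← pow_mul, mul_comm, pow_mul, hζ, one_pow, L.θ_one]
  have hg : ∀ s, R (L.θ g s) ^ p = L.θ g s := fun s => hR _
  have h1 := L.mul_Ψ g 1 _ _ hg (key (Pi.single x 1))
  have h2 := L.mul_Ψ 1 g _ _ (key (Pi.single (g • x) 1)) hg
  have h3 : L.Ψ g (fun s => R (L.θ g s)) * L.Ψ 1 (fun s => ζ ^ (Pi.single x 1 : S → ℕ) s) =
      L.Ψ 1 (fun s => ζ ^ (Pi.single (g • x) 1 : S → ℕ) s) * L.Ψ g (fun s => R (L.θ g s)) := by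
    rw [h1, h2, mul_one, one_mul]
    congr 1
    funext s
    simp only [one_smul, Pi.single_apply, smul_left_cancel_iff, mul_comm]
  rw [L.ker_Ψ, L.ker_Ψ] at h3
  have h4 : ∀ y : S, ∑ s, (Pi.single y 1 : S → ℕ) s • L.a s = L.a y := fun y => by
    simp [Pi.single_apply, ite_smul]
  simp only [h4] at h3
  rw [← L.map_Ψ g _ hg]
  generalize L.Ψ g (fun s => R (L.θ g s)) = A at h3 ⊢
  have h5 := congrArg Units.val h3
  simp only [Units.val_mul, IsW2.coe_kerElem, mul_add, add_mul, mul_one, one_mul, add_right_inj,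
    h.mul_mapv, h.mapv_mul] at h5
  exact h.mapv_injective h5

variable {C : Type*} [CommGroup C] (ι : C →* G)

theorem exists_commuting_lifts (hζ : ∀ d : M, d ^ p = 1 → ∃ i : ℕ, ζ ^ i = d)
    (hroot : ∀ d : M, ∃ r, r ^ p = d) (hC : ∀ c : C, c ^ p = 1) (z : C) :
    ∃ (Λ : C → GL n W) (ε : C → S → ℕ), (∀ c, GeneralLinearGroup.map π (Λ c) = u (ι c)) ∧
      (∀ c d, Λ c * Λ d = Λ d * Λ c) ∧ (∀ c, Λ c ^ p = h.kerElem (∑ s, ε c s • L.a s)) ∧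
      (∀ c s, ε c s ≠ 0 → ∃ c', L.θ (ι c') s ≠ 1) ∧ (∀ s, ε z s ≠ 0 → L.θ (ι z) s ≠ 1) ∧
      (∀ g, (∀ c, ι c * g = g * ι c) → ∀ c s, ε c (g • s) = ε c s) ∧
      (∀ g, ι z * g = g * ι z → ∀ s, ε z (g • s) = ε z s) := by
  classical
  let _ : MulAction C S := MulAction.compHom S ι
  have smul_def : ∀ (c : C) (s : S), c • s = ι c • s := fun _ _ => rfl
  choose R hR using hroot
  obtain ⟨E, hE⟩ := Subgroup.exists_extend_fun (M := M) hC z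
  let χ : S → C → M := fun s c => if c • s = s then L.θ (ι c) s else 1
  have hχ : ∀ s, ∀ a ∈ MulAction.stabilizer C s, ∀ b ∈ MulAction.stabilizer C s,
      χ s (a * b) = χ s a * χ s b := fun s a ha b hb => by
    have hab := mul_mem ha hb
    rw [MulAction.mem_stabilizer_iff] at ha hb hab
    simp only [χ, ha, hb, hab, if_true, map_mul, L.θ_mul, ← smul_def]
  let e : S → C →* M := fun s => E (MulAction.stabilizer C s) (χ s)
  have hfix : ∀ g c, ι c * g = g * ι c → ∀ s, c • g • s = g • s ↔ c • s = s := fun g c hgc s => by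
    rw [smul_def, smul_def, ← mul_smul, hgc, mul_smul, smul_left_cancel_iff]
  have hχg : ∀ g c, ι c * g = g * ι c → ∀ s, χ (g • s) c = χ s c := fun g c hgc s => by
    simp only [χ, hfix g c hgc s]
    split_ifs with hs
    · have h1 := L.θ_mul (ι c) g s
      rw [hgc, L.θ_mul, ← smul_def, hs, mul_comm] at h1
      exact (mul_right_cancel h1).symm
    · rfl
  have heg : ∀ g, (∀ c, ι c * g = g * ι c) → ∀ s, e (g • s) = e s := fun g hg s => by
    have h1 : MulAction.stabilizer C (g • s) = MulAction.stabilizer C s := by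
      ext c; exact hfix g c (hg c) s
    have h2 : χ (g • s) = χ s := funext fun c => hχg g c (hg c) s
    simp only [e, h1, h2]
  have hez : ∀ s, e s z = χ s z := fun s => by
    by_cases hs : z ∈ MulAction.stabilizer C s
    · exact (hE _ _ (hχ s)).1 z hs
    · rw [show e s z = 1 from (hE _ _ (hχ s)).2.1 hs]
      exact (if_neg hs).symm
  have heC : ∀ (c : C) s, e (c • s) = e s := fun c s =>
    heg (ι c) (fun d => by rw [← map_mul, ← map_mul, mul_comm]) s
  obtain ⟨m, hm⟩ := MulAction.exists_split_cocycle (C := C) (fun c s => L.θ (ι c) s)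
    (fun g h s => by rw [map_mul, L.θ_mul]; rfl) e heC
    (fun c s hc => ((hE _ _ (hχ s)).1 c hc).symm ▸ (if_pos hc).symm)
  have hep : ∀ c s, e s c ^ p = 1 := fun c s => by rw [← map_pow, hC, map_one]
  let I : M → ℕ := fun d => if hd : d = 1 ∨ d ^ p ≠ 1 then 0 else
    (hζ d (not_not.1 (not_or.1 hd).2)).choose
  have hI : ∀ d, d ^ p = 1 → ζ ^ I d = d := fun d hd => by
    by_cases h1 : d = 1
    · simp [I, h1]
    · have : ¬ (d = 1 ∨ d ^ p ≠ 1) := by simp [h1, hd]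
      simp only [I, this, dif_neg, not_false_eq_true]
      exact (hζ d (not_not.1 (not_or.1 this).2)).choose_spec
  have hI1 : ∀ d, I d ≠ 0 → d ≠ 1 := fun d h1 h2 => h1 (by simp [I, h2])
  let t : C → ℕ → S → M := fun c i s => R (e s c) ^ i * (R (m (c ^ i • s)) / R (m s))
  have ht : ∀ c i s, t c i s ^ p = L.θ (ι (c ^ i)) s := fun c i s => by
    rw [hm (c ^ i) s, mul_pow, div_pow, hR, hR, ← pow_mul, mul_comm i, pow_mul, hR, map_pow]
  refine ⟨fun c => L.Ψ (ι c) (t c 1), fun c s => I (e s c),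
    fun c => L.map_Ψ _ _ fun s => by rw [ht, pow_one], fun c d => ?_, fun c => ?_, fun c s hcs => ?_,
    fun s hs => ?_, fun g hg c s => congrArg (fun f : C →* M => I (f c)) (heg g hg s),
    fun g hg s => congrArg I (by rw [hez, hez, hχg g z hg])⟩
  · rw [L.mul_Ψ _ _ _ _ (fun s => by rw [ht, pow_one]) (fun s => by rw [ht, pow_one]),
      L.mul_Ψ _ _ _ _ (fun s => by rw [ht, pow_one]) (fun s => by rw [ht, pow_one]),
      ← map_mul, ← map_mul, mul_comm d c]
    congr 1
    funext s
    simp only [t, pow_one, ← smul_def, heC, smul_smul, mul_comm d c]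
    simp only [div_eq_mul_inv]
    calc _ = R (e s c) * R (e s d) * R (m ((c * d) • s)) * (R (m s))⁻¹ * ((R (m (d • s)))⁻¹ * R (m (d • s))) := by
          ac_rfl
      _ = R (e s c) * R (e s d) * R (m ((c * d) • s)) * (R (m s))⁻¹ * ((R (m (c • s)))⁻¹ * R (m (c • s))) := by
          rw [inv_mul_cancel, inv_mul_cancel]
      _ = _ := by ac_rfl
  · have h1 : ∀ i, L.Ψ (ι c) (t c 1) ^ i = L.Ψ (ι (c ^ i)) (t c i) := fun i => by
      induction i with
      | zero =>
        have := L.ker_Ψ (fun _ => 0)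
        simp only [pow_zero, zero_smul, Finset.sum_const_zero, h.kerElem_zero] at this
        rw [pow_zero, pow_zero, map_one, ← this]
        congr 1
        funext s
        simp [t]
      | succ i ih =>
        rw [pow_succ, ih, L.mul_Ψ _ _ _ _ (ht c i) (fun s => by rw [ht, pow_one]), ← map_mul, pow_succ c]
        congr 1
        funext s
        simp only [t, pow_one, ← smul_def, heC, smul_smul, ← pow_succ]
        simp only [div_eq_mul_inv, pow_succ (R (e s c))]
        calc _ = R (e s c) ^ i * R (e s c) * R (m (c ^ (i + 1) • s)) * (R (m s))⁻¹ * ((R (m (c • s)))⁻¹ * R (m (c • s))) := by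
              ac_rfl
          _ = _ := by rw [inv_mul_cancel, mul_one, ← mul_assoc]
    rw [h1, hC, map_one, ← L.ker_Ψ]
    congr 1
    funext s
    simp only [t, hC, one_smul, div_self', mul_one, hR, hI _ (hep c s)]
  · by_contra! h1
    refine hI1 _ hcs ?_
    rw [show e s = 1 from (hE _ _ (hχ s)).2.2 fun c hc => ?_, MonoidHom.one_apply]
    simp only [χ, h1, ite_self]
  · intro h1
    refine hI1 _ hs ?_
    rw [hez]
    simp only [χ, h1, ite_self]

end LiftData

end LiftData

theorem one_add_pow_of_pow_three_eq_zero {A : Type*} [Ring A] {b : A} (hb : b * b * b = 0) (m : ℕ) :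
    (1 + b) ^ m = 1 + m • b + m.choose 2 • (b * b) := by
  induction m with
  | zero => simp
  | succ m ih =>
    rw [pow_succ, ih, Nat.choose_succ_succ' m 1, Nat.choose_one_right]
    simp only [mul_add, add_mul, mul_one, one_mul, smul_mul_assoc, hb, add_smul, one_smul, smul_zero]
    abel

namespace IsW2

variable {p : ℕ} [Fact p.Prime] {k W : Type*} [Field k] [CharP k p] [CommRing W]
  {π : W →+* k} {v : k →+ W} {n : Type*} [Fintype n] [DecidableEq n]

theorem nsmul_matrix (h : IsW2 p π v) (A : Matrix n n W) :
    p • A = ((A.map π).map (frobenius k p)).map v := by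
  ext i j
  simp [nsmul_eq_mul, h.natCast_mul, frobenius_def]

theorem nsmul_mapv (h : IsW2 p π v) (X : Matrix n n k) : p • X.map v = 0 := by
  rw [h.nsmul_matrix, h.mapv_map]
  ext i j
  simp [(Fact.out : p.Prime).ne_zero, frobenius_def]

theorem commute_block (h : IsW2 p π v) {N L : Matrix n n W} {X Y : Matrix n n k}
    (hc : (1 + N + X.map v) * (1 + L + Y.map v) = (1 + L + Y.map v) * (1 + N + X.map v))
    (hNL : N * L = 0) (hLN : L * N = 0) :
    (N.map π).map (frobenius k p) * Y + X * (L.map π).map (frobenius k p) =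
      (L.map π).map (frobenius k p) * X + Y * (N.map π).map (frobenius k p) := by
  apply h.mapv_injective
  simp only
  rw [Matrix.map_add _ (map_add v), Matrix.map_add _ (map_add v), ← h.mul_mapv, ← h.mul_mapv,
    ← h.mapv_mul, ← h.mapv_mul]
  simp only [mul_add, add_mul, mul_one, one_mul, h.mapv_mul_mapv, hNL, hLN] at hc
  rw [← sub_eq_zero] at hc ⊢
  rw [← hc]
  abel

/-- The `p`-th power of a lift of a transvection commuting with a lift of a second transvection. -/
theorem pow_of_commute_transvection (h : IsW2 p π v) (hp : p ≠ 2) {i l j : n} (hil : i ≠ l) (hij : i ≠ j)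
    (hlj : l ≠ j) (A B : GL n W)
    (hA : (GeneralLinearGroup.map π A : Matrix n n k) = 1 + Matrix.single i j 1)
    (hB : (GeneralLinearGroup.map π B : Matrix n n k) = 1 + Matrix.single i l 1) (hAB : A * B = B * A) :
    A ^ p = h.kerElem (Matrix.single i j 1) := by
  have hsingle : ∀ a b : n, ((Matrix.single a b (1 : W)).map π) = Matrix.single a b 1 := fun a b => by
    rw [Matrix.map_single, map_one]
  have hφ : ∀ a b : n, ((Matrix.single a b (1 : k)).map (frobenius k p)) = Matrix.single a b 1 := fun a b => by
    rw [Matrix.map_single, map_one]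
  have hmap : ∀ a b : n, ((1 + Matrix.single a b (1 : W)).map π) = 1 + Matrix.single a b 1 := fun a b => by
    rw [Matrix.map_add _ (map_add π), hsingle, Matrix.map_one _ (map_zero π) (map_one π)]
  obtain ⟨X, hX⟩ := h.exists_mapv (A : Matrix n n W) (1 + Matrix.single i j 1)
    (Eq.trans hA (hmap i j).symm)
  obtain ⟨Y, hY⟩ := h.exists_mapv (B : Matrix n n W) (1 + Matrix.single i l 1)
    (Eq.trans hB (hmap i l).symm)
  have hc := congrArg Units.val hAB
  rw [Units.val_mul, Units.val_mul, hX, hY] at hc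
  have h1 := h.commute_block hc (by simp [hij.symm]) (by simp [hil.symm])
  simp only [hsingle, hφ] at h1
  have h2 : X j i = 0 := by
    have := congrFun (congrFun h1 j) l
    simpa [Matrix.single_mul_apply_of_ne, Matrix.mul_single_apply_of_ne, hij.symm, hij, hlj] using this
  have h3 : Matrix.single i j (1 : k) * X * Matrix.single i j 1 = 0 := by
    rw [Matrix.single_mul_mul_single]
    simp [h2]
  set N := Matrix.single i j (1 : W) with hN
  have hNN : N * N = 0 := by simp [hN, hij.symm]
  have hb2 : (N + X.map v) * (N + X.map v) = N * X.map v + X.map v * N := by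
    simp only [mul_add, add_mul, hNN, h.mapv_mul_mapv]
    abel
  have hb3 : (N + X.map v) * (N + X.map v) * (N + X.map v) = 0 := by
    rw [hb2]
    have h4 : N * X.map v * N = 0 := by
      rw [h.mul_mapv, h.mapv_mul, hN, hsingle, hφ, h3]
      exact Matrix.map_zero _ (map_zero v)
    have h5 : N * X.map v * X.map v = 0 := by rw [mul_assoc, h.mapv_mul_mapv, mul_zero]
    have h6 : X.map v * N * N = 0 := by rw [mul_assoc, hNN, mul_zero]
    have h7 : X.map v * N * X.map v = 0 := by rw [mul_assoc, h.mul_mapv, h.mapv_mul_mapv]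
    simp only [mul_add, add_mul, h4, h5, h6, h7, add_zero]
  obtain ⟨c, hc⟩ : p ∣ p.choose 2 :=
    (Fact.out : p.Prime).dvd_choose_self two_ne_zero
      (lt_of_le_of_ne (Fact.out : p.Prime).two_le (Ne.symm hp))
  ext1
  rw [Units.val_pow_eq_pow_val, hX, add_assoc, one_add_pow_of_pow_three_eq_zero hb3, hc, hb2,
    h.mul_mapv, h.mapv_mul, ← Matrix.map_add _ (map_add v), mul_comm p c, mul_smul, h.nsmul_mapv,
    smul_zero, add_zero, smul_add, h.nsmul_mapv, add_zero, h.nsmul_matrix, hN, hsingle, hφ, coe_kerElem]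

end IsW2

section Two

variable {k W : Type*} [Field k] [CharP k 2] [CommRing W]
  {π : W →+* k} {v : k →+ W} {n : Type*} [Fintype n] [DecidableEq n]

theorem IsW2.sq_block (h : IsW2 2 π v) {N : Matrix n n W} {X : Matrix n n k} (hN : N * N = 0) :
    (1 + N + X.map v) * (1 + N + X.map v) = 1 + ((N.map π).map (frobenius k 2) +
      (N.map π).map (frobenius k 2) * X + X * (N.map π).map (frobenius k 2)).map v := by
  rw [Matrix.map_add _ (map_add v), Matrix.map_add _ (map_add v), ← h.mul_mapv, ← h.mapv_mul,
    ← h.nsmul_matrix]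
  have h2 := h.nsmul_mapv X
  simp only [two_smul] at h2 ⊢
  simp only [mul_add, add_mul, mul_one, one_mul, hN, h.mapv_mul_mapv]
  rw [← sub_eq_zero]
  refine Eq.trans ?_ h2
  abel

theorem trace_eq_of_block {e₁ e₃ a a' b b' X Y : Matrix n n k} (haa : a * a' = e₁) (haa' : a' * a = e₃)
    (hbb : b * b' = e₁) (hbb' : b' * b = e₃) (h₁a : e₁ * a = a) (ha₃ : a * e₃ = a) (h₁b : e₁ * b = b)
    (hb₃ : b * e₃ = b) (ha' : a' * e₁ = a') (hb' : b' * e₁ = b') (h₃b' : e₃ * b' = b') (h₃a' : e₃ * a' = a')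
    (hA : e₁ * (a + a * X + X * a) * e₃ = 0) (hB : e₁ * (b + b * Y + Y * b) * e₃ = 0)
    (hC : a * Y + X * b = b * X + Y * a) : e₁.trace = (b * a').trace := by
  have h1 : (e₁ * (a + a * X + X * a) * e₃ * (a' * (b * a'))).trace = 0 := by rw [hA]; simp
  have h2 : (e₁ * (b + b * Y + Y * b) * e₃ * b').trace = 0 := by rw [hB]; simp
  have h3 : ((a * Y + X * b) * a').trace = ((b * X + Y * a) * a').trace := by rw [hC]
  have e11 : e₁ * e₁ = e₁ := by rw [← haa, ← mul_assoc, haa, h₁a, haa]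
  have h4 : (e₁ * (a + a * X + X * a) * e₃ * (a' * (b * a'))).trace =
      (b * a').trace + (X * (a' * b)).trace + (X * (b * a')).trace := by
    have e1 : e₁ * (a + a * X + X * a) * e₃ * (a' * (b * a')) =
        (e₁ * a) * (e₃ * a') * (b * a') + (e₁ * a) * (X * ((e₃ * a') * (b * a'))) +
          e₁ * (X * ((a * (e₃ * a')) * (b * a'))) := by noncomm_ring
    rw [e1, h₃a', h₁a, haa, ← mul_assoc e₁ b, h₁b, trace_add, trace_add, trace_mul_comm a,
      trace_mul_comm e₁]
    congr 2
    · rw [mul_assoc, mul_assoc, mul_assoc, haa', hb₃]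
    · rw [mul_assoc, mul_assoc, ha']
  have h5 : (e₁ * (b + b * Y + Y * b) * e₃ * b').trace =
      e₁.trace + (Y * e₃).trace + (Y * e₁).trace := by
    have e1 : e₁ * (b + b * Y + Y * b) * e₃ * b' =
        (e₁ * b) * (e₃ * b') + (e₁ * b) * (Y * (e₃ * b')) +
          e₁ * (Y * (b * (e₃ * b'))) := by noncomm_ring
    rw [e1, h₃b', h₁b, hbb, trace_add, trace_add, trace_mul_comm b, trace_mul_comm e₁]
    congr 2
    · rw [mul_assoc, hbb']
    · rw [mul_assoc, e11]
  have h6 : ((a * Y + X * b) * a').trace = (Y * e₃).trace + (X * (b * a')).trace := by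
    rw [add_mul, trace_add, mul_assoc a, trace_mul_comm a, mul_assoc, haa', mul_assoc]
  have h7 : ((b * X + Y * a) * a').trace = (X * (a' * b)).trace + (Y * e₁).trace := by
    rw [add_mul, trace_add, mul_assoc b, trace_mul_comm b, mul_assoc, mul_assoc, haa]
  rw [h4] at h1
  rw [h5] at h2
  rw [h6, h7] at h3
  have h8 : ∀ x : k, x + x = 0 := fun x => CharTwo.add_self_eq_zero x
  linear_combination h2 - h1 - h3 + h8 (X * (b * a')).trace - h8 (Y * e₁).trace

end Two

namespace LiftData

variable {p : ℕ} [Fact p.Prime] {k W : Type*} [Field k] [CharP k p] [CommRing W]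
  {π : W →+* k} {v : k →+ W} {n : Type*} [Fintype n] [DecidableEq n]
  {D : HeisDatum (Matrix n n k)} {E E' : Matrix n n k} [Finite D.X] [Finite D.Y]
  {u : D.Grp →* GL n k} {S : Type*} [Fintype S] [MulAction D.Grp S] {M : Type*} [CommGroup M] {ζ : M}

/-- The elements `1 + x + z` form an abelian group. -/
def _root_.HeisDatum.Grp.ofXZ {A : Type*} [Ring A] {D : HeisDatum A} :
    Multiplicative (D.X × D.Z) →* D.Grp where
  toFun c := ⟨c.toAdd.1, 0, c.toAdd.2⟩
  map_one' := rfl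
  map_mul' c d := by ext <;> simp

theorem exists_commuting_lifts_ofXZ {h : IsW2 p π v} (L : LiftData h u S ζ)
    (hu : ∀ g, (u g : Matrix n n k) = HeisDatum.Grp.toRing g)
    (H : D.IsGood (frobenius k p).mapMatrix E E') (hζ1 : ζ ^ p = 1)
    (hζ : ∀ d : M, d ^ p = 1 → ∃ i : ℕ, ζ ^ i = d) (hroot : ∀ d : M, ∃ r, r ^ p = d)
    (hXY : p < Nat.card (D.X × D.Y)) (hp : p ≠ 2 ∨ p < Nat.card D.X ∧ p < Nat.card D.Y)
    (z : D.Z) (x : D.X) :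
    ∃ (A B : GL n W) (T : Matrix n n k), GeneralLinearGroup.map π A = u (.ofZ z) ∧
      GeneralLinearGroup.map π B = u ⟨x, 0, 0⟩ ∧ A * B = B * A ∧ A ^ p = h.kerElem T ∧
      D.e₁ * T * D.e₃ = 0 := by
  have hpA : ∀ a : Matrix n n k, p • a = 0 := fun a => by
    ext i j; simp
  obtain ⟨Λ, ε, hΛ, hcomm, hpow, -, hε, -, hinv⟩ := L.exists_commuting_lifts HeisDatum.Grp.ofXZ hζ hroot
    (fun c => by
      change Multiplicative.ofAdd (p • c.toAdd) = 1
      rw [show p • c.toAdd = 0 from Prod.ext (Subtype.ext (hpA _)) (Subtype.ext (hpA _))]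
      rfl) (.ofAdd (0, z))
  refine ⟨Λ (.ofAdd (0, z)), Λ (.ofAdd (x, 0)), _, hΛ _, hΛ _, hcomm _ _, hpow _, ?_⟩
  refine H.sum_eq_zero hpA L.a (fun g s => ?_) L.θ L.θ_mul hXY hp _
    (fun g s => hinv g (HeisDatum.Grp.ofZ_mul_comm z g) s) fun s hs => ⟨z, hε s hs⟩
  have := L.map_mul_a hζ1 hroot g s
  rw [hu] at this
  exact this

theorem exists_commuting_lifts_ofZ {h : IsW2 p π v} (L : LiftData h u S ζ)
    (hu : ∀ g, (u g : Matrix n n k) = HeisDatum.Grp.toRing g)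
    (H : D.IsGood (frobenius k p).mapMatrix E E') (hζ1 : ζ ^ p = 1)
    (hζ : ∀ d : M, d ^ p = 1 → ∃ i : ℕ, ζ ^ i = d) (hroot : ∀ d : M, ∃ r, r ^ p = d)
    (hXY : p < Nat.card (D.X × D.Y)) (hp : p ≠ 2 ∨ p < Nat.card D.X ∧ p < Nat.card D.Y)
    (z z' : D.Z) :
    ∃ (A B : GL n W) (T T' : Matrix n n k), GeneralLinearGroup.map π A = u (.ofZ z) ∧
      GeneralLinearGroup.map π B = u (.ofZ z') ∧ A * B = B * A ∧ A ^ p = h.kerElem T ∧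
      B ^ p = h.kerElem T' ∧ D.e₁ * T * D.e₃ = 0 ∧ D.e₁ * T' * D.e₃ = 0 := by
  have hpA : ∀ a : Matrix n n k, p • a = 0 := fun a => by
    ext i j; simp
  let ι : Multiplicative D.Z →* D.Grp :=
    { toFun := fun c => .ofZ c.toAdd
      map_one' := rfl
      map_mul' := fun c d => HeisDatum.Grp.ofZ_add _ _ }
  obtain ⟨Λ, ε, hΛ, hcomm, hpow, hε, -, hinv, -⟩ := L.exists_commuting_lifts ι hζ hroot
    (fun c => by
      change Multiplicative.ofAdd (p • c.toAdd) = 1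
      rw [show p • c.toAdd = 0 from Subtype.ext (hpA _)]
      rfl) 1
  have key : ∀ c, D.e₁ * (∑ s, ε c s • L.a s) * D.e₃ = 0 := fun c => by
    refine H.sum_eq_zero hpA L.a (fun g s => ?_) L.θ L.θ_mul hXY hp _
      (fun g s => hinv g (fun c => HeisDatum.Grp.ofZ_mul_comm _ g) c s) fun s hs => hε c s hs
    have := L.map_mul_a hζ1 hroot g s
    rw [hu] at this
    exact this
  exact ⟨Λ (.ofAdd z), Λ (.ofAdd z'), _, _, hΛ _, hΛ _, hcomm _ _, hpow _, hpow _, key _, key _⟩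

theorem false_of_ne_two {h : IsW2 p π v} (L : LiftData h u S ζ)
    (hu : ∀ g, (u g : Matrix n n k) = HeisDatum.Grp.toRing g)
    (H : D.IsGood (frobenius k p).mapMatrix E E') (hζ1 : ζ ^ p = 1)
    (hζ : ∀ d : M, d ^ p = 1 → ∃ i : ℕ, ζ ^ i = d) (hroot : ∀ d : M, ∃ r, r ^ p = d)
    (hXY : p < Nat.card (D.X × D.Y)) (hp : p ≠ 2) {i l j : n} (hil : i ≠ l) (hij : i ≠ j)
    (hlj : l ≠ j) (h₁ : D.e₁ = Matrix.single i i 1) (h₃ : D.e₃ = Matrix.single j j 1)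
    (hx : Matrix.single i l 1 ∈ D.X) (hz : Matrix.single i j 1 ∈ D.Z) : False := by
  obtain ⟨A, B, T, hA, hB, hAB, hT, hT'⟩ :=
    L.exists_commuting_lifts_ofXZ hu H hζ1 hζ hroot hXY (Or.inl hp) ⟨_, hz⟩ ⟨_, hx⟩
  have h1 := h.pow_of_commute_transvection hp hil hij hlj A B
    (by rw [hA, hu]; simp [HeisDatum.Grp.toRing_apply, HeisDatum.Grp.ofZ])
    (by rw [hB, hu]; simp [HeisDatum.Grp.toRing_apply]) hAB
  rw [hT] at h1
  rw [h.kerElem_injective h1, h₁, h₃] at hT'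
  have := congrFun (congrFun hT' i) j
  simp at this

theorem false_of_trace_ne {k W : Type*} [Field k] [CharP k 2] [CommRing W]
    {π : W →+* k} {v : k →+ W} {n : Type*} [Fintype n] [DecidableEq n]
    {D : HeisDatum (Matrix n n k)} {E E' : Matrix n n k} [Finite D.X] [Finite D.Y]
    {u : D.Grp →* GL n k} {S : Type*} [Fintype S] [MulAction D.Grp S] {M : Type*} [CommGroup M] {ζ : M}
    {h : IsW2 2 π v} (L : LiftData h u S ζ)
    (hu : ∀ g, (u g : Matrix n n k) = HeisDatum.Grp.toRing g)
    (H : D.IsGood (frobenius k 2).mapMatrix E E') (hζ1 : ζ ^ 2 = 1)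
    (hζ : ∀ d : M, d ^ 2 = 1 → ∃ i : ℕ, ζ ^ i = d) (hroot : ∀ d : M, ∃ r, r ^ 2 = d)
    (hX : 2 < Nat.card D.X) (hY : 2 < Nat.card D.Y)
    (f₁ f₃ : Matrix n n W) (hf₁ : f₁.map π = D.e₁) (hf₃ : f₃.map π = D.e₃) (hf : f₃ * f₁ = 0)
    {z z' : Matrix n n k} (hz : z ∈ D.Z) (hzz : z * z' = D.e₁) (hzz' : z' * z = D.e₃)
    (hE'₁ : E' * D.e₁ = E') (hE'₃ : D.e₃ * E' = E') (hz'₁ : z' * D.e₁ = z') (hz'₃ : D.e₃ * z' = z')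
    (htr : D.e₁.trace ≠ (frobenius k 2) (z * E').trace) : False := by
  have hXY : 2 < Nat.card (D.X × D.Y) := by rw [Nat.card_prod]; nlinarith
  obtain ⟨A, B, T, T', hA, hB, hAB, hT, hT', hT1, hT2⟩ :=
    L.exists_commuting_lifts_ofZ hu H hζ1 hζ hroot hXY (Or.inr ⟨hX, hY⟩) ⟨E, H.mem⟩ ⟨z, hz⟩
  have hlift : ∀ x ∈ D.Z, ∃ N : Matrix n n W, N.map π = x ∧
      ∃ N', N = f₁ * N' * f₃ := fun x hx => by
    choose τ hτ using h.surjective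
    refine ⟨f₁ * x.map τ * f₃, ?_, _, rfl⟩
    rw [Matrix.map_mul, Matrix.map_mul, hf₁, hf₃, Matrix.map_map]
    rw [show x.map (π ∘ τ) = x from by ext i j; simp [hτ]]
    exact D.hZ x hx
  have lift_mul : ∀ N N' : Matrix n n W, f₁ * N * f₃ * (f₁ * N' * f₃) = 0 := fun N N' => by
    rw [show f₁ * N * f₃ * (f₁ * N' * f₃) = f₁ * N * (f₃ * f₁) * N' * f₃ by noncomm_ring, hf]
    simp
  obtain ⟨N, hN, N₀, rfl⟩ := hlift E H.mem
  obtain ⟨N', hN', N₀', rfl⟩ := hlift z hz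
  obtain ⟨X, hX⟩ := h.exists_mapv (A : Matrix n n W) (1 + f₁ * N₀ * f₃) (by
    rw [Matrix.map_add _ (map_add π), hN, Matrix.map_one _ (map_zero π) (map_one π)]
    refine (congrArg Units.val hA).trans ?_
    rw [hu]; simp [HeisDatum.Grp.toRing_apply, HeisDatum.Grp.ofZ])
  obtain ⟨Y, hY⟩ := h.exists_mapv (B : Matrix n n W) (1 + f₁ * N₀' * f₃) (by
    rw [Matrix.map_add _ (map_add π), hN', Matrix.map_one _ (map_zero π) (map_one π)]
    refine (congrArg Units.val hB).trans ?_
    rw [hu]; simp [HeisDatum.Grp.toRing_apply, HeisDatum.Grp.ofZ])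
  have hc := congrArg Units.val hAB
  rw [Units.val_mul, Units.val_mul, hX, hY] at hc
  have hC := h.commute_block hc (lift_mul _ _) (lift_mul _ _)
  have hA2 := congrArg Units.val hT
  have hB2 := congrArg Units.val hT'
  rw [sq, Units.val_mul, hX, h.sq_block (lift_mul _ _), IsW2.coe_kerElem, add_right_inj, hN] at hA2
  rw [sq, Units.val_mul, hY, h.sq_block (lift_mul _ _), IsW2.coe_kerElem, add_right_inj, hN'] at hB2
  rw [← h.mapv_injective hA2] at hT1
  rw [← h.mapv_injective hB2] at hT2
  rw [hN, hN'] at hC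
  let φ : Matrix n n k →+* Matrix n n k := (frobenius k 2).mapMatrix
  have hφ₁ : φ D.e₁ = D.e₁ := H.map_e₁
  have hφ₃ : φ D.e₃ = D.e₃ := H.map_e₃
  have hEl := D.hZ _ H.mem
  have hzl := D.hZ _ hz
  have key : ∀ a b c : Matrix n n k, a * b = c → φ a * φ b = φ c := fun a b c hab => by
    rw [← map_mul, hab]
  refine htr ((trace_eq_of_block (e₁ := D.e₁) (e₃ := D.e₃) (a := φ E) (a' := φ E') (b := φ z) (b' := φ z')
    ?_ ?_ ?_ ?_ ?_ ?_ ?_ ?_ ?_ ?_ ?_ ?_ hT1 hT2 hC).trans ?_)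
  · rw [key _ _ _ H.mul₁, hφ₁]
  · rw [key _ _ _ H.mul₃, hφ₃]
  · rw [key _ _ _ hzz, hφ₁]
  · rw [key _ _ _ hzz', hφ₃]
  · conv_lhs => rw [← hφ₁]
    exact key _ _ _ (HeisDatum.block_left D.e₁₁ hEl)
  · conv_lhs => rw [← hφ₃]
    exact key _ _ _ (HeisDatum.block_right D.e₃₃ hEl)
  · conv_lhs => rw [← hφ₁]
    exact key _ _ _ (HeisDatum.block_left D.e₁₁ hzl)
  · conv_lhs => rw [← hφ₃]
    exact key _ _ _ (HeisDatum.block_right D.e₃₃ hzl)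
  · conv_lhs => rw [← hφ₁]
    exact key _ _ _ hE'₁
  · conv_lhs => rw [← hφ₁]
    exact key _ _ _ hz'₁
  · conv_lhs => rw [← hφ₃]
    exact key _ _ _ hz'₃
  · conv_lhs => rw [← hφ₃]
    exact key _ _ _ hE'₃
  · rw [key _ _ _ rfl, Matrix.trace, Matrix.trace, map_sum]
    rfl

end LiftData

section ZProd

variable {Δ L L' : Type*} [CommGroup L] [CommGroup L']

/-- The monomial with exponents `ν` in the family `P`. -/
def zprod (P : Δ → L) (ν : Δ →₀ ℤ) : L := ν.prod fun δ n => P δ ^ n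

theorem zprod_add (P : Δ → L) (ν μ : Δ →₀ ℤ) : zprod P (ν + μ) = zprod P ν * zprod P μ := by
  classical
  exact Finsupp.prod_add_index' (by simp) (by simp [_root_.zpow_add])

theorem zprod_zero (P : Δ → L) : zprod P 0 = 1 := Finsupp.prod_zero_index

theorem zprod_nsmul (P : Δ → L) (m : ℕ) (ν : Δ →₀ ℤ) : zprod P (m • ν) = zprod P ν ^ m := by
  induction m with
  | zero => simp [zprod_zero]
  | succ m ih => rw [succ_nsmul, zprod_add, ih, pow_succ]

theorem zprod_sub (P : Δ → L) (ν μ : Δ →₀ ℤ) : zprod P (ν - μ) = zprod P ν / zprod P μ := by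
  rw [eq_div_iff_mul_eq'', ← zprod_add, add_sub_cancel]

theorem zprod_pow (P : Δ → L) (m : ℕ) (ν : Δ →₀ ℤ) :
    zprod (fun δ => P δ ^ m) ν = zprod P ν ^ m := by
  simp only [zprod, Finsupp.prod, ← Finset.prod_pow]
  exact Finset.prod_congr rfl fun δ _ => by rw [← zpow_natCast, ← zpow_natCast, zpow_comm]

theorem map_zprod {F : Type*} [FunLike F L L'] [MonoidHomClass F L L'] (f : F) (P : Δ → L)
    (ν : Δ →₀ ℤ) : f (zprod P ν) = zprod (fun δ => f (P δ)) ν := by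
  simp [zprod, map_finsuppProd]

theorem zprod_congr {P Q : Δ → L} {ν : Δ →₀ ℤ} (h : ∀ δ ∈ ν.support, P δ = Q δ) :
    zprod P ν = zprod Q ν :=
  Finset.prod_congr rfl fun δ hδ => by simp only [h δ hδ]

end ZProd

/-- The multiplicative structures needed for Kummer theory over the invariants of a finite group `G`
acting on a field, relative to a family `P` of independent elements generating the multiplicative
group up to constants. -/
structure KummerData (p : ℕ) (Γ G Ω L Δ M : Type*) [Group Γ] [Group G] [CommGroup Ω] [CommGroup L]
    [CommGroup M] [MulDistribMulAction Γ Ω] [MulDistribMulAction G L] [MulAction G Δ] where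
  q : Γ →* G
  q_surjective : Function.Surjective q
  j : L →* Ω
  j_injective : Function.Injective j
  j_smul : ∀ σ x, j (q σ • x) = σ • j x
  c : M →* L
  c_injective : Function.Injective c
  smul_c : ∀ (g : G) m, g • c m = c m
  P : Δ → L
  θ : G → Δ → M
  smul_P : ∀ g δ, g • P δ = c (θ g δ) * P (g • δ)
  exists_of_fixed : ∀ y : Ω, (∀ σ, q σ = 1 → σ • y = y) → ∃ N, N.Coprime p ∧ ∃ x, j x = y ^ N
  exists_eq : ∀ x : L, ∃ m ν, x = c m * zprod P ν
  indep : ∀ m ν, zprod P ν = c m → ν = 0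
  ζ : M
  ζ_pow : ζ ^ p = 1
  ζ_ne : ζ ≠ 1
  torsion : ∀ d : Ω, d ^ p = 1 → ∃ i : ℕ, j (c ζ) ^ i = d
  exists_root : ∀ d : M, ∃ r, r ^ p = d
  exists_root' : ∀ d : Ω, ∃ r, r ^ p = d
  kummer : ∀ χ : q.ker → ZMod p, (∀ σ τ, χ (σ * τ) = χ σ + χ τ) → Smooth Ω χ →
    ∃ y : Ω, ∀ τ : q.ker, τ • y = j (c ζ) ^ (χ τ).val * y

namespace KummerData

variable {p : ℕ} [Fact p.Prime] {Γ G Ω L Δ M : Type*} [Group Γ] [Group G] [CommGroup Ω] [CommGroup L]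
    [CommGroup M] [MulDistribMulAction Γ Ω] [MulDistribMulAction G L] [MulAction G Δ]
    (K : KummerData p Γ G Ω L Δ M)

theorem torsion_M (d : M) (hd : d ^ p = 1) : ∃ i : ℕ, K.ζ ^ i = d := by
  obtain ⟨i, hi⟩ := K.torsion (K.j (K.c d)) (by rw [← map_pow, ← map_pow, hd, map_one, map_one])
  exact ⟨i, K.c_injective (K.j_injective (by rw [map_pow, map_pow, hi]))⟩

theorem smul_jc (σ : Γ) (m : M) : σ • K.j (K.c m) = K.j (K.c m) := by
  rw [← K.j_smul, K.smul_c]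

/-- The image of the root of unity in `Ω`. -/
def z : Ω := K.j (K.c K.ζ)

theorem z_pow_p : K.z ^ p = 1 := by rw [z, ← map_pow, ← map_pow, K.ζ_pow, map_one, map_one]

theorem smul_z (σ : Γ) : σ • K.z = K.z := K.smul_jc σ _

theorem z_pow_eq_one_iff (m : ℕ) : K.z ^ m = 1 ↔ p ∣ m := by
  have h1 : orderOf K.z = p := orderOf_eq_prime K.z_pow_p fun h1 => K.ζ_ne (by
    rw [z, ← map_one K.j, ← map_one K.c] at h1
    exact K.c_injective (K.j_injective h1))
  rw [← orderOf_dvd_iff_pow_eq_one, h1]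

theorem z_pow_congr {a b : ℕ} (h : (a : ZMod p) = b) : K.z ^ a = K.z ^ b := by
  rw [ZMod.natCast_eq_natCast_iff] at h
  have h1 : orderOf K.z ∣ p := orderOf_dvd_of_pow_eq_one K.z_pow_p
  exact pow_eq_pow_iff_modEq.2 (h.of_dvd h1)

theorem θ_mul (g h : G) (δ : Δ) : K.θ (g * h) δ = K.θ g (h • δ) * K.θ h δ := by
  apply K.c_injective
  have h1 := K.smul_P (g * h) δ
  rw [mul_smul, K.smul_P, smul_mul', K.smul_c, K.smul_P, ← mul_assoc, mul_smul] at h1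
  rw [map_mul, ← mul_right_cancel h1, mul_comm]

/-- A chosen `p`-th root of `P δ`. -/
noncomputable def r (δ : Δ) : Ω := (K.exists_root' (K.j (K.P δ))).choose

theorem r_pow (δ : Δ) : K.r δ ^ p = K.j (K.P δ) := (K.exists_root' (K.j (K.P δ))).choose_spec

theorem exists_smul_r (σ : Γ) (δ : Δ) : ∃ t : M, t ^ p = K.θ (K.q σ) δ ∧
    σ • K.r δ = K.j (K.c t) * K.r (K.q σ • δ) := by
  obtain ⟨t, ht⟩ := K.exists_root (K.θ (K.q σ) δ)
  obtain ⟨i, hi⟩ := K.torsion (σ • K.r δ / (K.j (K.c t) * K.r (K.q σ • δ))) (by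
    rw [div_pow, mul_pow, ← map_pow, ← map_pow, ← smul_pow', K.r_pow, K.r_pow, ht, ← K.j_smul,
      K.smul_P, map_mul, div_self'])
  refine ⟨K.ζ ^ i * t, by rw [mul_pow, ht, ← pow_mul, mul_comm i, pow_mul, K.ζ_pow, one_pow, one_mul], ?_⟩
  rw [map_mul, map_mul, map_pow, map_pow, hi, mul_assoc, div_mul_cancel]

theorem exists_smul_r_of_ker (τ : Γ) (hτ : K.q τ = 1) (δ : Δ) : ∃ i : ℕ,
    τ • K.r δ = K.z ^ i * K.r δ := by
  obtain ⟨t, ht, h⟩ := K.exists_smul_r τ δ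
  rw [hτ, one_smul] at h
  rw [hτ, show K.θ 1 δ = 1 by simpa using K.θ_mul 1 1 δ] at ht
  obtain ⟨i, rfl⟩ := K.torsion_M t ht
  exact ⟨i, by rw [h, z, map_pow, map_pow]⟩

theorem exists_finset_of_hom (χ : K.q.ker → ZMod p) (hχ : ∀ σ τ, χ (σ * τ) = χ σ + χ τ)
    (hs : Smooth Ω χ) : ∃ T : Finset Δ, ∀ τ : K.q.ker, (∀ δ ∈ T, τ • K.r δ = K.r δ) → χ τ = 0 := by
  obtain ⟨y, hy⟩ := K.kummer χ hχ hs
  obtain ⟨N, hN, x, hx⟩ := K.exists_of_fixed (y ^ p) fun σ hσ => by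
    rw [smul_pow', show σ • y = _ from hy ⟨σ, hσ⟩, mul_pow, ← pow_mul, mul_comm _ p, pow_mul]
    rw [show K.j (K.c K.ζ) ^ p = 1 from K.z_pow_p, one_pow, one_mul]
  obtain ⟨m, ν, rfl⟩ := K.exists_eq x
  obtain ⟨m', hm'⟩ := K.exists_root m
  obtain ⟨i, hi⟩ := K.torsion (y ^ N / (K.j (K.c m') * zprod K.r ν)) (by
    rw [div_pow, mul_pow, ← zprod_pow, ← map_pow, ← map_pow, hm', ← pow_mul, mul_comm N, pow_mul, ← hx,
      map_mul, map_zprod]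
    simp only [K.r_pow, div_self'])
  rw [eq_div_iff_mul_eq'] at hi
  refine ⟨ν.support, fun τ hτ => ?_⟩
  have h1 : τ • y ^ N = y ^ N := by
    have h2 : τ • zprod K.r ν = zprod K.r ν := by
      rw [← MulDistribMulAction.toMonoidHom_apply, map_zprod]
      exact zprod_congr hτ
    rw [← hi]
    change (τ : Γ) • (_ : Ω) = _
    rw [smul_mul', smul_mul', smul_pow', K.smul_jc, K.smul_jc]
    rw [show (τ : Γ) • zprod K.r ν = _ from h2]
  rw [smul_pow', hy, mul_pow, mul_eq_right, ← pow_mul] at h1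
  have h2 := (K.z_pow_eq_one_iff _).1 h1
  have h3 := Nat.Coprime.dvd_of_dvd_mul_right hN.symm h2
  rw [← ZMod.val_eq_zero]
  exact Nat.eq_zero_of_dvd_of_lt h3 (ZMod.val_lt _)

theorem exists_smul_r_eq (T : Finset Δ) (ε : Δ → ℕ) :
    ∃ τ : Γ, K.q τ = 1 ∧ ∀ δ ∈ T, τ • K.r δ = K.z ^ ε δ * K.r δ := by
  classical
  let I : AddSubgroup (T → ZMod p) :=
    { carrier := {f | ∃ τ : Γ, K.q τ = 1 ∧ ∀ δ : T, τ • K.r (δ : Δ) = K.z ^ (f δ).val * K.r (δ : Δ)}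
      zero_mem' := ⟨(1 : Γ), map_one _, fun δ => by simp⟩
      add_mem' := by
        rintro f g ⟨σ, hσ, hf⟩ ⟨τ, hτ, hg⟩
        refine ⟨σ * τ, by rw [map_mul, hσ, hτ, one_mul], fun δ => ?_⟩
        rw [mul_smul, hg, smul_mul', smul_pow', K.smul_z, hf, ← mul_assoc, ← pow_add]
        congr 1
        exact K.z_pow_congr (by simp [add_comm])
      neg_mem' := by
        rintro f ⟨σ, hσ, hf⟩
        refine ⟨σ⁻¹, by rw [map_inv, hσ, inv_one], fun δ => ?_⟩
        rw [inv_smul_eq_iff, smul_mul', smul_pow', K.smul_z, hf, ← mul_assoc, ← pow_add,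
          K.z_pow_congr (b := 0) (by simp), pow_zero, one_mul] }
  have hI : I = ⊤ := by
    by_contra hI
    obtain ⟨ψ, ⟨f, hf⟩, hψ⟩ := AddSubgroup.exists_zmod_hom (p := p) (fun f => by ext; simp) I hI
    let ν : Δ →₀ ℤ := Finsupp.indicator T fun δ h => ((ψ (Pi.single ⟨δ, h⟩ 1)).val : ℤ)
    have hψf : ∀ f, ψ f = ∑ δ, f δ * ψ (Pi.single δ 1) := fun f => by
      conv_lhs => rw [← Finset.univ_sum_single f, map_sum]
      refine Finset.sum_congr rfl fun δ _ => ?_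
      have : Pi.single (M := fun _ => ZMod p) δ (f δ) = (f δ).val • Pi.single δ 1 := by
        ext x
        by_cases hx : x = δ
        · subst hx; simp
        · simp [hx]
      rw [this, map_nsmul]
      simp
    let y : Ω := ∏ δ : T, K.r δ ^ (ψ (Pi.single δ 1)).val
    have hy : zprod K.r ν = y := by
      simp only [zprod, ν]
      rw [Finsupp.prod_indicator_index_eq_prod_attach _ (by simp)]
      simp only [zpow_natCast, y, Finset.univ_eq_attach]
    obtain ⟨N, hN, x, hx⟩ := K.exists_of_fixed y fun τ hτ => by
      choose i hi using K.exists_smul_r_of_ker τ hτ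
      have hiI : (fun δ : T => (i δ : ZMod p)) ∈ I :=
        ⟨τ, hτ, fun δ => by rw [hi, K.z_pow_congr (a := i δ) (b := (i δ : ZMod p).val) (by simp)]⟩
      have h1 := hψ _ hiI
      rw [hψf] at h1
      simp only [y, Finset.smul_prod', smul_pow', hi, mul_pow, Finset.prod_mul_distrib, ← pow_mul,
        Finset.prod_pow_eq_pow_sum]
      rw [K.z_pow_congr (b := 0), pow_zero, one_mul]
      simpa using h1
    obtain ⟨m, μ, rfl⟩ := K.exists_eq x
    have h1 : zprod K.P (N • ν - p • μ) = K.c (m ^ p) := by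
      rw [zprod_sub, zprod_nsmul, zprod_nsmul, map_pow, div_eq_iff_eq_mul, ← mul_pow]
      apply K.j_injective
      rw [map_pow, map_pow, hx, ← hy, ← pow_mul, mul_comm N, pow_mul, ← zprod_pow, map_zprod]
      simp only [K.r_pow]
    have h2 := sub_eq_zero.1 (K.indep _ _ h1)
    have h3 : ∀ δ : T, ψ (Pi.single δ 1) = 0 := fun δ => by
      have h4 := DFunLike.congr_fun h2 (δ : Δ)
      simp only [Finsupp.coe_smul, Pi.smul_apply, ν, Finsupp.indicator_of_mem δ.2, nsmul_eq_mul] at h4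
      have h5 : (p : ℤ) ∣ ((N * (ψ (Pi.single δ 1)).val : ℕ) : ℤ) := ⟨_, by push_cast; exact h4⟩
      have h6 := Nat.Coprime.dvd_of_dvd_mul_left hN.symm (Int.natCast_dvd_natCast.1 h5)
      rw [← ZMod.val_eq_zero]
      exact Nat.eq_zero_of_dvd_of_lt h6 (ZMod.val_lt _)
    rw [hψf] at hf
    simp [h3] at hf
  obtain ⟨τ, hτ, h⟩ : (fun δ : T => (ε δ : ZMod p)) ∈ I := hI ▸ AddSubgroup.mem_top _
  exact ⟨τ, hτ, fun δ hδ => by rw [h ⟨δ, hδ⟩, K.z_pow_congr (b := ε δ) (by simp)]⟩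

theorem AddMonoidHom.exists_zmod_ne_zero_of_module {V : Type*} [AddCommGroup V] [Module (ZMod p) V]
    {v : V} (hv : v ≠ 0) : ∃ ψ : V →+ ZMod p, ψ v ≠ 0 := by
  obtain ⟨l, hl, -⟩ := Submodule.exists_le_ker_of_notMem (K := ZMod p) (p := (⊥ : Submodule (ZMod p) V))
    (v := v) (by simpa using hv)
  exact ⟨l.toAddMonoidHom, hl⟩

theorem AddMonoidHom.exists_zmod_ne_zero {V : Type*} [AddCommGroup V] (hV : ∀ v : V, p • v = 0)
    {v : V} (hv : v ≠ 0) : ∃ ψ : V →+ ZMod p, ψ v ≠ 0 :=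
  let _ : Module (ZMod p) V := AddCommGroup.zmodModule hV
  exists_zmod_ne_zero_of_module hv

theorem exists_finset_of_smooth {V : Type*} [AddCommGroup V] (hV : ∀ v : V, p • v = 0)
    (hfin : ∀ x : Ω, (MulAction.orbit Γ x).Finite) (φ : K.q.ker → V)
    (hφ : ∀ σ τ, φ (σ * τ) = φ σ + φ τ) (hs : Smooth Ω φ) :
    ∃ T : Finset Δ, ∀ τ : K.q.ker, (∀ δ ∈ T, τ • K.r δ = K.r δ) → φ τ = 0 := by
  classical
  let f : K.q.ker →* Multiplicative V := ⟨⟨fun τ => .ofAdd (φ τ), by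
    have := hφ 1 1
    rw [mul_one, left_eq_add] at this
    rw [this]; rfl⟩, hφ⟩
  let A : AddSubgroup V := Subgroup.toAddSubgroup' f.range
  have hA : Finite A := by
    have h2 := Smooth.finite_range (Γ := K.q.ker)
      (fun x => (hfin x).subset fun _ ⟨τ, hτ⟩ => ⟨(τ : Γ), hτ⟩) hs
    exact h2
  have : Finite (A →+ ZMod p) := DFunLike.finite _
  let φA : K.q.ker → A := fun τ => ⟨φ τ, τ, rfl⟩
  have h1 : ∀ ψ : A →+ ZMod p, ∃ T : Finset Δ, ∀ τ : K.q.ker, (∀ δ ∈ T, τ • K.r δ = K.r δ) →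
      ψ (φA τ) = 0 := fun ψ => K.exists_finset_of_hom (fun τ => ψ (φA τ))
        (fun σ τ => by rw [← map_add]; exact congrArg ψ (Subtype.ext (hφ σ τ)))
        (Smooth.comp (Smooth.congr_inj Subtype.val_injective hs) ψ)
  choose T hT using h1
  cases nonempty_fintype (A →+ ZMod p)
  refine ⟨Finset.univ.biUnion T, fun τ hτ => ?_⟩
  by_contra h0
  obtain ⟨ψ, hψ⟩ := AddMonoidHom.exists_zmod_ne_zero (p := p) (V := A)
    (fun v => Subtype.ext (hV v)) (v := φA τ) fun h => h0 (congrArg Subtype.val h)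
  exact hψ (hT ψ τ fun δ hδ => hτ δ (Finset.mem_biUnion.2 ⟨ψ, Finset.mem_univ _, hδ⟩))

variable {k W : Type*} [Field k] [CommRing W] {π : W →+* k} {v : k →+ W}
  {n : Type*} [Fintype n] [DecidableEq n]

/-- The lifts of `g` to `Γ` with a prescribed action on the chosen roots. -/
def IsLift (S : SubMulAction G Δ) (g : G) (t : S → M) (σ : Γ) : Prop :=
  K.q σ = g ∧ ∀ δ : S, σ • K.r (δ : Δ) = K.j (K.c (t δ)) * K.r (g • (δ : Δ))

theorem exists_isLift {S : SubMulAction G Δ} (hS : (S : Set Δ).Finite) (g : G) (t : S → M)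
    (ht : ∀ δ : S, t δ ^ p = K.θ g δ) : ∃ σ, K.IsLift S g t σ := by
  classical
  obtain ⟨σ, rfl⟩ := K.q_surjective g
  choose t' ht' hσ using K.exists_smul_r σ
  have h1 : ∀ δ : S, ∃ i : ℕ, K.ζ ^ i = t δ / t' δ := fun δ =>
    K.torsion_M _ (by rw [div_pow, ht, ht', div_self'])
  choose i hi using h1
  obtain ⟨τ, hτ, h⟩ := K.exists_smul_r_eq hS.toFinset fun δ => if h : δ ∈ S then i ⟨δ, h⟩ else 0
  refine ⟨σ * τ, by rw [map_mul, hτ, mul_one], fun δ => ?_⟩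
  rw [mul_smul, h δ (by simp), dif_pos δ.2, smul_mul', smul_pow', K.smul_z, hσ, z, ← map_pow, ← map_pow,
    hi, ← mul_assoc, ← map_mul, ← map_mul, div_mul_cancel]

variable {K} in
theorem IsLift.mul {S : SubMulAction G Δ} {g g' : G} {t t' : S → M} {σ σ' : Γ}
    (h : K.IsLift S g t σ) (h' : K.IsLift S g' t' σ') :
    K.IsLift S (g * g') (fun s => t (g' • s) * t' s) (σ * σ') := by
  refine ⟨by rw [map_mul, h.1, h'.1], fun δ => ?_⟩
  have h1 := h.2 (g' • δ)
  rw [SubMulAction.val_smul] at h1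
  rw [mul_smul, h'.2, smul_mul', K.smul_jc, h1, mul_smul, map_mul, map_mul, ← mul_assoc,
    mul_comm (K.j (K.c (t' _)))]

theorem nonempty_liftData [CharP k p] (h : IsW2 p π v) [Finite G]
    (hfin : ∀ x : Ω, (MulAction.orbit Γ x).Finite)
    (u : G →* GL n k) (ρ : Γ →* GL n W) (hρ : Smooth Ω ρ)
    (hu : (GeneralLinearGroup.map π).comp ρ = u.comp K.q) :
    ∃ (S : SubMulAction G Δ) (_ : Fintype S), Nonempty (LiftData h u S K.ζ) := by
  classical
  have hu' : ∀ σ, GeneralLinearGroup.map π (ρ σ) = u (K.q σ) := DFunLike.congr_fun hu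
  have h1 : ∀ τ : K.q.ker, ∃ X, ρ τ = h.kerElem X := fun τ =>
    h.exists_kerElem (by rw [hu', show K.q τ = 1 from τ.2, map_one])
  choose φ hφ using h1
  obtain ⟨T, hT⟩ := K.exists_finset_of_smooth (fun v => by ext; simp) hfin φ
    (fun σ τ => h.kerElem_injective (by
      rw [h.kerElem_add, ← hφ, ← hφ, ← hφ, Subgroup.coe_mul, map_mul]))
    (Smooth.congr_inj h.kerElem_injective (by simpa only [← hφ] using hρ.restrict K.q.ker))
  let S : SubMulAction G Δ :=
    { carrier := ⋃ δ ∈ T, MulAction.orbit G δ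
      smul_mem' := fun g δ hδ => by
        simp only [Set.mem_iUnion] at hδ ⊢
        obtain ⟨ε, hε, hδ⟩ := hδ
        exact ⟨ε, hε, MulAction.mem_orbit_of_mem_orbit g hδ⟩ }
  have hS : (S : Set Δ).Finite := T.finite_toSet.biUnion fun δ _ => Set.finite_range _
  have hTS : ∀ δ ∈ T, δ ∈ S := fun δ hδ =>
    Set.mem_iUnion₂.2 ⟨δ, hδ, MulAction.mem_orbit_self δ⟩
  have hker : ∀ τ : K.q.ker, (∀ δ ∈ S, τ • K.r δ = K.r δ) → ρ τ = 1 := fun τ hτ => by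
    rw [hφ, hT τ fun δ hδ => hτ δ (hTS δ hδ), h.kerElem_zero]
  have huniq : ∀ g t σ σ', K.IsLift S g t σ → K.IsLift S g t σ' → ρ σ = ρ σ' := by
    intro g t σ σ' h1 h2
    have h3 := hker ⟨σ⁻¹ * σ', by rw [MonoidHom.mem_ker, map_mul, map_inv, h1.1, h2.1, inv_mul_cancel]⟩
      fun δ hδ => by
        change (σ⁻¹ * σ') • K.r δ = K.r δ
        rw [mul_smul, inv_smul_eq_iff, h1.2 ⟨δ, hδ⟩, h2.2 ⟨δ, hδ⟩]
    rw [map_mul, map_inv, inv_mul_eq_one] at h3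
    exact h3
  let Ψ : G → (S → M) → GL n W := fun g t => if h : ∃ σ, K.IsLift S g t σ then ρ h.choose else 1
  have hΨ : ∀ g t σ, K.IsLift S g t σ → Ψ g t = ρ σ := fun g t σ hσ => by
    have h1 : ∃ σ, K.IsLift S g t σ := ⟨σ, hσ⟩
    rw [show Ψ g t = _ from dif_pos h1]
    exact huniq _ _ _ _ h1.choose_spec hσ
  have hθ : ∀ (ε : S → ℕ) δ, (K.ζ ^ ε δ) ^ p = K.θ 1 δ := fun ε δ => by
    rw [show K.θ 1 δ = 1 by simpa using K.θ_mul 1 1 δ, ← pow_mul, mul_comm, pow_mul, K.ζ_pow, one_pow]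
  have hf : ∀ ε : S → ℕ, ∃ X, Ψ 1 (fun s => K.ζ ^ ε s) = h.kerElem X := fun ε => by
    obtain ⟨σ, hσ⟩ := K.exists_isLift hS 1 _ (hθ ε)
    rw [hΨ _ _ σ hσ]
    exact h.exists_kerElem (by rw [hu', hσ.1, map_one])
  choose f hf using hf
  have hmul : ∀ g g' t t', (∀ s : S, t s ^ p = K.θ g s) → (∀ s : S, t' s ^ p = K.θ g' s) →
      Ψ g t * Ψ g' t' = Ψ (g * g') fun s => t (g' • s) * t' s := fun g g' t t' ht ht' => by
    obtain ⟨σ, hσ⟩ := K.exists_isLift hS g t ht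
    obtain ⟨σ', hσ'⟩ := K.exists_isLift hS g' t' ht'
    rw [hΨ _ _ _ hσ, hΨ _ _ _ hσ', hΨ _ _ _ (hσ.mul hσ'), map_mul]
  have hadd : ∀ ε ε', f (ε + ε') = f ε + f ε' := fun ε ε' => h.kerElem_injective (by
    rw [h.kerElem_add, ← hf, ← hf, ← hf, hmul _ _ _ _ (hθ ε) (hθ ε'), mul_one]
    simp only [one_smul, Pi.add_apply, pow_add])
  let F : (S → ℕ) →+ Matrix n n k := ⟨⟨f, by simpa using hadd 0 0⟩, hadd⟩
  let _ : Fintype S := hS.fintype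
  refine ⟨S, hS.fintype, ⟨⟨fun g s => K.θ g s, fun g g' s => K.θ_mul g g' s, fun s => f (Pi.single s 1), Ψ,
    fun g t ht => ?_, hmul, fun ε => ?_⟩⟩⟩
  · obtain ⟨σ, hσ⟩ := K.exists_isLift hS g t ht
    rw [hΨ _ _ _ hσ, hu', hσ.1]
  · rw [hf]
    congr 1
    change F ε = _
    conv_lhs => rw [← Finset.univ_sum_single ε, map_sum]
    refine Finset.sum_congr rfl fun s _ => ?_
    have : Pi.single (M := fun _ => ℕ) s (ε s) = ε s • Pi.single s 1 := by
      rw [← Pi.single_smul]; simp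
    rw [this, map_nsmul]
    rfl

end KummerData

section UFD

variable (R : Type*) [CommRing R] [IsDomain R] [UniqueFactorizationMonoid R]

/-- The classes of irreducible elements up to units. -/
def IrreducibleClass : Type _ := {d : Associates R // Irreducible d}

variable {R}

namespace IrreducibleClass

/-- A representative of a class of irreducible elements. -/
noncomputable def rep (d : IrreducibleClass R) : R := Quot.out d.1

theorem mk_rep (d : IrreducibleClass R) : Associates.mk d.rep = d.1 := Quot.out_eq _

theorem irreducible_rep (d : IrreducibleClass R) : Irreducible d.rep := by
  rw [← Associates.irreducible_mk, mk_rep]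
  exact d.2

theorem prime_rep (d : IrreducibleClass R) : Prime d.rep :=
  UniqueFactorizationMonoid.irreducible_iff_prime.1 d.irreducible_rep

theorem eq_of_rep_dvd {d e : IrreducibleClass R} (h : d.rep ∣ e.rep) : d = e := by
  have := d.irreducible_rep.associated_of_dvd e.irreducible_rep h
  exact Subtype.ext (by rw [← mk_rep, ← mk_rep, Associates.mk_eq_mk_iff_associated.2 this])

/-- The class of an irreducible element. -/
def mk (r : R) (hr : Irreducible r) : IrreducibleClass R :=
  ⟨Associates.mk r, Associates.irreducible_mk.2 hr⟩

theorem associated_rep_mk (r : R) (hr : Irreducible r) : Associated (mk r hr).rep r :=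
  Associates.mk_eq_mk_iff_associated.1 (mk_rep _)

variable {G : Type*} [Group G] [MulSemiringAction G R]

theorem irreducible_smul {g : G} {r : R} (hr : Irreducible r) : Irreducible (g • r) :=
  (MulEquiv.irreducible_iff (MulSemiringAction.toRingEquiv G R g)).2 hr

noncomputable instance : SMul G (IrreducibleClass R) where
  smul g d := mk (g • d.rep) (irreducible_smul d.irreducible_rep)

theorem associated_smul_rep (g : G) (d : IrreducibleClass R) : Associated (g • d).rep (g • d.rep) :=
  associated_rep_mk _ _

noncomputable instance : MulAction G (IrreducibleClass R) where
  one_smul d := eq_of_rep_dvd (by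
    refine (associated_smul_rep _ _).dvd.trans ?_
    rw [one_smul])
  mul_smul g h d := eq_of_rep_dvd (by
    refine (associated_smul_rep _ _).dvd.trans ?_
    rw [mul_smul]
    refine Dvd.dvd.trans ?_ (associated_smul_rep _ _).symm.dvd
    exact map_dvd (MulSemiringAction.toRingHom G R g) (associated_smul_rep _ _).symm.dvd)

variable {L : Type*} [Field L] [Algebra R L] [IsFractionRing R L]

variable (L) in
/-- The representative as a unit of the fraction field. -/
noncomputable def unit (d : IrreducibleClass R) : Lˣ :=
  Units.mk0 (algebraMap R L d.rep) (by
    simpa using d.irreducible_rep.ne_zero)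

theorem exists_eq (x : Lˣ) : ∃ (m : Rˣ) (ν : IrreducibleClass R →₀ ℤ),
    x = Units.map (algebraMap R L) m * zprod (unit L) ν := by
  let H : Subgroup Lˣ :=
    { carrier := {x | ∃ (m : Rˣ) (ν : IrreducibleClass R →₀ ℤ),
        x = Units.map (algebraMap R L) m * zprod (unit L) ν}
      one_mem' := ⟨1, 0, by rw [map_one, zprod_zero, mul_one]⟩
      mul_mem' := by
        rintro _ _ ⟨m, ν, rfl⟩ ⟨m', ν', rfl⟩
        exact ⟨m * m', ν + ν', by rw [map_mul, zprod_add, mul_mul_mul_comm]⟩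
      inv_mem' := by
        rintro _ ⟨m, ν, rfl⟩
        refine ⟨m⁻¹, 0 - ν, by rw [map_inv, zprod_sub, zprod_zero, one_div, mul_inv]⟩ }
  have h1 : ∀ r : R, ∀ hr : algebraMap R L r ≠ 0, Units.mk0 _ hr ∈ H := by
    intro r
    induction r using WfDvdMonoid.induction_on_irreducible with
    | zero => exact fun h => (h (map_zero _)).elim
    | unit u hu =>
      obtain ⟨u, rfl⟩ := hu
      exact fun h => ⟨u, 0, by ext; simp [zprod_zero]⟩
    | mul a i ha hi ih =>
      intro h
      rw [map_mul] at h
      have h1 := ih (right_ne_zero_of_mul h)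
      obtain ⟨u, hu⟩ := associated_rep_mk i hi
      have h2 : Units.mk0 _ (left_ne_zero_of_mul h) ∈ H := by
        refine ⟨u, Finsupp.single (mk i hi) 1, ?_⟩
        ext
        conv_lhs => rw [Units.val_mk0, ← hu]
        simp [zprod, unit, mul_comm]
      convert! H.mul_mem h2 h1
      ext; simp
  obtain ⟨a, b, hb, hx⟩ := IsFractionRing.div_surjective (A := R) (x : L)
  have hb' : algebraMap R L b ≠ 0 := by simpa using nonZeroDivisors.ne_zero hb
  have ha' : algebraMap R L a ≠ 0 := fun h => x.ne_zero (by rw [← hx, h, zero_div])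
  have : x = Units.mk0 _ ha' / Units.mk0 _ hb' := by ext; simp [hx]
  rw [this]
  exact H.div_mem (h1 _ _) (h1 _ _)

theorem le_zero_of_zprod_eq (m : Rˣ) (ν : IrreducibleClass R →₀ ℤ)
    (h : zprod (unit L) ν = Units.map (algebraMap R L) m) (d : IrreducibleClass R) : ν d ≤ 0 := by
  by_contra! hd
  let a : R := ∏ e ∈ ν.support, e.rep ^ (ν e).toNat
  let b : R := ∏ e ∈ ν.support, e.rep ^ (-ν e).toNat
  have h1 : a = m * b := by
    apply IsFractionRing.injective R L
    have h2 : algebraMap R L b ≠ 0 := by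
      simp [b, Finset.prod_ne_zero_iff, irreducible_rep, Irreducible.ne_zero]
    have h3 : algebraMap R L a / algebraMap R L b = algebraMap R L m := by
      rw [show algebraMap R L m = (Units.map (algebraMap R L) m : Lˣ) from rfl, ← h]
      simp only [a, b, zprod, Finsupp.prod, map_prod, map_pow, ← Finset.prod_div_distrib, Units.coe_prod,
        unit, Units.val_zpow_eq_zpow_val, Units.val_mk0]
      refine Finset.prod_congr rfl fun e _ => ?_
      rw [← zpow_natCast, ← zpow_natCast, ← zpow_sub₀ (by simpa using e.irreducible_rep.ne_zero)]
      congr 1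
      omega
    rw [map_mul, ← h3, div_mul_cancel₀ _ h2]
  have h2 : d.rep ∣ b := by
    rw [← Units.dvd_mul_left (u := m), ← h1]
    exact (dvd_pow_self _ (by omega)).trans
      (Finset.dvd_prod_of_mem _ (Finsupp.mem_support_iff.2 hd.ne'))
  obtain ⟨e, -, he⟩ := d.prime_rep.exists_mem_finset_dvd h2
  have h3 : (-ν e).toNat ≠ 0 := fun h0 => by
    rw [h0, pow_zero] at he
    exact d.irreducible_rep.not_isUnit (isUnit_of_dvd_one he)
  rw [← eq_of_rep_dvd (d.prime_rep.dvd_of_dvd_pow he)] at h3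
  omega

theorem eq_zero_of_zprod_eq (m : Rˣ) (ν : IrreducibleClass R →₀ ℤ)
    (h : zprod (unit L) ν = Units.map (algebraMap R L) m) : ν = 0 := by
  ext d
  refine le_antisymm (le_zero_of_zprod_eq m ν h d) ?_
  have := le_zero_of_zprod_eq (L := L) m⁻¹ (0 - ν) (by rw [zprod_sub, h, zprod_zero, map_inv, one_div]) d
  simpa using this

end IrreducibleClass

end UFD

theorem IsAlgClosed.exists_pow_mem_range_of_fixed {L Ω : Type*} [Field L] [Field Ω] [IsAlgClosed Ω]
    [Algebra L Ω] [Algebra.IsAlgebraic L Ω] (y : Ω) (hy : ∀ σ : Ω ≃ₐ[L] Ω, σ y = y) :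
    ∃ n : ℕ, y ^ ringExpChar L ^ n ∈ (algebraMap L Ω).range := by
  classical
  rw [← mem_perfectClosure_iff, mem_perfectClosure_iff_natSepDegree_eq_one,
    Polynomial.natSepDegree_eq_of_isAlgClosed (E := Ω), Finset.card_eq_one]
  have hy' : IsIntegral L y := Algebra.IsIntegral.isIntegral y
  refine ⟨y, ?_⟩
  ext x
  rw [Multiset.mem_toFinset, Finset.mem_singleton, Polynomial.mem_aroots]
  constructor
  · rintro ⟨-, hx⟩
    have : IsAlgClosure L Ω := ⟨inferInstance, inferInstance⟩
    have : Normal L Ω := IsAlgClosure.normal L Ω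
    obtain ⟨σ, hσ⟩ := minpoly.exists_algEquiv_of_root' (K := L) (L := Ω) hy'.isAlgebraic hx
    rw [← hσ, hy]
  · rintro rfl
    exact ⟨minpoly.ne_zero hy', minpoly.aeval L x⟩

theorem ringExpChar_coprime {L : Type*} [Field L] {p : ℕ} (hp : p.Prime) (h : (p : L) ≠ 0) :
    (ringExpChar L).Coprime p := by
  have h1 : ringExpChar L = max (ringChar L) 1 := rfl
  have := ringExpChar.expChar L
  rcases expChar_is_prime_or_one L (ringExpChar L) with h2 | h2
  · rw [Nat.coprime_primes h2 hp]
    intro h3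
    have h4 : ringChar L = p := by have := hp.one_lt; omega
    exact h (h4 ▸ ringChar.Nat.cast_ringChar)
  · rw [h2]; exact Nat.coprime_one_left _

section Invariants

variable {E L Ω G : Type*} [Field E] [Field L] [Field Ω] [Algebra E L] [Algebra E Ω] [Algebra L Ω]
  [IsScalarTower E L Ω] [Group G] [MulSemiringAction G L]

theorem exists_restrict [FiniteDimensional E L] [Normal E L] [Normal E Ω] (e : G ≃* (L ≃ₐ[E] L))
    (he : ∀ g x, e g x = g • x) : ∃ q : (Ω ≃ₐ[E] Ω) →* G, Function.Surjective q ∧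
    ∀ σ x, algebraMap L Ω (q σ • x) = σ (algebraMap L Ω x) := by
  refine ⟨e.symm.toMonoidHom.comp (AlgEquiv.restrictNormalHom L),
    e.symm.surjective.comp (AlgEquiv.restrictNormalHom_surjective _),
    fun σ x => ?_⟩
  rw [← AlgEquiv.restrictNormal_commutes, ← he]
  congr 1
  exact DFunLike.congr_fun (e.apply_symm_apply (σ.restrictNormal L)) x

variable [FaithfulSMul G L]

theorem smooth_restrict [Finite G] {q : (Ω ≃ₐ[E] Ω) →* G}
    (hq : ∀ σ x, algebraMap L Ω (q σ • x) = σ (algebraMap L Ω x)) : Smooth Ω q := by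
  classical
  cases nonempty_fintype G
  have h1 : ∀ g : G, ∃ x : L, g ≠ 1 → g • x ≠ x := fun g => by
    by_contra! h
    exact (h 0).1 (eq_of_smul_eq_smul (α := L) fun x => by rw [(h x).2, one_smul])
  choose x hx using h1
  refine Smooth.of_hom q (Finset.univ.image fun g => algebraMap L Ω (x g)) fun n hn => ?_
  by_contra h
  refine hx _ h ((algebraMap L Ω).injective ?_)
  rw [hq]
  exact hn _ (Finset.mem_image_of_mem _ (Finset.mem_univ _))

theorem exists_pow_of_fixed [IsAlgClosed Ω] [Algebra.IsAlgebraic L Ω] {q : (Ω ≃ₐ[E] Ω) →* G}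
    (hq : ∀ σ x, algebraMap L Ω (q σ • x) = σ (algebraMap L Ω x)) (y : Ω)
    (hy : ∀ σ, q σ = 1 → σ y = y) :
    ∃ n : ℕ, ∃ x, algebraMap L Ω x = y ^ ringExpChar L ^ n := by
  refine IsAlgClosed.exists_pow_mem_range_of_fixed (L := L) y fun σ =>
    hy (σ.restrictScalars E) (eq_of_smul_eq_smul (α := L) fun x => ?_)
  rw [one_smul]
  apply (algebraMap L Ω).injective
  rw [hq]
  exact σ.commutes x

theorem exists_smul_eq_pow_mul {p : ℕ} [Fact p.Prime] (Γ : Subgroup (Ω ≃ₐ[E] Ω))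
    (hfin : ∀ x : Ω, (MulAction.orbit Γ x).Finite) (η : Ωˣ) (hη : η ^ p = 1)
    (hη' : ∀ γ : Γ, γ • η = η) (χ : Γ → ZMod p) (hχ : ∀ σ τ, χ (σ * τ) = χ σ + χ τ)
    (hs : Smooth Ωˣ χ) : ∃ y : Ωˣ, ∀ τ, τ • y = η ^ (χ τ).val * y := by
  classical
  obtain ⟨S, hS⟩ := hs
  have hs' : Smooth Ω χ := ⟨S.image Units.val, fun γ n hn => hS γ n fun x hx =>
    Units.ext (hn _ (Finset.mem_image_of_mem _ hx))⟩
  let _ : MulAction Γ Unit := { smul := fun _ u => u, one_smul := fun _ => rfl, mul_smul := fun _ _ _ => rfl }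
  obtain ⟨f, hf, h⟩ := exists_eq_div_smul_of_cocycle hfin (S := Unit)
    ((Smooth.const (Ω := Ω) fun s : Unit => s)) (fun γ _ => (η ^ (χ γ).val : Ωˣ)) (fun γ _ => Units.ne_zero _)
    (hs'.comp fun c (_ : Unit) => ((η ^ c.val : Ωˣ) : Ω)) fun σ τ _ => by
      change _ = _ * ((σ • η ^ (χ τ).val : Ωˣ) : Ω)
      rw [← Units.val_mul, smul_pow', hη', hχ, ← pow_add]
      congr 1
      have h1 : orderOf η ∣ p := orderOf_dvd_of_pow_eq_one hη
      refine pow_eq_pow_iff_modEq.2 (Nat.ModEq.of_dvd h1 ?_)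
      rw [← ZMod.natCast_eq_natCast_iff]
      simp
  refine ⟨(Units.mk0 _ (hf ()))⁻¹, fun τ => ?_⟩
  have h1 := h τ ()
  rw [smul_inv', inv_eq_iff_eq_inv, _root_.mul_inv_rev, inv_inv, eq_mul_inv_iff_mul_eq, mul_comm]
  exact Units.ext h1

end Invariants

/-- The action on units induced by an action by multiplicative endomorphisms. -/
abbrev unitsAction (G L : Type*) [Group G] [Monoid L] [MulDistribMulAction G L] :
    MulDistribMulAction G Lˣ where
  smul g x := Units.map (MulDistribMulAction.toMonoidHom L g) x
  one_smul x := Units.ext (one_smul G (x : L))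
  mul_smul g h x := Units.ext (mul_smul g h (x : L))
  smul_one g := Units.ext (smul_one g)
  smul_mul g x y := Units.ext (smul_mul' g (x : L) y)

theorem exists_kummerData {p : ℕ} [Fact p.Prime] {R E L Ω G : Type*} [CommRing R] [IsDomain R]
    [UniqueFactorizationMonoid R] [Field E] [Field L] [Field Ω] [Algebra R L] [IsFractionRing R L]
    [Algebra E L] [Algebra E Ω] [Algebra L Ω] [IsScalarTower E L Ω] [FiniteDimensional E L] [Normal E L]
    [IsAlgClosure E Ω] [Group G] [Finite G] [MulSemiringAction G R] [MulSemiringAction G L]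
    [FaithfulSMul G L] (e : G ≃* (L ≃ₐ[E] L)) (he : ∀ g x, e g x = g • x)
    (hRL : ∀ (g : G) (r : R), algebraMap R L (g • r) = g • algebraMap R L r)
    (hu : ∀ (g : G) (u : Rˣ), g • (u : R) = u) (hroot : ∀ u : Rˣ, ∃ r, r ^ p = u) {ζ : Rˣ}
    (hζ : IsPrimitiveRoot ζ p) (hp : (p : L) ≠ 0) :
    letI := unitsAction G L
    ∃ K : KummerData p (Ω ≃ₐ[E] Ω) G Ωˣ Lˣ (IrreducibleClass R) Rˣ, K.ζ = ζ ∧ Smooth Ω K.q := by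
  let _ := unitsAction G L
  have : IsAlgClosed Ω := IsAlgClosure.isAlgClosed E
  have : Normal E Ω := IsAlgClosure.normal E Ω
  have : Algebra.IsAlgebraic E Ω := IsAlgClosure.isAlgebraic
  have : Algebra.IsAlgebraic L Ω := Algebra.IsAlgebraic.tower_top (K := E) L
  obtain ⟨q, hq, hqs⟩ := exists_restrict (Ω := Ω) e he
  have hjc : Function.Injective ((algebraMap L Ω).comp (algebraMap R L)) :=
    (algebraMap L Ω).injective.comp (IsFractionRing.injective R L)
  have hΘ : ∀ (g : G) (d : IrreducibleClass R), ∃ m : Rˣ, g • d.rep = m * (g • d).rep := fun g d => by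
    obtain ⟨m, hm⟩ := IrreducibleClass.associated_smul_rep g d
    exact ⟨m, by rw [mul_comm, hm]⟩
  choose θ hθ using hΘ
  have hζΩ : IsPrimitiveRoot (Units.map (algebraMap L Ω : L →* Ω) (Units.map (algebraMap R L : R →* L) ζ)) p :=
    (hζ.map_of_injective (Units.map_injective (IsFractionRing.injective R L))).map_of_injective
      (Units.map_injective (algebraMap L Ω).injective)
  have hσζ : ∀ (σ : Ω ≃ₐ[E] Ω) (u : Rˣ),
      σ • Units.map (algebraMap L Ω : L →* Ω) (Units.map (algebraMap R L : R →* L) u) =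
        Units.map (algebraMap L Ω : L →* Ω) (Units.map (algebraMap R L : R →* L) u) := fun σ u => by
    ext
    change σ (algebraMap L Ω (algebraMap R L u)) = algebraMap L Ω (algebraMap R L u)
    rw [← hqs, ← hRL, hu]
  refine ⟨{ q := q, q_surjective := hq
            j := Units.map (algebraMap L Ω : L →* Ω)
            j_injective := Units.map_injective (algebraMap L Ω).injective
            j_smul := fun σ x => Units.ext (hqs σ x)
            c := Units.map (algebraMap R L : R →* L)
            c_injective := Units.map_injective (IsFractionRing.injective R L)
            smul_c := fun g m => Units.ext (by
              change g • algebraMap R L m = algebraMap R L m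
              rw [← hRL, hu])
            P := IrreducibleClass.unit L
            θ := θ
            smul_P := fun g d => Units.ext (by
              change g • algebraMap R L d.rep = algebraMap R L (θ g d) * algebraMap R L (g • d).rep
              rw [← hRL, hθ, map_mul])
            exists_of_fixed := fun y hy => ?_
            exists_eq := IrreducibleClass.exists_eq
            indep := IrreducibleClass.eq_zero_of_zprod_eq
            ζ := ζ
            ζ_pow := hζ.pow_eq_one
            ζ_ne := hζ.ne_one (Fact.out : p.Prime).one_lt
            torsion := fun d hd => ?_
            exists_root := hroot
            exists_root' := fun d => ?_
            kummer := fun χ hχ hs => ?_ }, rfl, smooth_restrict hqs⟩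
  · obtain ⟨n, x, hx⟩ := exists_pow_of_fixed hqs (y : Ω) fun σ hσ => congrArg Units.val (hy σ hσ)
    have hx0 : x ≠ 0 := by
      rintro rfl
      rw [map_zero] at hx
      exact pow_ne_zero _ y.ne_zero hx.symm
    exact ⟨_, (ringExpChar_coprime Fact.out hp).pow_left n, Units.mk0 x hx0, Units.ext (by simpa using hx)⟩
  · obtain ⟨i, -, hi⟩ := IsPrimitiveRoot.eq_pow_of_pow_eq_one
      (IsPrimitiveRoot.coe_units_iff.2 hζΩ) (ξ := (d : Ω)) (by rw [← Units.val_pow_eq_pow_val, hd, Units.val_one])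
    exact ⟨i, Units.ext hi⟩
  · obtain ⟨z, hz⟩ := IsAlgClosed.exists_pow_nat_eq (d : Ω) (Fact.out : p.Prime).pos
    have hz0 : z ≠ 0 := by
      rintro rfl
      rw [zero_pow (Fact.out : p.Prime).ne_zero] at hz
      exact d.ne_zero hz.symm
    exact ⟨Units.mk0 z hz0, Units.ext (by simpa using hz)⟩
  · exact exists_smul_eq_pow_mul q.ker
      (fun x => (Gal.finite_orbit x).subset fun _ ⟨τ, hτ⟩ => ⟨(τ : Ω ≃ₐ[E] Ω), hτ⟩) _ hζΩ.pow_eq_one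
      (fun γ => hσζ γ ζ) χ hχ hs

section FunctionField

variable {p : ℕ} [Fact p.Prime] {k : Type*} [Field k] [CharP k p] {W : Type*} [CommRing W] {π : W →+* k}
  {v : k →+ W} {n : Type*} [Fintype n] [DecidableEq n]

theorem Smooth.units {Γ X Ω : Type*} [Group Γ] [Field Ω] [MulSemiringAction Γ Ω]
    [MulDistribMulAction Γ Ωˣ] (hval : ∀ (γ : Γ) (x : Ωˣ), ((γ • x : Ωˣ) : Ω) = γ • (x : Ω))
    {f : Γ → X} (hf : Smooth Ω f) : Smooth Ωˣ f := by
  classical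
  obtain ⟨S, hS⟩ := hf
  refine ⟨S.biUnion fun x => if hx : x = 0 then ∅ else {Units.mk0 x hx}, fun γ m hm =>
    hS γ m fun x hxS => ?_⟩
  rcases eq_or_ne x 0 with rfl | hx
  · exact smul_zero m
  · have := hm (Units.mk0 x hx) (Finset.mem_biUnion.2 ⟨x, hxS, by simp [hx]⟩)
    simpa [hval] using congrArg Units.val this

/-- A lift of the representation attached to the extension `L / E` gives a lifting datum. -/
theorem exists_liftData_of_isFractionRing (h : IsW2 p π v) {R E L G : Type} [CommRing R] [IsDomain R]
    [UniqueFactorizationMonoid R] [Field E] [Field L] [Algebra R L] [IsFractionRing R L]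
    [Algebra E L] [FiniteDimensional E L] [Normal E L] [Group G] [Finite G] [MulSemiringAction G R]
    [MulSemiringAction G L] [FaithfulSMul G L] (e : G ≃* (L ≃ₐ[E] L)) (he : ∀ g x, e g x = g • x)
    (hRL : ∀ (g : G) (r : R), algebraMap R L (g • r) = g • algebraMap R L r)
    (hu : ∀ (g : G) (u : Rˣ), g • (u : R) = u) (hroot : ∀ u : Rˣ, ∃ r, r ^ p = u) {ζ : Rˣ}
    (hζ : IsPrimitiveRoot ζ p) (hp : (p : L) ≠ 0) (u : G →* GL n k)
    (H : ∀ q : (AlgebraicClosure E ≃ₐ[E] AlgebraicClosure E) →* G, Smooth (AlgebraicClosure E) q →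
      ∃ ρ : (AlgebraicClosure E ≃ₐ[E] AlgebraicClosure E) →* GL n W,
        Smooth (AlgebraicClosure E) ρ ∧ (GeneralLinearGroup.map π).comp ρ = u.comp q) :
    ∃ (S : Type) (_ : Fintype S) (_ : MulAction G S), Nonempty (LiftData h u S ζ) ∧
      ∀ d : Rˣ, d ^ p = 1 → ∃ i : ℕ, ζ ^ i = d := by
  have : Algebra.IsAlgebraic E L := Algebra.IsAlgebraic.of_finite E L
  let i : L →ₐ[E] AlgebraicClosure E := IsAlgClosed.lift
  let _ : Algebra L (AlgebraicClosure E) := i.toRingHom.toAlgebra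
  have : IsScalarTower E L (AlgebraicClosure E) := IsScalarTower.of_algebraMap_eq fun x =>
    (i.commutes x).symm
  let _ := unitsAction G L
  obtain ⟨K, rfl, hK⟩ := exists_kummerData (Ω := AlgebraicClosure E) e he hRL hu hroot hζ hp
  obtain ⟨ρ, hρ, hρq⟩ := H K.q hK
  have hfin (x : (AlgebraicClosure E)ˣ) :
      (MulAction.orbit (AlgebraicClosure E ≃ₐ[E] AlgebraicClosure E) x).Finite := by
    refine Set.Finite.of_finite_image (f := Units.val) ((Gal.finite_orbit (K := E) (x : AlgebraicClosure E)).subset ?_)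
      Units.val_injective.injOn
    rintro _ ⟨_, ⟨σ, rfl⟩, rfl⟩
    exact ⟨σ, rfl⟩
  obtain ⟨S, hS, hL⟩ := K.nonempty_liftData h hfin u ρ (hρ.units fun _ _ => rfl) hρq
  exact ⟨S, hS, inferInstance, hL, K.torsion_M⟩

/-- The left regular action on a polynomial ring with variables indexed by a group. -/
noncomputable abbrev MvPolynomial.regularAction (F G : Type*) [CommRing F] [Group G] :
    MulSemiringAction G (MvPolynomial G F) where
  smul g f := MvPolynomial.rename (g * ·) f
  one_smul f := by
    change MvPolynomial.rename (fun x => 1 * x) f = f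
    simp only [one_mul]
    exact MvPolynomial.rename_id_apply f
  mul_smul g g' f := by
    change MvPolynomial.rename (fun x => g * g' * x) f =
      MvPolynomial.rename (g * ·) (MvPolynomial.rename (g' * ·) f)
    rw [MvPolynomial.rename_rename]
    simp only [Function.comp_def, mul_assoc]
  smul_zero g := map_zero (MvPolynomial.rename (g * ·))
  smul_add g := map_add (MvPolynomial.rename (g * ·))
  smul_one g := map_one (MvPolynomial.rename (g * ·))
  smul_mul g := map_mul (MvPolynomial.rename (g * ·))

theorem exists_liftData (h : IsW2 p π v) (F : Type) [Field F] (hp : (p : F) ≠ 0) {G : Type} [Group G]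
    [Finite G] (u : G →* GL n k)
    (H : ∀ (K : Type) [Field K] [Algebra F K]
      (q : (AlgebraicClosure K ≃ₐ[K] AlgebraicClosure K) →* G), Smooth (AlgebraicClosure K) q →
      ∃ ρ : (AlgebraicClosure K ≃ₐ[K] AlgebraicClosure K) →* GL n W,
        Smooth (AlgebraicClosure K) ρ ∧ (GeneralLinearGroup.map π).comp ρ = u.comp q) :
    ∃ (S : Type) (_ : Fintype S) (_ : MulAction G S) (M : Type) (_ : CommGroup M) (ζ : M),
      Nonempty (LiftData h u S ζ) ∧ ζ ^ p = 1 ∧ (∀ d : M, d ^ p = 1 → ∃ i : ℕ, ζ ^ i = d) ∧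
        ∀ d : M, ∃ r, r ^ p = d := by
  have hp0 : p ≠ 0 := (Fact.out : p.Prime).ne_zero
  let C := AlgebraicClosure F
  let R := MvPolynomial G C
  let L := FractionRing R
  let _ : MulSemiringAction G R := MvPolynomial.regularAction C G
  let _ : MulSemiringAction G L := IsFractionRing.mulSemiringAction G R L
  have hX (g g' : G) : g • (MvPolynomial.X g' : R) = MvPolynomial.X (g * g') :=
    MvPolynomial.rename_X _ _
  have hC (g : G) (c : C) : g • (MvPolynomial.C c : R) = MvPolynomial.C c :=
    MvPolynomial.rename_C _ _
  have hRL (g : G) (r : R) : algebraMap R L (g • r) = g • algebraMap R L r :=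
    algebraMap.coe_smul' g r L
  have : FaithfulSMul G L := ⟨fun {g g'} hg => by
    have h1 := IsFractionRing.injective R L
      ((hRL g (MvPolynomial.X 1)).trans ((hg _).trans (hRL g' (MvPolynomial.X 1)).symm))
    rw [hX, hX, mul_one, mul_one] at h1
    exact MvPolynomial.X_injective h1⟩
  have hpC : (p : C) ≠ 0 := by
    rw [← map_natCast (algebraMap F C)]
    exact (map_ne_zero _).2 hp
  have hunit (r : Rˣ) : ∃ c : Cˣ, r = Units.map (MvPolynomial.C : C →+* R).toMonoidHom c := by
    obtain ⟨c, hc, hr⟩ := MvPolynomial.isUnit_iff_eq_C_of_isReduced.1 r.isUnit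
    exact ⟨hc.unit, Units.ext hr⟩
  have : NeZero (p : C) := ⟨hpC⟩
  obtain ⟨ζ, hζ⟩ := HasEnoughRootsOfUnity.exists_primitiveRoot C p
  let E := FixedPoints.subfield G L
  let φ : F →+* E := (((algebraMap R L).comp MvPolynomial.C).comp (algebraMap F C)).codRestrict E
    fun x g => by
      change g • algebraMap R L (MvPolynomial.C _) = algebraMap R L (MvPolynomial.C _)
      rw [← hRL, hC]
  let _ : Algebra F E := φ.toAlgebra
  have hroot (r : Rˣ) : ∃ s, s ^ p = r := by
    obtain ⟨c, rfl⟩ := hunit r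
    obtain ⟨d, hd⟩ := IsAlgClosed.exists_pow_nat_eq (c : C) (Nat.pos_of_ne_zero hp0)
    have hd0 : d ≠ 0 := by
      rintro rfl
      rw [zero_pow hp0] at hd
      exact c.ne_zero hd.symm
    exact ⟨Units.map (MvPolynomial.C : C →+* R).toMonoidHom (Units.mk0 d hd0), by
      rw [← map_pow]
      exact congrArg _ (Units.ext hd)⟩
  have hζu : IsPrimitiveRoot (hζ.isUnit hp0).unit p := IsPrimitiveRoot.coe_units_iff.1 hζ
  have hζR := hζu.map_of_injective (f := Units.map (MvPolynomial.C : C →+* R).toMonoidHom)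
    (Units.map_injective (MvPolynomial.C_injective G C))
  obtain ⟨S, i₁, i₂, hS, hM⟩ := exists_liftData_of_isFractionRing h (R := R) (E := E) (L := L)
    (FixedPoints.toAlgAutMulEquiv G L) (fun _ _ => rfl) hRL
    (fun g r => by
      obtain ⟨c, rfl⟩ := hunit r
      exact hC g c) hroot hζR
    (by
      rw [← map_natCast (algebraMap R L), ← map_natCast (MvPolynomial.C : C →+* R)]
      exact (map_ne_zero_iff _ (IsFractionRing.injective R L)).2
        ((map_ne_zero_iff _ (MvPolynomial.C_injective G C)).2 hpC)) u (H E)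
  exact ⟨S, i₁, i₂, Rˣ, inferInstance, _, hS, hζR.pow_eq_one, hM, hroot⟩

end FunctionField

section BlockDatum

variable {k : Type*} [Field k] {n : Type*} [Fintype n] [DecidableEq n]

/-- The diagonal idempotent matrix with support `I`. -/
def blockIdem (R : Type*) [Semiring R] (I : Finset n) : Matrix n n R :=
  diagonal fun a => if a ∈ I then 1 else 0

theorem blockIdem_mul_apply {R : Type*} [Semiring R] (I : Finset n) (x : Matrix n n R) (a b : n) :
    (blockIdem R I * x) a b = if a ∈ I then x a b else 0 := by
  simp [blockIdem, diagonal_mul]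

theorem mul_blockIdem_apply {R : Type*} [Semiring R] (I : Finset n) (x : Matrix n n R) (a b : n) :
    (x * blockIdem R I) a b = if b ∈ I then x a b else 0 := by
  simp [blockIdem, mul_diagonal]

theorem blockIdem_mul_self (R : Type*) [Semiring R] (I : Finset n) :
    blockIdem R I * blockIdem R I = blockIdem R I := by
  rw [blockIdem, diagonal_mul_diagonal]
  congr 1
  ext a
  split_ifs <;> simp

theorem blockIdem_mul_of_disjoint (R : Type*) [Semiring R] {I J : Finset n} (h : Disjoint I J) :
    blockIdem R I * blockIdem R J = 0 := by
  rw [blockIdem, blockIdem, diagonal_mul_diagonal, ← diagonal_zero]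
  congr 1
  ext a
  by_cases ha : a ∈ I
  · simp [Finset.disjoint_left.1 h ha]
  · simp [ha]

theorem blockIdem_map {R R' : Type*} [Semiring R] [Semiring R'] (f : R →+* R') (I : Finset n) :
    (blockIdem R I).map f = blockIdem R' I := by
  rw [blockIdem, diagonal_map (map_zero f)]
  simp [blockIdem, Function.comp_def, apply_ite f]

theorem blockIdem_singleton (R : Type*) [Semiring R] (i : n) : blockIdem R {i} = single i i 1 := by
  ext a b
  by_cases ha : a = i <;> by_cases hb : a = b <;> simp_all [blockIdem, diagonal, single]
  all_goals grind

/-- The matrices with coefficients in `C` supported in the block `I × J`. -/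
def blockSubgroup (I J : Finset n) (C : AddSubgroup k) : AddSubgroup (Matrix n n k) where
  carrier := {x | ∀ a b, x a b ∈ C ∧ ((a ∉ I ∨ b ∉ J) → x a b = 0)}
  zero_mem' a b := ⟨C.zero_mem, fun _ => rfl⟩
  add_mem' {x y} hx hy a b := ⟨C.add_mem (hx a b).1 (hy a b).1, fun h => by
    rw [Matrix.add_apply, (hx a b).2 h, (hy a b).2 h, add_zero]⟩
  neg_mem' {x} hx a b := ⟨C.neg_mem (hx a b).1, fun h => by
    rw [Matrix.neg_apply, (hx a b).2 h, neg_zero]⟩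

theorem single_mem_blockSubgroup {I J : Finset n} {C : AddSubgroup k} {i j : n} (hi : i ∈ I) (hj : j ∈ J)
    {c : k} (hc : c ∈ C) : single i j c ∈ blockSubgroup I J C := fun a b => by
  by_cases h : i = a ∧ j = b
  · obtain ⟨rfl, rfl⟩ := h
    simp [hi, hj, hc]
  · rw [single_apply, if_neg h]
    exact ⟨C.zero_mem, fun _ => rfl⟩

theorem blockIdem_mul_mul_blockIdem {I J : Finset n} {C : AddSubgroup k} {x : Matrix n n k}
    (hx : x ∈ blockSubgroup I J C) : blockIdem k I * x * blockIdem k J = x := by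
  ext a b
  rw [mul_blockIdem_apply, blockIdem_mul_apply]
  by_cases ha : a ∈ I <;> by_cases hb : b ∈ J <;> simp [ha, hb, (hx a b).2]

instance (I J : Finset n) (C : AddSubgroup k) [Finite C] : Finite (blockSubgroup I J C) :=
  Finite.of_injective (fun x (a b : n) => (⟨x.1 a b, (x.2 a b).1⟩ : C)) fun _ _ h =>
    Subtype.ext (Matrix.ext fun a b => congrArg Subtype.val (congrFun (congrFun h a) b))

/-- The datum with blocks `I`, `{l}`, `J`. -/
def blockDatum (I J : Finset n) (l : n) (hI : l ∉ I) (hJ : l ∉ J) (hIJ : Disjoint I J)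
    (A C : AddSubgroup k) (hAC : ∀ a ∈ A, ∀ b ∈ A, a * b ∈ C) : HeisDatum (Matrix n n k) where
  e₁ := blockIdem k I
  e₂ := blockIdem k {l}
  e₃ := blockIdem k J
  e₁₁ := blockIdem_mul_self k I
  e₂₂ := blockIdem_mul_self k _
  e₃₃ := blockIdem_mul_self k J
  e₁₂ := blockIdem_mul_of_disjoint k (by simpa using hI)
  e₂₁ := blockIdem_mul_of_disjoint k (by simpa using hI)
  e₁₃ := blockIdem_mul_of_disjoint k hIJ
  e₃₁ := blockIdem_mul_of_disjoint k hIJ.symm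
  e₂₃ := blockIdem_mul_of_disjoint k (by simpa using hJ)
  e₃₂ := blockIdem_mul_of_disjoint k (by simpa using hJ)
  X := blockSubgroup I {l} A
  Y := blockSubgroup {l} J A
  Z := blockSubgroup I J C
  hX _ := blockIdem_mul_mul_blockIdem
  hY _ := blockIdem_mul_mul_blockIdem
  hZ _ := blockIdem_mul_mul_blockIdem
  mul_mem x hx y hy a b := by
    rw [Matrix.mul_apply]
    exact ⟨sum_mem fun c _ => hAC _ (hx a c).1 _ (hy c b).1, fun h => Finset.sum_eq_zero fun c _ => by
      rcases h with h | h
      · rw [(hx a c).2 (Or.inl h), zero_mul]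
      · rw [(hy c b).2 (Or.inr h), mul_zero]⟩

variable {I J : Finset n} {l : n} (hI : l ∉ I) (hJ : l ∉ J) (hIJ : Disjoint I J)
  {A C : AddSubgroup k} (hAC : ∀ a ∈ A, ∀ b ∈ A, a * b ∈ C)

theorem blockDatum_isGood (φ : k →+* k) {E E' : Matrix n n k} (hInon : I.Nonempty) (hJnon : J.Nonempty)
    (hA : 1 ∈ A) (hC : C ≤ AddSubgroup.closure {c | ∃ a ∈ A, ∃ b ∈ A, a * b = c})
    (hE : E ∈ blockSubgroup I J C) (hE₁ : E * E' = blockIdem k I) (hE₃ : E' * E = blockIdem k J) :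
    (blockDatum I J l hI hJ hIJ A C hAC).IsGood φ.mapMatrix E E' where
  inj := Matrix.map_injective φ.injective
  map_e₁ := blockIdem_map φ I
  map_e₂ := blockIdem_map φ {l}
  map_e₃ := blockIdem_map φ J
  mem := hE
  mul₁ := hE₁
  mul₃ := hE₃
  rank_one u v huv := by
    change u * blockIdem k {l} * v = 0 at huv
    change u * blockIdem k {l} = 0 ∨ blockIdem k {l} * v = 0
    by_contra! hne
    obtain ⟨h1, h2⟩ := hne
    obtain ⟨a, ha⟩ : ∃ a, u a l ≠ 0 := by
      by_contra! h
      refine h1 (Matrix.ext fun a b => ?_)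
      rw [mul_blockIdem_apply]
      split_ifs with hb
      · rw [Finset.mem_singleton.1 hb, h]; rfl
      · rfl
    obtain ⟨b, hb⟩ : ∃ b, v l b ≠ 0 := by
      by_contra! h
      refine h2 (Matrix.ext fun a b => ?_)
      rw [blockIdem_mul_apply]
      split_ifs with hb
      · rw [Finset.mem_singleton.1 hb, h]; rfl
      · rfl
    have h := congrFun (congrFun huv a) b
    rw [Matrix.mul_apply, Finset.sum_eq_single l (fun c _ hc => by
      rw [mul_blockIdem_apply, if_neg (by simpa using hc), zero_mul]) (by simp),
      mul_blockIdem_apply, if_pos (by simp)] at h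
    exact mul_ne_zero ha hb h
  scalar b hb := by
    have h1 : (1 : k) ∈ C := by simpa using hAC 1 hA 1 hA
    have hs (i) (hi : i ∈ I) (j) (hj : j ∈ J) : single i j 1 * b = b * single i j 1 := by
      have := hb _ (single_mem_blockSubgroup hi hj h1)
      rwa [RingHom.mapMatrix_apply, map_single, map_one] at this
    obtain ⟨i₀, hi₀⟩ := hInon
    obtain ⟨j₀, hj₀⟩ := hJnon
    have hd (i) (hi : i ∈ I) (j) (hj : j ∈ J) : b j j = b i i := by
      simpa [Matrix.mul_apply, single_apply] using congrFun (congrFun (hs i hi j hj) i) j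
    refine ⟨b i₀ i₀ • 1, fun t => by simp, ?_, ?_⟩
    · ext a c
      change (blockIdem k I * b * blockIdem k I) a c =
        ((b i₀ i₀ • (1 : Matrix n n k)) * blockIdem k I) a c
      rw [mul_blockIdem_apply, mul_blockIdem_apply, blockIdem_mul_apply]
      by_cases hc : c ∈ I
      · by_cases hac : a = c
        · subst hac
          simp [hc, ← hd a hc j₀ hj₀, hd i₀ hi₀ j₀ hj₀]
        · have := congrFun (congrFun (hs c hc j₀ hj₀) a) j₀
          simp only [Matrix.mul_apply, single_apply] at this
          simp [hc, hac, Ne.symm hac] at this ⊢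
          exact fun _ => this.symm
      · simp [hc]
    · ext a c
      change (blockIdem k J * b * blockIdem k J) a c =
        ((b i₀ i₀ • (1 : Matrix n n k)) * blockIdem k J) a c
      rw [mul_blockIdem_apply, mul_blockIdem_apply, blockIdem_mul_apply]
      by_cases ha : a ∈ J
      · by_cases hac : a = c
        · subst hac
          simp [ha, hd i₀ hi₀ a ha]
        · have := congrFun (congrFun (hs i₀ hi₀ a ha) i₀) c
          simp only [Matrix.mul_apply, single_apply] at this
          simp [ha, hac, Ne.symm hac] at this ⊢
          exact fun _ => this
      · by_cases hac : a = c
        · subst hac; simp [ha]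
        · simp [ha, hac]
  span z hz := by
    change z ∈ blockSubgroup I J C at hz
    rw [matrix_eq_sum_single z]
    refine sum_mem fun a _ => sum_mem fun b _ => ?_
    by_cases h : a ∈ I ∧ b ∈ J
    · have := AddSubgroup.mem_map_of_mem (singleAddMonoidHom (α := k) a b) (hC (hz a b).1)
      rw [AddMonoidHom.map_closure] at this
      refine AddSubgroup.closure_mono ?_ this
      rintro _ ⟨_, ⟨s, hs, t, ht, rfl⟩, rfl⟩
      exact ⟨single a l s, single_mem_blockSubgroup h.1 (by simp) hs, single l b t,
        single_mem_blockSubgroup (by simp) h.2 ht, by simp⟩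
    · rw [(hz a b).2 (by tauto), single_zero]
      exact zero_mem _

theorem blockDatum_blockTriangular [LinearOrder n] (hIl : ∀ i ∈ I, i < l) (hlJ : ∀ j ∈ J, l < j)
    (g : (blockDatum I J l hI hJ hIJ A C hAC).Grp) :
    (HeisDatum.Grp.toRing g : Matrix n n k).BlockTriangular id := fun a b (hab : b < a) => by
  have hx : (g.x : Matrix n n k) a b = 0 := (g.x.2 a b).2 (by
    by_contra! h
    rw [Finset.mem_singleton.1 h.2] at hab
    exact hab.not_gt (hIl a h.1))
  have hy : (g.y : Matrix n n k) a b = 0 := (g.y.2 a b).2 (by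
    by_contra! h
    rw [Finset.mem_singleton.1 h.1] at hab
    exact hab.not_gt (hlJ b h.2))
  have hz : (g.z : Matrix n n k) a b = 0 := (g.z.2 a b).2 (by
    by_contra! h
    exact hab.not_gt ((hIl a h.1).trans (hlJ b h.2)))
  rw [HeisDatum.Grp.toRing_apply, Matrix.add_apply, Matrix.add_apply, Matrix.add_apply, hx, hy, hz,
    Matrix.one_apply_ne hab.ne']
  simp

end BlockDatum

section Obstruction

theorem exists_addSubgroup_mul (p : ℕ) [Fact p.Prime] {k : Type*} [Field k] [CharP k p] (c : k) :
    ∃ A C : AddSubgroup k, Finite A ∧ Finite C ∧ 1 ∈ A ∧ c ∈ A ∧ (∀ a ∈ A, ∀ b ∈ A, a * b ∈ C) ∧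
      C ≤ AddSubgroup.closure {x | ∃ a ∈ A, ∃ b ∈ A, a * b = x} := by
  let _ : Algebra (ZMod p) k := ZMod.algebra k p
  let A : Submodule (ZMod p) k := Submodule.span (ZMod p) {1, c}
  have hA : A.FG := Submodule.fg_span (by simp)
  have hfin {B : Submodule (ZMod p) k} (hB : B.FG) : Finite B :=
    have := Module.Finite.of_fg hB
    Module.finite_of_finite (ZMod p)
  refine ⟨A.toAddSubgroup, (A * A).toAddSubgroup, hfin hA, hfin (hA.mul hA),
    Submodule.subset_span (by simp), Submodule.subset_span (by simp),
    fun a ha b hb => Submodule.mul_mem_mul ha hb, fun x hx => ?_⟩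
  refine Submodule.mul_induction_on (C := fun x => x ∈ AddSubgroup.closure _) hx
    (fun a ha b hb => AddSubgroup.subset_closure ⟨a, ha, b, hb, rfl⟩) fun x y hx hy => add_mem hx hy

theorem AddSubgroup.le_natCard_of_nsmul_eq_zero {A : Type*} [AddGroup A] {X : AddSubgroup A} [Finite X]
    {p : ℕ} [Fact p.Prime] {x : A} (hx : x ∈ X) (h0 : x ≠ 0) (hp : p • x = 0) : p ≤ Nat.card X := by
  have h1 : addOrderOf (⟨x, hx⟩ : X) = p :=
    addOrderOf_eq_prime (Subtype.ext hp) fun h => h0 (congrArg Subtype.val h)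
  exact Nat.le_of_dvd Nat.card_pos (h1 ▸ _root_.addOrderOf_dvd_natCard _)

theorem AddSubgroup.two_lt_natCard {A : Type*} [AddGroup A] {X : AddSubgroup A} [Finite X] {x y : A}
    (hx : x ∈ X) (hy : y ∈ X) (hx0 : x ≠ 0) (hy0 : y ≠ 0) (hxy : x ≠ y) : 2 < Nat.card X := by
  have := Fintype.ofFinite X
  rw [Nat.card_eq_fintype_card, Fintype.two_lt_card_iff]
  refine ⟨0, ⟨x, hx⟩, ⟨y, hy⟩, ?_, ?_, ?_⟩ <;> simpa [Subtype.ext_iff] using by tauto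

variable {p : ℕ} [Fact p.Prime] {k : Type*} [Field k] [CharP k p] {W : Type*} [CommRing W] {π : W →+* k}
  {v : k →+ W}

theorem Matrix.single_ne_zero {n R : Type*} [DecidableEq n] [Zero R] {i j : n} {c : R} (hc : c ≠ 0) :
    single i j c ≠ 0 := fun h => hc (by simpa using congrFun (congrFun h i) j)

theorem exists_ne_zero_ne_one {k : Type*} [Field k] (h : Nat.card k ≠ 2) : ∃ c : k, c ≠ 0 ∧ c ≠ 1 := by
  by_contra! h0
  refine h (Nat.card_eq_two_iff.2 ⟨0, 1, zero_ne_one, Set.eq_univ_of_forall fun c => ?_⟩)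
  rcases eq_or_ne c 0 with rfl | hc
  · simp
  · simp [h0 c hc]

/-- Every upper-triangular Galois representation over an extension of `F` lifts along `π`. -/
def LiftsTriangular (F : Type) [Field F] (π : W →+* k) (n : Type*) [Fintype n] [DecidableEq n]
    [LinearOrder n] : Prop :=
  ∀ (K : Type) [Field K] [Algebra F K]
    (ρ : (AlgebraicClosure K ≃ₐ[K] AlgebraicClosure K) →* GL n k), Smooth (AlgebraicClosure K) ρ →
    (∀ γ, (ρ γ : Matrix n n k).BlockTriangular id) →
    ∃ ρ' : (AlgebraicClosure K ≃ₐ[K] AlgebraicClosure K) →* GL n W,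
      Smooth (AlgebraicClosure K) ρ' ∧ (GeneralLinearGroup.map π).comp ρ' = ρ

variable {n : Type} [Fintype n] [LinearOrder n] {F : Type} [Field F]

theorem LiftsTriangular.exists_liftData {k : Type} [Field k] [CharP k p] {π : W →+* k} {v : k →+ W}
    (H : LiftsTriangular F π n) (h : IsW2 p π v)
    (hp : (p : F) ≠ 0) (D : HeisDatum (Matrix n n k)) [Finite D.X] [Finite D.Y] [Finite D.Z]
    (hD : ∀ g : D.Grp, (HeisDatum.Grp.toRing g : Matrix n n k).BlockTriangular id) :
    ∃ (S : Type) (_ : Fintype S) (_ : MulAction D.Grp S) (M : Type) (_ : CommGroup M) (ζ : M),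
      Nonempty (LiftData h (HeisDatum.Grp.toRing (D := D)).toHomUnits S ζ) ∧ ζ ^ p = 1 ∧
        (∀ d : M, d ^ p = 1 → ∃ i : ℕ, ζ ^ i = d) ∧ ∀ d : M, ∃ r, r ^ p = d :=
  _root_.exists_liftData h F hp _ fun K _ _ q hq =>
    H K ((HeisDatum.Grp.toRing (D := D)).toHomUnits.comp q)
      (Smooth.comp hq (HeisDatum.Grp.toRing (D := D)).toHomUnits) fun γ => hD (q γ)

theorem LiftsTriangular.false_of_ne_two {k : Type} [Field k] [CharP k p] {π : W →+* k} {v : k →+ W}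
    (H : LiftsTriangular F π n) (h : IsW2 p π v)
    (hp : (p : F) ≠ 0) (hp2 : p ≠ 2) {i l j : n} (hil : i < l) (hlj : l < j) : False := by
  obtain ⟨A, C, hA, hC, h1, -, hAC, hCA⟩ := exists_addSubgroup_mul p (1 : k)
  have h1C : (1 : k) ∈ C := by simpa using hAC 1 h1 1 h1
  let D := blockDatum {i} {j} l (by simpa using hil.ne') (by simpa using hlj.ne)
    (by simpa using (hil.trans hlj).ne) A C hAC
  have hG : D.IsGood (frobenius k p).mapMatrix (single i j 1) (single j i 1) :=
    blockDatum_isGood _ _ _ hAC _ (by simp) (by simp) h1 hCA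
      (single_mem_blockSubgroup (by simp) (by simp) h1C) (by simp [blockIdem_singleton])
      (by simp [blockIdem_singleton])
  have : Finite D.X := inferInstanceAs (Finite (blockSubgroup {i} {l} A))
  have : Finite D.Y := inferInstanceAs (Finite (blockSubgroup {l} {j} A))
  have : Finite D.Z := inferInstanceAs (Finite (blockSubgroup {i} {j} C))
  obtain ⟨S, _, _, M, _, ζ, ⟨L⟩, hζ1, hζ, hroot⟩ := H.exists_liftData h hp D
    (blockDatum_blockTriangular _ _ _ hAC (by simpa using hil) (by simpa using hlj))
  have hX : single i l 1 ∈ D.X := single_mem_blockSubgroup (by simp) (by simp) h1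
  have hY : single l j 1 ∈ D.Y := single_mem_blockSubgroup (by simp) (by simp) h1
  have hcX := AddSubgroup.le_natCard_of_nsmul_eq_zero (p := p) hX (Matrix.single_ne_zero one_ne_zero)
    (by rw [smul_single, nsmul_one, CharP.cast_eq_zero, single_zero])
  have hcY := AddSubgroup.le_natCard_of_nsmul_eq_zero (p := p) hY (Matrix.single_ne_zero one_ne_zero)
    (by rw [smul_single, nsmul_one, CharP.cast_eq_zero, single_zero])
  have hpp : 1 < p := (Fact.out : p.Prime).one_lt
  exact L.false_of_ne_two (fun _ => rfl) hG hζ1 hζ hroot (by rw [Nat.card_prod]; nlinarith) hp2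
    hil.ne (hil.trans hlj).ne hlj.ne (blockIdem_singleton k i) (blockIdem_singleton k j) hX
    (single_mem_blockSubgroup (by simp) (by simp) h1C)

theorem LiftsTriangular.false_of_card_ne_two {k : Type} [Field k] [CharP k 2] {π : W →+* k} {v : k →+ W}
    (H : LiftsTriangular F π n) (h : IsW2 2 π v)
    (hp : ((2 : ℕ) : F) ≠ 0) (hk : Nat.card k ≠ 2) {i l j : n} (hil : i < l) (hlj : l < j) : False := by
  obtain ⟨c, hc0, hc1⟩ := exists_ne_zero_ne_one hk
  obtain ⟨A, C, hA, hC, h1, hcA, hAC, hCA⟩ := exists_addSubgroup_mul 2 c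
  have h1C : (1 : k) ∈ C := by simpa using hAC 1 h1 1 h1
  have hcC : c ∈ C := by simpa using hAC 1 h1 c hcA
  have hij : Disjoint ({i} : Finset n) {j} := by simpa using (hil.trans hlj).ne
  let D := blockDatum {i} {j} l (by simpa using hil.ne') (by simpa using hlj.ne) hij A C hAC
  have hG : D.IsGood (frobenius k 2).mapMatrix (single i j 1) (single j i 1) :=
    blockDatum_isGood _ _ _ hAC _ (by simp) (by simp) h1 hCA
      (single_mem_blockSubgroup (by simp) (by simp) h1C) (by simp [blockIdem_singleton])
      (by simp [blockIdem_singleton])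
  have : Finite D.X := inferInstanceAs (Finite (blockSubgroup {i} {l} A))
  have : Finite D.Y := inferInstanceAs (Finite (blockSubgroup {l} {j} A))
  have : Finite D.Z := inferInstanceAs (Finite (blockSubgroup {i} {j} C))
  obtain ⟨S, _, _, M, _, ζ, ⟨L⟩, hζ1, hζ, hroot⟩ := H.exists_liftData h hp D
    (blockDatum_blockTriangular _ _ _ hAC (by simpa using hil) (by simpa using hlj))
  have hX {a : k} (ha : a ∈ A) : single i l a ∈ D.X := single_mem_blockSubgroup (by simp) (by simp) ha
  have hY {a : k} (ha : a ∈ A) : single l j a ∈ D.Y := single_mem_blockSubgroup (by simp) (by simp) ha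
  have h₁ : D.e₁ = single i i 1 := blockIdem_singleton k i
  have h₃ : D.e₃ = single j j 1 := blockIdem_singleton k j
  refine L.false_of_trace_ne (fun _ => rfl) hG hζ1 hζ hroot
    (AddSubgroup.two_lt_natCard (hX h1) (hX hcA) (Matrix.single_ne_zero one_ne_zero)
      (Matrix.single_ne_zero hc0)
      fun h => hc1 (by simpa using (congrFun (congrFun h i) l).symm))
    (AddSubgroup.two_lt_natCard (hY h1) (hY hcA) (Matrix.single_ne_zero one_ne_zero)
      (Matrix.single_ne_zero hc0)
      fun h => hc1 (by simpa using (congrFun (congrFun h l) j).symm))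
    (blockIdem W {i}) (blockIdem W {j}) (blockIdem_map π _) (blockIdem_map π _)
    (blockIdem_mul_of_disjoint W hij.symm) (z := single i j c) (z' := single j i c⁻¹)
    (single_mem_blockSubgroup (by simp) (by simp) hcC) ?_ ?_ ?_ ?_ ?_ ?_ ?_
  all_goals simp only [h₁, h₃]
  · simp [hc0]
  · simp [hc0]
  · simp
  · simp
  · simp
  · simp
  · simp only [trace_single_eq_same, single_mul_single_same, mul_one]
    rw [← map_one (frobenius k 2)]
    exact fun h => hc1 ((frobenius k 2).injective h).symm

theorem LiftsTriangular.false_of_five {k : Type} [Field k] [CharP k 2] [Finite k] {π : W →+* k}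
    {v : k →+ W} (H : LiftsTriangular F π n) (h : IsW2 2 π v) (hp : ((2 : ℕ) : F) ≠ 0)
    {i i' l j j' : n} (hi : i < i') (hil : i' < l) (hlj : l < j) (hj : j < j') : False := by
  have hij : Disjoint ({i, i'} : Finset n) {j, j'} := by
    rw [Finset.disjoint_left]
    intro a ha hb
    simp only [Finset.mem_insert, Finset.mem_singleton] at ha hb
    grind
  let D := blockDatum (k := k) {i, i'} {j, j'} l (by simp; grind) (by simp; grind) hij ⊤ ⊤
    fun _ _ _ _ => trivial
  have h0 := hi.ne
  have h0' := hi.ne'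
  have h1 := hj.ne
  have h1' := hj.ne'
  have h₁ : blockIdem k {i, i'} = single i i 1 + single i' i' 1 := by
    ext a b
    simp only [blockIdem, diagonal_apply, single_apply, Matrix.add_apply, Finset.mem_insert,
      Finset.mem_singleton]
    grind
  have h₃ : blockIdem k {j, j'} = single j j 1 + single j' j' 1 := by
    ext a b
    simp only [blockIdem, diagonal_apply, single_apply, Matrix.add_apply, Finset.mem_insert,
      Finset.mem_singleton]
    grind
  have hG : D.IsGood (frobenius k 2).mapMatrix (single i j 1 + single i' j' 1)
      (single j i 1 + single j' i' 1) :=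
    blockDatum_isGood (A := ⊤) (C := ⊤) _ _ _ (fun _ _ _ _ => trivial) _ (by simp) (by simp) trivial
      (fun x _ => AddSubgroup.subset_closure ⟨x, trivial, 1, trivial, mul_one x⟩)
      (add_mem (single_mem_blockSubgroup (by simp) (by simp) trivial)
        (single_mem_blockSubgroup (by simp) (by simp) trivial))
      (by simp [h₁, mul_add, add_mul, h0, h0', h1, h1'])
      (by simp [h₃, mul_add, add_mul, h0, h0', h1, h1'])
  have : Finite D.X := inferInstanceAs (Finite (blockSubgroup {i, i'} {l} ⊤))
  have : Finite D.Y := inferInstanceAs (Finite (blockSubgroup {l} {j, j'} ⊤))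
  have : Finite D.Z := inferInstanceAs (Finite (blockSubgroup {i, i'} {j, j'} ⊤))
  obtain ⟨S, _, _, M, _, ζ, ⟨L⟩, hζ1, hζ, hroot⟩ := H.exists_liftData h hp D
    (blockDatum_blockTriangular (A := ⊤) (C := ⊤) _ _ _ (fun _ _ _ _ => trivial)
      (by simp; grind) (by simp; grind))
  have hX {a : n} (ha : a ∈ ({i, i'} : Finset n)) : single a l 1 ∈ D.X :=
    single_mem_blockSubgroup ha (by simp) trivial
  have hY {b : n} (hb : b ∈ ({j, j'} : Finset n)) : single l b 1 ∈ D.Y :=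
    single_mem_blockSubgroup (by simp) hb trivial
  have h2 : (1 : k) + 1 = 0 := CharTwo.add_self_eq_zero 1
  have h3 (a b : n) : single a b (1 : k) + single a b 1 = 0 := by rw [← single_add, h2, single_zero]
  refine L.false_of_trace_ne (fun _ => rfl) hG hζ1 hζ hroot
    (AddSubgroup.two_lt_natCard (hX (a := i) (by simp)) (hX (a := i') (by simp)) (Matrix.single_ne_zero one_ne_zero)
      (Matrix.single_ne_zero one_ne_zero) fun h => by simpa [h0'] using congrFun (congrFun h i) l)
    (AddSubgroup.two_lt_natCard (hY (b := j) (by simp)) (hY (b := j') (by simp)) (Matrix.single_ne_zero one_ne_zero)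
      (Matrix.single_ne_zero one_ne_zero) fun h => by simpa [h1'] using congrFun (congrFun h l) j)
    (blockIdem W {i, i'}) (blockIdem W {j, j'}) (blockIdem_map π _) (blockIdem_map π _)
    (blockIdem_mul_of_disjoint W hij.symm) (z := single i j' 1 + single i' j 1 + single i' j' 1)
    (z' := single j i 1 + single j i' 1 + single j' i 1)
    (add_mem (add_mem (single_mem_blockSubgroup (by simp) (by simp) trivial)
      (single_mem_blockSubgroup (by simp) (by simp) trivial))
      (single_mem_blockSubgroup (by simp) (by simp) trivial)) ?_ ?_ ?_ ?_ ?_ ?_ ?_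
  all_goals
    simp only [show D.e₁ = single i i 1 + single i' i' 1 from h₁,
      show D.e₃ = single j j 1 + single j' j' 1 from h₃]
  · simp [mul_add, add_mul, h0, h0', h1, h1']
    rw [add_comm (single i i (1 : k)), add_add_add_comm, h3, zero_add, add_comm]
  · simp [mul_add, add_mul, h0, h0', h1, h1']
    rw [add_right_comm _ (single j j (1 : k)), add_right_comm _ (single j' j' (1 : k)), h3, zero_add, add_comm]
  · simp [mul_add, add_mul, h0, h0', h1, h1']
  · simp [mul_add, add_mul, h0, h0', h1, h1']
  · simp [mul_add, add_mul, h0, h0', h1, h1', add_right_comm]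
  · simp [mul_add, add_mul, h0, h0', h1, h1', add_right_comm]
  · simp [mul_add, add_mul, h0, h0', h1, h1', h2]

/-- If upper-triangular representations over all extensions of `F` lift, then one of the three
conditions of the theorem holds. -/
theorem LiftsTriangular.condition {k : Type} [Field k] [CharP k p] {π : W →+* k} {v : k →+ W}
    {m : ℕ} (H : LiftsTriangular F π (Fin m)) (h : IsW2 p π v) :
    ringChar F = p ∨ m ≤ 2 ∨ (Nat.card k = 2 ∧ m ≤ 4) := by
  by_contra! hc
  obtain ⟨hF, hm, hk⟩ := hc
  have hp : (p : F) ≠ 0 := fun h0 => by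
    rcases (Nat.dvd_prime Fact.out).1 ((ringChar.spec F p).1 h0) with h1 | h1
    · exact CharP.ringChar_ne_one h1
    · exact hF h1
  by_cases hp2 : p = 2
  · subst hp2
    by_cases hk2 : Nat.card k = 2
    · have := Nat.finite_of_card_ne_zero (α := k) (by rw [hk2]; simp)
      have hm4 := hk hk2
      exact H.false_of_five h hp (i := ⟨0, by lia⟩) (i' := ⟨1, by lia⟩) (l := ⟨2, by lia⟩)
        (j := ⟨3, by lia⟩) (j' := ⟨4, by lia⟩) (by simp) (by simp) (by simp) (by simp)
    · exact H.false_of_card_ne_two h hp hk2 (i := ⟨0, by lia⟩) (l := ⟨1, by lia⟩) (j := ⟨2, by lia⟩)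
        (by simp) (by simp)
  · exact H.false_of_ne_two h hp hp2 (i := ⟨0, by lia⟩) (l := ⟨1, by lia⟩) (j := ⟨2, by lia⟩)
      (by simp) (by simp)

end Obstruction

/-- The solution of the lifting problem for Galois representations:
(1) for every field extension `K/F` every continuous homomorphism `Γ_K → GL_n(k)` lifts to
`GL_n(W₂(k))`; (2) for every field extension `K/F` every continuous homomorphism
`Γ_K → B_n(k)` lifts to `B_n(W₂(k))`; (3) `char F = p`, or `n ≤ 2`, or `|k| = 2` and
`n ≤ 4`; these three assertions are equivalent. -/
theorem lifting_galois_representations_tfae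
    (p : ℕ) [Fact p.Prime] (F : Type) [Field F] (k : Type) [Field k] [CharP k p]
    (n : ℕ) (hn : 0 < n) :
    List.TFAE
      [ ∀ (K : Type) [Field K] [Algebra F K]
          (ρ : Field.absoluteGaloisGroup K →* GL (Fin n) k), Continuous[_, ⊥] ⇑ρ →
          ∃ ρ' : Field.absoluteGaloisGroup K →* GL (Fin n) (TruncatedWittVector p 2 k),
            Continuous[_, ⊥] ⇑ρ' ∧
              (Matrix.GeneralLinearGroup.map (wittReduce p k)).comp ρ' = ρ,
        ∀ (K : Type) [Field K] [Algebra F K]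
          (ρ : Field.absoluteGaloisGroup K →* BorelSubgroup n k), Continuous[_, ⊥] ⇑ρ →
          ∃ ρ' : Field.absoluteGaloisGroup K →* BorelSubgroup n (TruncatedWittVector p 2 k),
            Continuous[_, ⊥] ⇑ρ' ∧ (BorelSubgroup.map (wittReduce p k)).comp ρ' = ρ,
        ringChar F = p ∨ n ≤ 2 ∨ (Nat.card k = 2 ∧ n ≤ 4) ] := by
  tfae_have 3 → 1 := fun h K _ _ ρ hρ => exists_lift_gl_of_condition p n h K ρ hρ
  tfae_have 3 → 2 := fun h K _ _ ρ hρ => exists_lift_borel_of_condition p n h K ρ hρ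
  tfae_have 1 → 3 := fun H => by
    refine LiftsTriangular.condition (π := wittReduce p k) (fun K _ _ ρ hρ _ => ?_) (isW2_wittReduce p k)
    obtain ⟨ρ', h1, h2⟩ := H K ρ ((Gal.smooth_iff_continuous _).2 hρ)
    exact ⟨ρ', (Gal.smooth_iff_continuous _).1 h1, h2⟩
  tfae_have 2 → 3 := fun H => by
    refine LiftsTriangular.condition (π := wittReduce p k) (fun K _ _ ρ hρ hB => ?_) (isW2_wittReduce p k)
    obtain ⟨ρ', h1, h2⟩ := H K (ρ.codRestrict (BorelSubgroup n k) hB)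
      ((Gal.smooth_iff_continuous _).2 (Smooth.congr_inj Subtype.val_injective hρ))
    refine ⟨(BorelSubgroup n _).subtype.comp ρ',
      Smooth.comp ((Gal.smooth_iff_continuous _).1 h1) (BorelSubgroup n _).subtype, ?_⟩
    ext1 γ
    exact congrArg Subtype.val (DFunLike.congr_fun h2 γ)
  tfae_finish
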